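/- If a measurable set A ⊂ ℝ^n of finite perimeter satisfies P(A, B_r) ≥ (n/r)·|A ∩ B_r| whenever |A ∩ B_r|/|B_r| ≤ δ(n), where δ(n) = |D_1|/|B_1| and D_1 is the region in the unit ball bounded by a hemispherical cap of radius one orthogonal to ∂B_1. Equivalently: under the hypothesis |A ∩ B_r|/|B_r| ≤ δ(n), one has P(A, B_r)/H^{n-1}(∂B_r) ≥ |A ∩ B_r|/|B_r|. -/

import Mathlib

open MeasureTheory Metric Set Filter
open scoped ENNReal Topology symmDiff

noncomputable section

variable {n : ℕ}

/-- `E` has Lebesgue density `d` at `x`. -/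
def HasDensity (E : Set (EuclideanSpace ℝ (Fin n))) (x : EuclideanSpace ℝ (Fin n))
    (d : ℝ≥0∞) : Prop :=
  Tendsto (fun r : ℝ => volume (E ∩ ball x r) / volume (ball x r)) (𝓝[>] 0) (𝓝 d)

/-- Measure-theoretic interior: points of density 1. -/
def mInterior (E : Set (EuclideanSpace ℝ (Fin n))) : Set (EuclideanSpace ℝ (Fin n)) :=
  {x | HasDensity E x 1}

/-- Measure-theoretic exterior: points of density 0. -/
def mExterior (E : Set (EuclideanSpace ℝ (Fin n))) : Set (EuclideanSpace ℝ (Fin n)) :=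
  {x | HasDensity E x 0}

/-- Measure-theoretic boundary. -/
def mBoundary (E : Set (EuclideanSpace ℝ (Fin n))) : Set (EuclideanSpace ℝ (Fin n)) :=
  (mInterior E ∪ mExterior E)ᶜ

/-- Measure-theoretic closure. -/
def mClosure (E : Set (EuclideanSpace ℝ (Fin n))) : Set (EuclideanSpace ℝ (Fin n)) :=
  (mExterior E)ᶜ

/-- Relative perimeter of `E` in `U`, via `H^{n-1}` of the measure-theoretic boundary. -/
def perim (E U : Set (EuclideanSpace ℝ (Fin n))) : ℝ≥0∞ :=
  μH[(n : ℝ) - 1] (mBoundary E ∩ U)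

def HasFinitePerimeter (E U : Set (EuclideanSpace ℝ (Fin n))) : Prop :=
  MeasurableSet E ∧ perim E U < ⊤

/-- `A ⊂⊂ U`. -/
def CpctIn (A U : Set (EuclideanSpace ℝ (Fin n))) : Prop :=
  IsCompact (closure A) ∧ closure A ⊆ U

def SubMinimizing (E U : Set (EuclideanSpace ℝ (Fin n))) : Prop :=
  ∀ F : Set (EuclideanSpace ℝ (Fin n)), MeasurableSet F →
    CpctIn (E ∆ F) U → perim E U ≤ perim (E ∩ F) U

def SuperMinimizing (E U : Set (EuclideanSpace ℝ (Fin n))) : Prop :=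
  ∀ F : Set (EuclideanSpace ℝ (Fin n)), MeasurableSet F →
    CpctIn (E ∆ F) U → perim E U ≤ perim (E ∪ F) U

def Minimizing (E U : Set (EuclideanSpace ℝ (Fin n))) : Prop :=
  ∀ F : Set (EuclideanSpace ℝ (Fin n)), MeasurableSet F →
    CpctIn (E ∆ F) U → perim E U ≤ perim F U

/-- The normalized representative: contains all density-1 points, no density-0 points. -/
def Normalized (E : Set (EuclideanSpace ℝ (Fin n))) : Prop :=
  mInterior E ⊆ E ∧ Disjoint E (mExterior E)

/-- The region in the unit ball bounded by a unit-radius spherical cap orthogonal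
to the unit sphere: intersection of the unit ball with a unit ball whose center is
at distance `√2`. -/
def capRegion (n : ℕ) (hn : 0 < n) : Set (EuclideanSpace ℝ (Fin n)) :=
  ball 0 1 ∩ ball (EuclideanSpace.single (⟨0, hn⟩ : Fin n) (Real.sqrt 2)) 1

/-- The dimensional constant `δ(n)`. -/
def deltaConst (n : ℕ) (hn : 0 < n) : ℝ≥0∞ :=
  volume (capRegion n hn) / volume (ball (0 : EuclideanSpace ℝ (Fin n)) 1)


/-- Orthogonal coordinates adapted to a unit vector. -/
lemma exists_frame {m : ℕ} (u : EuclideanSpace ℝ (Fin (m+1))) (hu : ‖u‖ = 1) :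
    ∃ (Φ : ℝ × EuclideanSpace ℝ (Fin m) ≃ᵐ EuclideanSpace ℝ (Fin (m+1)))
      (ι : EuclideanSpace ℝ (Fin m) →ₗᵢ[ℝ] EuclideanSpace ℝ (Fin (m+1))),
      MeasurePreserving Φ ∧ (∀ t y, Φ (t, y) = t • u + ι y) ∧ (∀ y, inner ℝ u (ι y) = 0) := by
  classical
  have hfr : Module.finrank ℝ (WithLp 2 (ℝ × EuclideanSpace ℝ (Fin m))) = m + 1 := by
    have : Module.finrank ℝ (WithLp 2 (ℝ × EuclideanSpace ℝ (Fin m))) = Module.finrank ℝ (ℝ × EuclideanSpace ℝ (Fin m)) :=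
      (WithLp.linearEquiv 2 ℝ (ℝ × EuclideanSpace ℝ (Fin m))).finrank_eq
    rw [this]; simp [Module.finrank_prod, add_comm]
  let L0 : WithLp 2 (ℝ × EuclideanSpace ℝ (Fin m)) ≃ₗᵢ[ℝ] EuclideanSpace ℝ (Fin (m+1)) :=
    ((stdOrthonormalBasis ℝ (WithLp 2 (ℝ × EuclideanSpace ℝ (Fin m)))).reindex (finCongr hfr)).repr
  let e : WithLp 2 (ℝ × EuclideanSpace ℝ (Fin m)) := WithLp.toLp 2 ((1:ℝ), (0 : EuclideanSpace ℝ (Fin m)))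
  have he : ‖e‖ = 1 := by
    simp [e]
  have hL0e : ‖L0 e‖ = ‖u‖ := by rw [L0.norm_map, he, hu]
  let L : WithLp 2 (ℝ × EuclideanSpace ℝ (Fin m)) ≃ₗᵢ[ℝ] EuclideanSpace ℝ (Fin (m+1)) :=
    L0.trans (Submodule.reflection (ℝ ∙ (L0 e - u))ᗮ)
  have hLe : L e = u := by
    simp only [L, LinearIsometryEquiv.trans_apply]
    exact Submodule.reflection_sub hL0e
  let ι : EuclideanSpace ℝ (Fin m) →ₗᵢ[ℝ] EuclideanSpace ℝ (Fin (m+1)) :=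
    { toFun := fun y => L (WithLp.toLp 2 ((0:ℝ), y))
      map_add' := by intro x y; rw [← map_add]; congr 1; apply (WithLp.ofLp_injective 2); ext <;> simp
      map_smul' := by intro c x; rw [← map_smul]; congr 1; apply (WithLp.ofLp_injective 2); ext <;> simp
      norm_map' := by intro x; simp }
  let Φ : ℝ × EuclideanSpace ℝ (Fin m) ≃ᵐ EuclideanSpace ℝ (Fin (m+1)) :=
    (MeasurableEquiv.toLp 2 (ℝ × EuclideanSpace ℝ (Fin m))).trans L.toMeasurableEquiv
  refine ⟨Φ, ι, ?_, ?_, ?_⟩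
  · exact L.measurePreserving.comp (WithLp.volume_preserving_toLp _ _)
  · intro t y
    have h1 : (WithLp.toLp 2 (t, y) : WithLp 2 (ℝ × EuclideanSpace ℝ (Fin m))) = t • e + WithLp.toLp 2 ((0:ℝ), y) := by
      simp only [e]; rw [← WithLp.toLp_smul, ← WithLp.toLp_add]; simp
    change L (WithLp.toLp 2 (t, y)) = t • u + L (WithLp.toLp 2 ((0:ℝ), y))
    rw [h1, map_add, map_smul, hLe]
  · intro y
    change inner ℝ u (L (WithLp.toLp 2 ((0:ℝ), y))) = 0
    rw [← hLe, L.inner_map_map]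
    simp [e]

lemma frame_norm_sq {m : ℕ} {u : EuclideanSpace ℝ (Fin (m+1))} (hu : ‖u‖ = 1)
    {ι : EuclideanSpace ℝ (Fin m) →ₗᵢ[ℝ] EuclideanSpace ℝ (Fin (m+1))}
    (hι : ∀ y, inner ℝ u (ι y) = 0) (t : ℝ) (y : EuclideanSpace ℝ (Fin m)) :
    ‖t • u + ι y‖ ^ 2 = t ^ 2 + ‖y‖ ^ 2 := by
  rw [norm_add_sq_real, inner_smul_left, hι]
  simp [norm_smul, hu]

lemma exists_hcst (m : ℕ) : ∃ c : ℝ≥0∞, c ≠ 0 ∧ c ≠ ⊤ ∧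
    (μH[(m:ℝ)] : Measure (EuclideanSpace ℝ (Fin m))) = c • volume := by
  have h : Measure.IsAddHaarMeasure (μH[(m:ℝ)] : Measure (EuclideanSpace ℝ (Fin m))) := by
    have := isAddHaarMeasure_hausdorffMeasure (E := EuclideanSpace ℝ (Fin m))
    simpa using this
  have hc := Measure.isAddLeftInvariant_eq_smul (μH[(m:ℝ)] : Measure (EuclideanSpace ℝ (Fin m))) volume
  have hp := Measure.addHaarScalarFactor_pos_of_isAddHaarMeasure (μH[(m:ℝ)] : Measure (EuclideanSpace ℝ (Fin m))) volume
  exact ⟨_, by simpa using hp.ne', ENNReal.coe_ne_top, hc⟩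

/-- The constant relating Hausdorff measure and Lebesgue measure. -/
def hcst (m : ℕ) : ℝ≥0∞ := (exists_hcst m).choose

lemma hcst_ne_zero (m : ℕ) : hcst m ≠ 0 := (exists_hcst m).choose_spec.1
lemma hcst_ne_top (m : ℕ) : hcst m ≠ ⊤ := (exists_hcst m).choose_spec.2.1
lemma hausdorff_eq (m : ℕ) : (μH[(m:ℝ)] : Measure (EuclideanSpace ℝ (Fin m))) = hcst m • volume :=
  (exists_hcst m).choose_spec.2.2

lemma frame_proj_lipschitz {m : ℕ} {u : EuclideanSpace ℝ (Fin (m+1))} (hu : ‖u‖ = 1)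
    {Φ : ℝ × EuclideanSpace ℝ (Fin m) ≃ᵐ EuclideanSpace ℝ (Fin (m+1))}
    {ι : EuclideanSpace ℝ (Fin m) →ₗᵢ[ℝ] EuclideanSpace ℝ (Fin (m+1))}
    (hΦ : ∀ t y, Φ (t, y) = t • u + ι y) (hι : ∀ y, inner ℝ u (ι y) = 0) :
    LipschitzWith 1 (fun z => (Φ.symm z).2) := by
  refine LipschitzWith.of_dist_le_mul ?_
  intro z w
  obtain ⟨⟨t, y⟩, rfl⟩ := Φ.surjective z
  obtain ⟨⟨t', y'⟩, rfl⟩ := Φ.surjective w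
  simp only [MeasurableEquiv.symm_apply_apply, NNReal.coe_one, one_mul]
  rw [dist_eq_norm, dist_eq_norm, hΦ, hΦ]
  have h : t • u + ι y - (t' • u + ι y') = (t - t') • u + ι (y - y') := by
    rw [map_sub, sub_smul]; abel
  rw [h]
  apply le_of_sq_le_sq _ (norm_nonneg _)
  rw [frame_norm_sq hu hι]
  nlinarith [sq_nonneg (t - t')]

lemma vol_proj_le {m : ℕ} {f : EuclideanSpace ℝ (Fin (m+1)) → EuclideanSpace ℝ (Fin m)}
    (hf : LipschitzWith 1 f) (T : Set (EuclideanSpace ℝ (Fin (m+1)))) :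
    volume (f '' T) ≤ (hcst m)⁻¹ * μH[(m:ℝ)] T := by
  have h1 : μH[(m:ℝ)] (f '' T) ≤ μH[(m:ℝ)] T := by
    have := hf.hausdorffMeasure_image_le (d := (m:ℝ)) (by positivity) T
    simpa using this
  rw [hausdorff_eq] at h1
  simp only [Measure.smul_apply, smul_eq_mul] at h1
  rw [mul_comm, ← div_eq_mul_inv, ENNReal.le_div_iff_mul_le (Or.inl (hcst_ne_zero m)) (Or.inl (hcst_ne_top m)), mul_comm]
  exact h1

/-- Part II -/
lemma volume_sweep_le {m : ℕ} (u : EuclideanSpace ℝ (Fin (m+1))) (hu : ‖u‖ = 1) (h : ℝ) (hh : 0 < h)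
    (T : Set (EuclideanSpace ℝ (Fin (m+1)))) :
    volume {z | ∃ τ ∈ Icc 0 h, z + τ • u ∈ T} ≤ ENNReal.ofReal h * ((hcst m)⁻¹ * μH[(m:ℝ)] T) := by
  obtain ⟨Φ, ι, hmp, hΦ, hι⟩ := exists_frame u hu
  by_cases hT : μH[(m:ℝ)] T = ⊤
  · rw [hT, ENNReal.mul_top (ENNReal.inv_ne_zero.2 (hcst_ne_top m)), ENNReal.mul_top]
    · exact le_top
    · simpa using hh
  have key : ∀ ρ : ℝ, 0 < ρ → volume {z | ∃ τ ∈ Icc 0 h, z + τ • u ∈ T} ≤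
      ENNReal.ofReal (h + ρ) * ((hcst m)⁻¹ * μH[(m:ℝ)] T) := by
    intro ρ hρ
    let Q : ℤ → Set (EuclideanSpace ℝ (Fin (m+1))) := fun k => (fun z => inner ℝ u z) ⁻¹' (Ico (k * ρ) ((k+1) * ρ))
    have hQm : ∀ k, MeasurableSet (Q k) := fun k => by
      apply measurableSet_Ico.preimage
      fun_prop
    have hQd : Pairwise (Function.onFun Disjoint Q) := by
      intro i j hij
      rw [Function.onFun, Set.disjoint_left]
      intro z hz hz'
      simp only [Q, mem_preimage, mem_Ico] at hz hz'
      apply hij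
      have h1 : (i:ℝ) < j + 1 := by
        by_contra hcon; push Not at hcon; nlinarith
      have h2 : (j:ℝ) < i + 1 := by
        by_contra hcon; push Not at hcon; nlinarith
      have h1' : i < j + 1 := by exact_mod_cast h1
      have h2' : j < i + 1 := by exact_mod_cast h2
      omega
    have hQu : ⋃ k, Q k = univ := by
      rw [eq_univ_iff_forall]
      intro z
      rw [mem_iUnion]
      refine ⟨⌊inner ℝ u z / ρ⌋, ?_⟩
      simp only [Q, mem_preimage, mem_Ico]
      constructor
      · have := Int.floor_le (inner ℝ u z / ρ)
        rwa [le_div_iff₀ hρ] at this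
      · have := Int.lt_floor_add_one (inner ℝ u z / ρ)
        rwa [div_lt_iff₀ hρ] at this
    have hsum : μH[(m:ℝ)] T = ∑' k, μH[(m:ℝ)] (Q k ∩ T) := by
      have h1 := measure_iUnion (μ := (μH[(m:ℝ)]).restrict T) hQd hQm
      rw [hQu, Measure.restrict_apply_univ] at h1
      rw [h1]
      congr 1; ext k
      rw [Measure.restrict_apply (hQm k)]
    have hcover : {z | ∃ τ ∈ Icc 0 h, z + τ • u ∈ T} ⊆ ⋃ k : ℤ,
        Φ '' (Icc (k * ρ - h) ((k+1) * ρ) ×ˢ ((fun z => (Φ.symm z).2) '' (Q k ∩ T))) := by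
      rintro z ⟨τ, hτ, hz⟩
      have : z + τ • u ∈ ⋃ k, Q k := by rw [hQu]; trivial
      obtain ⟨k, hk⟩ := mem_iUnion.1 this
      rw [mem_iUnion]
      refine ⟨k, ?_⟩
      obtain ⟨⟨t, y⟩, rfl⟩ := Φ.surjective z
      have hshift : Φ (t, y) + τ • u = Φ (t + τ, y) := by rw [hΦ, hΦ, add_smul]; abel
      refine ⟨(t, y), ⟨?_, ?_⟩, rfl⟩
      · have hin : inner ℝ u (Φ (t, y) + τ • u) = t + τ := by
          rw [hshift, hΦ, inner_add_right, hι, inner_smul_right, real_inner_self_eq_norm_sq, hu]; simp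
        simp only [Q, mem_preimage, mem_Ico] at hk
        rw [hin] at hk
        constructor <;> simp only [mem_Icc] at hτ ⊢ <;> linarith [hτ.1, hτ.2, hk.1, hk.2]
      · refine ⟨Φ (t, y) + τ • u, ⟨hk, hz⟩, ?_⟩
        simp [hshift]
    calc volume {z | ∃ τ ∈ Icc 0 h, z + τ • u ∈ T} ≤ _ := measure_mono hcover
      _ ≤ ∑' k : ℤ, volume (Φ '' (Icc (k * ρ - h) ((k+1) * ρ) ×ˢ ((fun z => (Φ.symm z).2) '' (Q k ∩ T)))) := measure_iUnion_le _
      _ ≤ ∑' k : ℤ, ENNReal.ofReal (h + ρ) * ((hcst m)⁻¹ * μH[(m:ℝ)] (Q k ∩ T)) := by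
          apply ENNReal.tsum_le_tsum
          intro k
          rw [← MeasurableEquiv.preimage_symm, (hmp.symm Φ).measure_preimage_equiv, Measure.volume_eq_prod, Measure.prod_prod, Real.volume_Icc]
          gcongr
          · apply le_of_eq; ring
          · exact vol_proj_le (frame_proj_lipschitz hu hΦ hι) _
      _ = _ := by
          rw [ENNReal.tsum_mul_left, ENNReal.tsum_mul_left, hsum]
  have hfin : (hcst m)⁻¹ * μH[(m:ℝ)] T ≠ ⊤ := ENNReal.mul_ne_top (ENNReal.inv_ne_top.2 (hcst_ne_zero m)) hT
  have hlim : Tendsto (fun ρ : ℝ => ENNReal.ofReal (h + ρ) * ((hcst m)⁻¹ * μH[(m:ℝ)] T)) (𝓝[>] 0)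
      (𝓝 (ENNReal.ofReal (h + 0) * ((hcst m)⁻¹ * μH[(m:ℝ)] T))) := by
    apply ENNReal.Tendsto.mul_const _ (Or.inr hfin)
    apply (ENNReal.continuous_ofReal.tendsto _).comp
    exact (tendsto_const_nhds.add tendsto_id).mono_left nhdsWithin_le_nhds
  rw [add_zero] at hlim
  refine ge_of_tendsto hlim ?_
  filter_upwards [self_mem_nhdsWithin] with ρ hρ using key ρ hρ

/-- Weighted version of Part II. -/
lemma lintegral_sweep_le {m : ℕ} (u : EuclideanSpace ℝ (Fin (m+1))) (hu : ‖u‖ = 1) (h : ℝ) (hh : 0 < h)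
    (S : Set (EuclideanSpace ℝ (Fin (m+1)))) (η : EuclideanSpace ℝ (Fin (m+1)) → ℝ) (L : NNReal)
    (hL : LipschitzWith L η) (h0 : ∀ z, 0 ≤ η z) :
    ∫⁻ z in {z | ∃ τ ∈ Icc 0 h, z + τ • u ∈ S}, ENNReal.ofReal (η z) ≤
      ENNReal.ofReal h * ((hcst m)⁻¹ * ∫⁻ z in S, ENNReal.ofReal (η z + L * h) ∂μH[(m:ℝ)]) := by
  have hm : Measurable η := hL.continuous.measurable
  have hinv : (hcst m)⁻¹ ≠ ⊤ := ENNReal.inv_ne_top.2 (hcst_ne_zero m)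
  rw [lintegral_eq_lintegral_meas_lt _ (Eventually.of_forall h0) hm.aemeasurable,
    lintegral_eq_lintegral_meas_lt _ (Eventually.of_forall (fun z => by have := h0 z; positivity)) (hm.add_const _).aemeasurable,
    ← lintegral_const_mul' _ _ hinv, ← lintegral_const_mul' _ _ ENNReal.ofReal_ne_top]
  apply lintegral_mono
  intro t
  beta_reduce
  rw [Measure.restrict_apply (measurableSet_lt measurable_const hm),
    Measure.restrict_apply (measurableSet_lt measurable_const (hm.add_const _))]
  refine le_trans (measure_mono ?_) (volume_sweep_le u hu h hh _)
  rintro z ⟨hz, τ, hτ, hs⟩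
  refine ⟨τ, hτ, ?_, hs⟩
  simp only [mem_setOf_eq] at hz ⊢
  have h1 := hL.dist_le_mul z (z + τ • u)
  have h2 : dist z (z + τ • u) = τ := by
    simp [norm_smul, hu, abs_of_nonneg hτ.1]
  rw [h2, Real.dist_eq] at h1
  have h3 := (abs_le.1 h1).2
  have h4 : (L:ℝ) * τ ≤ L * h := by gcongr; exact hτ.2
  linarith

/-- Points where the density of `A` is uniformly small at scales below `1/(k+1)`. -/
def lowDens (A : Set (EuclideanSpace ℝ (Fin n))) (η : ℝ≥0∞) (k : ℕ) : Set (EuclideanSpace ℝ (Fin n)) :=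
  {x | ∀ r ∈ Ioo (0:ℝ) (1 / ((k:ℝ) + 1)), volume (A ∩ ball x r) ≤ η * volume (ball x r)}

lemma lowDens_mono (A : Set (EuclideanSpace ℝ (Fin n))) (η : ℝ≥0∞) {k l : ℕ} (hkl : k ≤ l) :
    lowDens A η k ⊆ lowDens A η l := by
  intro x hx r hr
  refine hx r ⟨hr.1, hr.2.trans_le ?_⟩
  gcongr

lemma vol_ball_pos (x : EuclideanSpace ℝ (Fin n)) {r : ℝ} (hr : 0 < r) : volume (ball x r) ≠ 0 :=
  (measure_ball_pos volume x hr).ne'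

lemma vol_ball_ne_top (x : EuclideanSpace ℝ (Fin n)) (r : ℝ) : volume (ball x r) ≠ ⊤ :=
  measure_ball_lt_top.ne

lemma isClosed_lowDens (A : Set (EuclideanSpace ℝ (Fin n))) (η : ℝ≥0∞) (k : ℕ) :
    IsClosed (lowDens A η k) := by
  rw [← isSeqClosed_iff_isClosed]
  intro x y hx hxy r hr
  have hun : ball y r = ⋃ j : ℕ, ball y (r - 1 / ((j:ℝ) + 1)) := by
    ext z
    simp only [mem_ball, mem_iUnion]
    constructor
    · intro hz
      obtain ⟨j, hj⟩ := exists_nat_one_div_lt (sub_pos.2 hz)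
      exact ⟨j, by linarith⟩
    · rintro ⟨j, hj⟩
      have : (0:ℝ) < 1 / ((j:ℝ) + 1) := by positivity
      linarith
  have hmono : Monotone (fun j : ℕ => A ∩ ball y (r - 1 / ((j:ℝ) + 1))) := by
    intro i j hij
    apply inter_subset_inter_right
    apply ball_subset_ball
    have : 1 / ((j:ℝ) + 1) ≤ 1 / ((i:ℝ) + 1) := by gcongr
    linarith
  rw [hun, inter_iUnion, hmono.measure_iUnion, ← hun]
  apply iSup_le
  intro j
  have hpos : (0:ℝ) < 1 / ((j:ℝ) + 1) := by positivity
  obtain ⟨N, hN⟩ := (Metric.tendsto_atTop.1 hxy) _ hpos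
  have h1 := hN N le_rfl
  calc volume (A ∩ ball y (r - 1 / ((j:ℝ) + 1))) ≤ volume (A ∩ ball (x N) r) := by
        apply measure_mono
        apply inter_subset_inter_right
        apply ball_subset_ball'
        rw [dist_comm]; linarith
    _ ≤ η * volume (ball (x N) r) := hx N r hr
    _ = η * volume (ball y r) := by
        rw [Measure.addHaar_ball_center, Measure.addHaar_ball_center _ y]

lemma mExterior_subset_lowDens (A : Set (EuclideanSpace ℝ (Fin n))) {η : ℝ≥0∞} (hη : 0 < η) :
    mExterior A ⊆ ⋃ k, lowDens A η k := by
  intro x hx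
  have h1 : ∀ᶠ r : ℝ in 𝓝[>] 0, volume (A ∩ ball x r) / volume (ball x r) < η :=
    (tendsto_order.1 (show Tendsto _ _ _ from hx)).2 η hη
  rw [eventually_nhdsWithin_iff, Metric.eventually_nhds_iff] at h1
  obtain ⟨ε, hε, h⟩ := h1
  obtain ⟨k, hk⟩ := exists_nat_one_div_lt hε
  rw [mem_iUnion]
  refine ⟨k, fun r hr => ?_⟩
  have h2 := h (y := r) (by rw [Real.dist_eq, sub_zero, abs_of_pos hr.1]; linarith [hr.2]) hr.1
  exact (ENNReal.div_le_iff (vol_ball_pos x hr.1) (vol_ball_ne_top x r)).1 h2.le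

lemma lowDens_disjoint (A : Set (EuclideanSpace ℝ (Fin n))) {η : ℝ≥0∞} (hη : η < 1) (k : ℕ)
    {x : EuclideanSpace ℝ (Fin n)} (hx : x ∈ lowDens A η k) : x ∉ mInterior A := by
  intro hI
  have h1 : ∀ᶠ r : ℝ in 𝓝[>] 0, η < volume (A ∩ ball x r) / volume (ball x r) :=
    (tendsto_order.1 (show Tendsto _ _ _ from hI)).1 η hη
  have h2 : ∀ᶠ r : ℝ in 𝓝[>] 0, r ∈ Ioo (0:ℝ) (1 / ((k:ℝ) + 1)) := Ioo_mem_nhdsGT (by positivity)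
  obtain ⟨r, hr1, hr2⟩ := (h1.and h2).exists
  exact absurd ((ENNReal.div_le_iff (vol_ball_pos x hr2.1) (vol_ball_ne_top x r)).2 (hx r hr2)) (not_le.2 hr1)

lemma ratio_compl {A : Set (EuclideanSpace ℝ (Fin n))} (hA : MeasurableSet A) (x : EuclideanSpace ℝ (Fin n))
    {r : ℝ} (hr : 0 < r) : volume (Aᶜ ∩ ball x r) / volume (ball x r) =
      1 - volume (A ∩ ball x r) / volume (ball x r) := by
  have h : volume (A ∩ ball x r) + volume (Aᶜ ∩ ball x r) = volume (ball x r) := by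
    rw [inter_comm A, inter_comm Aᶜ]
    exact measure_inter_add_sdiff _ hA
  have h2 : volume (A ∩ ball x r) / volume (ball x r) + volume (Aᶜ ∩ ball x r) / volume (ball x r) = 1 := by
    rw [← ENNReal.add_div, h, ENNReal.div_self (vol_ball_pos x hr) (vol_ball_ne_top x r)]
  refine ENNReal.eq_sub_of_add_eq ?_ (by rw [add_comm]; exact h2)
  intro htop
  rw [htop] at h2; simp at h2

lemma HasDensity.compl {A : Set (EuclideanSpace ℝ (Fin n))} (hA : MeasurableSet A) {x : EuclideanSpace ℝ (Fin n)}
    {d : ℝ≥0∞} (h : HasDensity A x d) : HasDensity Aᶜ x (1 - d) := by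
  have h1 : Tendsto (fun r : ℝ => 1 - volume (A ∩ ball x r) / volume (ball x r)) (𝓝[>] 0) (𝓝 (1 - d)) :=
    ENNReal.Tendsto.sub tendsto_const_nhds h (Or.inl ENNReal.one_ne_top)
  refine h1.congr' ?_
  filter_upwards [self_mem_nhdsWithin] with r hr using (ratio_compl hA x hr).symm

lemma mInterior_compl {A : Set (EuclideanSpace ℝ (Fin n))} (hA : MeasurableSet A) : mInterior Aᶜ = mExterior A := by
  ext x
  constructor
  · intro h
    have := HasDensity.compl hA.compl (show HasDensity Aᶜ x 1 from h)
    simpa [mExterior] using this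
  · intro h
    have := HasDensity.compl hA (show HasDensity A x 0 from h)
    simpa [mInterior] using this

lemma mExterior_compl {A : Set (EuclideanSpace ℝ (Fin n))} (hA : MeasurableSet A) : mExterior Aᶜ = mInterior A := by
  rw [← mInterior_compl hA.compl, compl_compl]

lemma ae_density {A : Set (EuclideanSpace ℝ (Fin n))} (hA : MeasurableSet A) :
    ∀ᵐ x, (x ∈ A → x ∈ mInterior A) ∧ (x ∉ A → x ∈ mExterior A) := by
  filter_upwards [Besicovitch.ae_tendsto_measure_inter_div_of_measurableSet volume hA] with x hx
  have h1 : HasDensity A x (A.indicator 1 x) := by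
    refine hx.congr' ?_
    filter_upwards [self_mem_nhdsWithin] with r hr
    have hr0 : r ≠ 0 := (show (0:ℝ) < r from hr).ne'
    have hae : (closedBall x r : Set (EuclideanSpace ℝ (Fin n))) =ᵐ[volume] ball x r := by
      rw [← ball_union_sphere]
      have : volume (sphere x r) = 0 := Measure.addHaar_sphere_of_ne_zero volume x hr0
      exact union_ae_eq_left_of_ae_eq_empty (by rwa [ae_eq_empty])
    rw [measure_congr hae, measure_congr ((ae_eq_refl A).inter hae)]
  constructor
  · intro hxA; simpa [hxA, mInterior] using h1
  · intro hxA; simpa [hxA, mExterior] using h1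

lemma mInterior_diff_null {A : Set (EuclideanSpace ℝ (Fin n))} (hA : MeasurableSet A) :
    volume (mInterior A \ A) = 0 := by
  refine measure_mono_null ?_ (show volume {x | ¬ ((x ∈ A → x ∈ mInterior A) ∧ (x ∉ A → x ∈ mExterior A))} = 0 from ae_density hA)
  rintro x ⟨hI, hxA⟩ ⟨_, h⟩
  have h0 := h hxA
  have := tendsto_nhds_unique (show Tendsto _ _ _ from hI) h0
  simp at this

lemma slice_null {m : ℕ} {B : Set (EuclideanSpace ℝ (Fin (m+1)))} (hB : MeasurableSet B)
    (u : EuclideanSpace ℝ (Fin (m+1))) (hu : ‖u‖ = 1) (k : ℕ) {η : ℝ≥0∞}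
    (hη : η * (4 ^ (m+1) * volume (ball (0:EuclideanSpace ℝ (Fin (m+1))) 1)) <
      volume (ball (0:EuclideanSpace ℝ (Fin m)) 1) / 4) :
    volume {z | ∃ t : ℝ, z + t • u ∈ lowDens B η k ∧
      ∀ τ ∈ Ioo (0:ℝ) (1 / ((k:ℝ)+1)), z + t • u + τ • u ∈ mInterior B} = 0 := by
  obtain ⟨Φ, ι, hmp, hΦ, hι⟩ := exists_frame u hu
  set Z : Set (EuclideanSpace ℝ (Fin (m+1))) := {p | p ∈ lowDens B η k ∧
      ∀ τ ∈ Ioo (0:ℝ) (1 / ((k:ℝ)+1)), p + τ • u ∈ mInterior B} with hZ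
  set θ : ℝ := 1 / (2 * ((k:ℝ)+1)) with hθ
  have hθ0 : 0 < θ := by positivity
  have hθ2 : 2 * θ = 1 / ((k:ℝ)+1) := by rw [hθ]; field_simp
  let T : ℤ → Set (EuclideanSpace ℝ (Fin m)) := fun j => {y | ∃ t ∈ Ico (j * θ) ((j+1) * θ), Φ (t, y) ∈ Z}
  have hT : ∀ j, volume (T j) = 0 := by
    intro j
    by_contra hne
    have hne' : volume.restrict (T j) ≠ 0 := by
      intro h; apply hne
      rw [← Measure.restrict_apply_univ, h]; simp
    have hae := Besicovitch.ae_tendsto_measure_inter_div (volume : Measure (EuclideanSpace ℝ (Fin m))) (T j)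
    have : (ae (volume.restrict (T j))).NeBot := ae_neBot.2 hne'
    obtain ⟨y0, hy0⟩ := hae.exists
    have h1 : ∀ᶠ r : ℝ in 𝓝[>] 0, (1/2 : ℝ≥0∞) < volume (T j ∩ closedBall y0 r) / volume (closedBall y0 r) :=
      (tendsto_order.1 hy0).1 _ (by simp)
    have h2 : ∀ᶠ r : ℝ in 𝓝[>] 0, r ∈ Ioo (0:ℝ) (θ / 4) := Ioo_mem_nhdsGT (by positivity)
    obtain ⟨r, hr1, hr2⟩ := (h1.and h2).exists
    have hr0 : 0 < r := hr2.1
    have hrθ : r < θ / 4 := hr2.2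
    have hcb : volume (closedBall y0 r) = ENNReal.ofReal (r ^ m) * volume (ball (0:EuclideanSpace ℝ (Fin m)) 1) := by
      rw [Measure.addHaar_closedBall _ _ hr0.le]; simp
    have hcb0 : volume (closedBall y0 r) ≠ 0 := (measure_closedBall_pos volume y0 hr0).ne'
    have hcbt : volume (closedBall y0 r) ≠ ⊤ := measure_closedBall_lt_top.ne
    have hhalf : 1/2 * volume (closedBall y0 r) ≤ volume (T j ∩ closedBall y0 r) := by
      have := hr1.le
      rwa [ENNReal.le_div_iff_mul_le (Or.inl hcb0) (Or.inl hcbt)] at this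
    -- choose heights
    have hch : ∀ y : EuclideanSpace ℝ (Fin m), ∃ t : ℝ, y ∈ T j → (t ∈ Ico (j * θ) ((j+1) * θ) ∧ Φ (t, y) ∈ Z) := by
      intro y
      by_cases hy : y ∈ T j
      · obtain ⟨t, ht, htZ⟩ := hy
        exact ⟨t, fun _ => ⟨ht, htZ⟩⟩
      · exact ⟨0, fun h => absurd h hy⟩
    choose tt htt using hch
    have hnon : (T j ∩ closedBall y0 r).Nonempty := by
      rw [nonempty_iff_ne_empty]; intro he
      rw [he] at hhalf
      simp at hhalf
      exact hcb0 hhalf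
    have hbdd : BddAbove (tt '' (T j ∩ closedBall y0 r)) := by
      refine ⟨(j+1) * θ, ?_⟩
      rintro _ ⟨y, hy, rfl⟩
      exact (htt y hy.1).1.2.le
    obtain ⟨_, ⟨ys, hys, rfl⟩, hlt⟩ := exists_lt_of_lt_csSup (hnon.image tt)
      (show sSup (tt '' (T j ∩ closedBall y0 r)) - r / 2 < sSup (tt '' (T j ∩ closedBall y0 r)) by linarith)
    have hsub : Φ '' (Ioo (tt ys + r / 2) (tt ys + r) ×ˢ (T j ∩ closedBall y0 r)) ⊆
        mInterior B ∩ ball (Φ (tt ys, ys)) (4 * r) := by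
      rintro _ ⟨⟨s, y⟩, ⟨hs, hy⟩, rfl⟩
      have hty := htt y hy.1
      have htys := htt ys hys.1
      have hle : tt y ≤ sSup (tt '' (T j ∩ closedBall y0 r)) := le_csSup hbdd ⟨y, hy, rfl⟩
      simp only [mem_Ioo, mem_Ico] at hs hty htys
      constructor
      · have h3 := hty.2.2 (s - tt y) ⟨by linarith, by rw [← hθ2]; nlinarith⟩
        have h4 : Φ (tt y, y) + (s - tt y) • u = Φ (s, y) := by
          rw [hΦ, hΦ, sub_smul]; abel
        rwa [h4] at h3
      · rw [mem_ball, dist_eq_norm, hΦ, hΦ]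
        have h5 : s • u + ι y - (tt ys • u + ι ys) = (s - tt ys) • u + ι (y - ys) := by
          rw [map_sub, sub_smul]; abel
        rw [h5]
        apply lt_of_pow_lt_pow_left₀ 2 (by positivity)
        rw [frame_norm_sq hu hι]
        have h6 : ‖y - ys‖ ≤ 2 * r := by
          rw [← dist_eq_norm]
          have := dist_triangle_right y ys y0
          have h7 := hy.2; have h8 := hys.2
          rw [mem_closedBall] at h7 h8
          linarith
        have h9 : (s - tt ys)^2 ≤ r^2 := by
          apply pow_le_pow_left₀ <;> linarith
        have h10 : ‖y - ys‖^2 ≤ (2*r)^2 := by gcongr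
        nlinarith
    have hup : volume (mInterior B ∩ ball (Φ (tt ys, ys)) (4 * r)) ≤ η * volume (ball (Φ (tt ys, ys)) (4 * r)) := by
      refine le_trans ?_ ((htt ys hys.1).2.1 (4*r) ⟨by positivity, by rw [← hθ2]; linarith⟩)
      calc volume (mInterior B ∩ ball (Φ (tt ys, ys)) (4 * r)) ≤
            volume ((B ∩ ball (Φ (tt ys, ys)) (4 * r)) ∪ (mInterior B \ B)) := by
              apply measure_mono
              rintro x ⟨hx1, hx2⟩
              by_cases hxB : x ∈ B
              · exact Or.inl ⟨hxB, hx2⟩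
              · exact Or.inr ⟨hx1, hxB⟩
        _ ≤ _ := measure_union_le _ _
        _ = _ := by rw [mInterior_diff_null hB, add_zero]
    have hlow : ENNReal.ofReal (r/2) * (1/2 * volume (closedBall y0 r)) ≤
        η * volume (ball (Φ (tt ys, ys)) (4 * r)) := by
      calc ENNReal.ofReal (r/2) * (1/2 * volume (closedBall y0 r))
          ≤ ENNReal.ofReal (r/2) * volume (T j ∩ closedBall y0 r) := by gcongr
        _ = volume (Φ '' (Ioo (tt ys + r / 2) (tt ys + r) ×ˢ (T j ∩ closedBall y0 r))) := by
            rw [← MeasurableEquiv.preimage_symm, (hmp.symm Φ).measure_preimage_equiv, Measure.volume_eq_prod, Measure.prod_prod, Real.volume_Ioo]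
            congr 2; ring
        _ ≤ _ := measure_mono hsub
        _ ≤ _ := hup
    rw [hcb, Measure.addHaar_ball_of_pos _ (Φ (tt ys, ys)) (by positivity : 0 < 4 * r), finrank_euclideanSpace_fin] at hlow
    apply absurd hη
    rw [not_lt]
    have hk : ENNReal.ofReal (r^(m+1)) ≠ 0 := by simp; positivity
    rw [← ENNReal.mul_le_mul_iff_right hk ENNReal.ofReal_ne_top]
    have e1 : ENNReal.ofReal (r/2) = ENNReal.ofReal r / 2 := by
      rw [ENNReal.ofReal_div_of_pos (by norm_num)]; simp
    have e2 : ENNReal.ofReal ((4*r)^(m+1)) = 4^(m+1) * ENNReal.ofReal (r^(m+1)) := by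
      rw [mul_pow, ENNReal.ofReal_mul (by positivity), ENNReal.ofReal_pow (by norm_num)]; simp
    have e3 : ENNReal.ofReal (r^(m+1)) = ENNReal.ofReal r * ENNReal.ofReal (r^m) := by
      rw [← ENNReal.ofReal_mul hr0.le, pow_succ']
    have e4 : (4:ℝ≥0∞)⁻¹ = 2⁻¹ * 2⁻¹ := by
      rw [← ENNReal.mul_inv (by simp) (by simp)]; norm_num
    calc ENNReal.ofReal (r^(m+1)) * (volume (ball (0:EuclideanSpace ℝ (Fin m)) 1) / 4)
        = ENNReal.ofReal (r/2) * (1/2 * (ENNReal.ofReal (r ^ m) * volume (ball (0:EuclideanSpace ℝ (Fin m)) 1))) := by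
          rw [e1, e3, div_eq_mul_inv, div_eq_mul_inv, e4]; simp only [one_div]; ring
      _ ≤ _ := hlow
      _ = _ := by rw [e2]; ring
  have hcov : {z | ∃ t : ℝ, z + t • u ∈ lowDens B η k ∧
      ∀ τ ∈ Ioo (0:ℝ) (1 / ((k:ℝ)+1)), z + t • u + τ • u ∈ mInterior B} ⊆
      Φ '' (univ ×ˢ (⋃ j, T j)) := by
    rintro z ⟨t, ht⟩
    obtain ⟨⟨s, y⟩, rfl⟩ := Φ.surjective z
    refine ⟨(s, y), ⟨mem_univ _, ?_⟩, rfl⟩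
    have h4 : Φ (s, y) + t • u = Φ (s + t, y) := by
      rw [hΦ, hΦ, add_smul]; abel
    have ht' : Φ (s + t, y) ∈ Z := by rw [← h4]; exact ht
    rw [mem_iUnion]
    refine ⟨⌊(s+t) / θ⌋, s + t, ⟨?_, ?_⟩, ht'⟩
    · have := Int.floor_le ((s+t) / θ)
      rwa [le_div_iff₀ hθ0] at this
    · have := Int.lt_floor_add_one ((s+t) / θ)
      rwa [div_lt_iff₀ hθ0] at this
  refine measure_mono_null hcov ?_
  rw [← MeasurableEquiv.preimage_symm, (hmp.symm Φ).measure_preimage_equiv, Measure.volume_eq_prod, Measure.prod_prod]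
  rw [measure_iUnion_null hT, mul_zero]

lemma baire_step {P C F : Set ℝ} (hF : F = frontier P) (hCP : C ⊆ P) {q : ℝ} {J : Set ℝ} (hJ : IsOpen J)
    (hqJ : q ∈ J) (hqF : q ∈ F) (hJF : J ∩ F ⊆ C) :
    ∃ p ∈ C, ∃ δ > 0, (∀ σ ∈ Ioo (0:ℝ) δ, p + σ ∉ P) ∨ (∀ σ ∈ Ioo (0:ℝ) δ, p - σ ∉ P) := by
  obtain ⟨ε, hε, hball⟩ := Metric.isOpen_iff.1 hJ q hqJ
  have hqc : q ∈ closure Pᶜ := by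
    rw [hF, frontier_eq_closure_inter_closure] at hqF; exact hqF.2
  obtain ⟨τ, hτP, hτ⟩ := Metric.mem_closure_iff.1 hqc ε hε
  have hqP : q ∈ P := hCP (hJF ⟨hqJ, hqF⟩)
  have hmemF : ∀ p, p ∈ closure P → p ∈ closure Pᶜ → p ∈ F := by
    intro p h1 h2; rw [hF, frontier_eq_closure_inter_closure]; exact ⟨h1, h2⟩
  have hτnc : τ ∈ ball q ε → τ ∉ closure P := by
    intro hb hc
    exact hτP (hCP (hJF ⟨hball hb, hmemF τ hc (subset_closure hτP)⟩))
  have hτb : τ ∈ ball q ε := by rw [mem_ball, dist_comm]; exact hτ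
  have hτnc := hτnc hτb
  have hne : τ ≠ q := fun h => hτP (h ▸ hqP)
  rw [mem_ball, Real.dist_eq, abs_lt] at hτb
  rcases lt_or_gt_of_ne hne with hlt | hgt
  · set X := P ∩ Icc τ q with hX
    have hXn : X.Nonempty := ⟨q, hqP, hlt.le, le_rfl⟩
    have hXb : BddBelow X := ⟨τ, fun x hx => hx.2.1⟩
    set p := sInf X with hp
    have hpc : p ∈ closure X := csInf_mem_closure hXn hXb
    have hpcP : p ∈ closure P := closure_mono inter_subset_left hpc
    have hpIcc : p ∈ Icc τ q := by
      have := closure_mono (inter_subset_right (s := P)) hpc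
      rwa [isClosed_Icc.closure_eq] at this
    have hpτ : τ < p := lt_of_le_of_ne hpIcc.1 (fun h => hτnc (h ▸ hpcP))
    have hout : ∀ x ∈ Ioo τ p, x ∉ P := fun x hx hxP =>
      absurd (csInf_le hXb ⟨hxP, hx.1.le, hx.2.le.trans hpIcc.2⟩) (not_le.2 hx.2)
    have hpcc : p ∈ closure Pᶜ := by
      have h1 : p ∈ closure (Ioo τ p) := by rw [closure_Ioo hpτ.ne]; exact ⟨hpτ.le, le_rfl⟩
      exact closure_mono (fun x hx => hout x hx) h1
    have hpC : p ∈ C := hJF ⟨hball (by rw [mem_ball, Real.dist_eq, abs_lt]; constructor <;> linarith [hpIcc.2]), hmemF p hpcP hpcc⟩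
    exact ⟨p, hpC, p - τ, by linarith, Or.inr fun σ hσ => hout _ ⟨by linarith [hσ.2], by linarith [hσ.1]⟩⟩
  · set X := P ∩ Icc q τ with hX
    have hXn : X.Nonempty := ⟨q, hqP, le_rfl, le_of_lt hgt⟩
    have hXb : BddAbove X := ⟨τ, fun x hx => hx.2.2⟩
    set p := sSup X with hp
    have hpc : p ∈ closure X := csSup_mem_closure hXn hXb
    have hpcP : p ∈ closure P := closure_mono inter_subset_left hpc
    have hpIcc : p ∈ Icc q τ := by
      have := closure_mono (inter_subset_right (s := P)) hpc
      rwa [isClosed_Icc.closure_eq] at this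
    have hpτ : p < τ := lt_of_le_of_ne hpIcc.2 (fun h => hτnc (h ▸ hpcP))
    have hout : ∀ x ∈ Ioo p τ, x ∉ P := fun x hx hxP =>
      absurd (le_csSup hXb ⟨hxP, hpIcc.1.trans hx.1.le, hx.2.le⟩) (not_le.2 hx.1)
    have hpcc : p ∈ closure Pᶜ := by
      have h1 : p ∈ closure (Ioo p τ) := by rw [closure_Ioo hpτ.ne]; exact ⟨le_rfl, hpτ.le⟩
      exact closure_mono (fun x hx => hout x hx) h1
    have hpC : p ∈ C := hJF ⟨hball (by rw [mem_ball, Real.dist_eq, abs_lt]; constructor <;> linarith [hpIcc.1]), hmemF p hpcP hpcc⟩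
    exact ⟨p, hpC, τ - p, by linarith, Or.inl fun σ hσ => hout _ ⟨by linarith [hσ.1], by linarith [hσ.2]⟩⟩

lemma baire_line {P : Set ℝ} {C D : ℕ → Set ℝ} (hC : ∀ k, IsClosed (C k)) (hD : ∀ k, IsClosed (D k))
    (hCP : ∀ k, C k ⊆ P) (hDP : ∀ k, D k ⊆ Pᶜ) (hPC : P ⊆ ⋃ k, C k) (hPD : Pᶜ ⊆ ⋃ k, D k)
    (h1 : P.Nonempty) (h2 : Pᶜ.Nonempty) :
    (∃ k, ∃ p ∈ C k, ∃ δ > 0, (∀ σ ∈ Ioo (0:ℝ) δ, p + σ ∉ P) ∨ (∀ σ ∈ Ioo (0:ℝ) δ, p - σ ∉ P)) ∨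
    (∃ k, ∃ p ∈ D k, ∃ δ > 0, (∀ σ ∈ Ioo (0:ℝ) δ, p + σ ∉ Pᶜ) ∨ (∀ σ ∈ Ioo (0:ℝ) δ, p - σ ∉ Pᶜ)) := by
  have hFn : (frontier P).Nonempty := by
    rw [nonempty_iff_ne_empty]; intro he
    have := isClopen_iff.1 (isClopen_iff_frontier_eq_empty.2 he)
    rcases this with h | h
    · exact h1.ne_empty h
    · rw [h] at h2; simp at h2
  have : Nonempty (frontier P) := hFn.to_subtype
  have : CompleteSpace (frontier P) := isClosed_frontier.completeSpace_coe
  obtain ⟨i, hi⟩ := nonempty_interior_of_iUnion_of_closed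
    (f := fun i : ℕ ⊕ ℕ => (Subtype.val : frontier P → ℝ) ⁻¹' (Sum.elim C D i))
    (by rintro (k | k)
        · exact (hC k).preimage continuous_subtype_val
        · exact (hD k).preimage continuous_subtype_val)
    (by rw [eq_univ_iff_forall]
        intro x
        by_cases hx : (x:ℝ) ∈ P
        · obtain ⟨k, hk⟩ := mem_iUnion.1 (hPC hx)
          exact mem_iUnion.2 ⟨Sum.inl k, hk⟩
        · obtain ⟨k, hk⟩ := mem_iUnion.1 (hPD hx)
          exact mem_iUnion.2 ⟨Sum.inr k, hk⟩)
  obtain ⟨⟨q, hqF⟩, hq⟩ := hi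
  rw [mem_interior] at hq
  obtain ⟨t, hts, hto, hqt⟩ := hq
  obtain ⟨J, hJ, rfl⟩ := isOpen_induced_iff.1 hto
  rcases i with k | k
  · left
    exact ⟨k, baire_step rfl (hCP k) hJ hqt hqF (fun x hx => hts (show (⟨x, hx.2⟩ : frontier P) ∈ _ from hx.1))⟩
  · right
    exact ⟨k, baire_step (frontier_compl P).symm (hDP k) hJ hqt hqF (fun x hx => hts (show (⟨x, hx.2⟩ : frontier P) ∈ _ from hx.1))⟩

lemma exists_eta (m : ℕ) : ∃ η : ℝ≥0∞, 0 < η ∧ η < 1 ∧ η * (4 ^ (m+1) * volume (ball (0:EuclideanSpace ℝ (Fin (m+1))) 1)) <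
      volume (ball (0:EuclideanSpace ℝ (Fin m)) 1) / 4 := by
  have h1 : (4 ^ (m+1) * volume (ball (0:EuclideanSpace ℝ (Fin (m+1))) 1)) ≠ ⊤ :=
    ENNReal.mul_ne_top (by simp) (vol_ball_ne_top _ _)
  have h2 : volume (ball (0:EuclideanSpace ℝ (Fin m)) 1) / 4 ≠ 0 := by
    simp only [ne_eq, ENNReal.div_eq_zero_iff, not_or]
    exact ⟨vol_ball_pos _ one_pos, by simp⟩
  obtain ⟨c, hc, hlt⟩ := ENNReal.exists_nnreal_pos_mul_lt h1 h2
  refine ⟨min c (1/2), ?_, ?_, ?_⟩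
  · rw [lt_min_iff]; constructor
    · exact_mod_cast hc
    · simp
  · exact lt_of_le_of_lt (min_le_right _ _) (by simp)
  · refine lt_of_le_of_lt ?_ hlt
    gcongr
    exact min_le_left _ _

/-- clamp to `[0,h]` -/
def clamp (h τ : ℝ) : ℝ := max 0 (min τ h)

lemma clamp_mem {h : ℝ} (hh : 0 < h) (τ : ℝ) : clamp h τ ∈ Icc 0 h :=
  ⟨le_max_left _ _, max_le hh.le (min_le_right _ _)⟩

lemma clamp_of_mem {h τ : ℝ} (hτ : τ ∈ Icc 0 h) : clamp h τ = τ := by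
  simp [clamp, hτ.1, hτ.2]

lemma clamp_of_le {h τ : ℝ} (hτ : τ ≤ 0) : clamp h τ = 0 := by
  simp [clamp, hτ]

lemma clamp_of_ge {h τ : ℝ} (hh : 0 < h) (hτ : h ≤ τ) : clamp h τ = h := by
  simp [clamp, hτ, hh.le]

lemma clamp_contra {m : ℕ} {B : Set (EuclideanSpace ℝ (Fin (m+1)))} 
    (u : EuclideanSpace ℝ (Fin (m+1))) {η : ℝ≥0∞} (hη : η < 1) {h : ℝ} (hh : 0 < h)
    {z : EuclideanSpace ℝ (Fin (m+1))}
    (hz1 : ∀ k : ℕ, ¬ ∃ t : ℝ, z + t • u ∈ lowDens B η k ∧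
      ∀ τ ∈ Ioo (0:ℝ) (1 / ((k:ℝ)+1)), z + t • u + τ • u ∈ mInterior B)
    (hz2 : ∀ k : ℕ, ¬ ∃ t : ℝ, z + t • (-u) ∈ lowDens B η k ∧
      ∀ τ ∈ Ioo (0:ℝ) (1 / ((k:ℝ)+1)), z + t • (-u) + τ • (-u) ∈ mInterior B)
    {k : ℕ} {p : ℝ} (hp : z + clamp h p • u ∈ lowDens B η k) {δ : ℝ} (hδ : 0 < δ)
    (hor : (∀ σ ∈ Ioo (0:ℝ) δ, z + clamp h (p + σ) • u ∈ mInterior B) ∨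
      (∀ σ ∈ Ioo (0:ℝ) δ, z + clamp h (p - σ) • u ∈ mInterior B)) : False := by
  have hpn : z + clamp h p • u ∉ mInterior B := lowDens_disjoint B hη k hp
  rcases hor with hor | hor
  · have hp0 : 0 ≤ p := by
      by_contra hcon
      push Not at hcon
      have := hor (min (δ/2) (-p)) ⟨by apply lt_min <;> linarith, lt_of_le_of_lt (min_le_left _ _) (by linarith)⟩
      rw [clamp_of_le (by linarith [min_le_right (δ/2) (-p)])] at this
      rw [clamp_of_le hcon.le] at hpn
      exact hpn this
    have hph : p < h := by
      by_contra hcon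
      push Not at hcon
      have := hor (δ/2) ⟨by linarith, by linarith⟩
      rw [clamp_of_ge hh (by linarith)] at this
      rw [clamp_of_ge hh hcon] at hpn
      exact hpn this
    obtain ⟨l, hl⟩ := exists_nat_one_div_lt (show 0 < min δ (h - p) from lt_min hδ (by linarith))
    have hmax : 1 / ((max k l : ℕ) + 1 : ℝ) ≤ 1 / ((l:ℝ) + 1) := by
      gcongr; exact le_max_right _ _
    refine hz1 (max k l) ⟨p, ?_, ?_⟩
    · rw [clamp_of_mem ⟨hp0, hph.le⟩] at hp
      exact lowDens_mono B η (le_max_left _ _) hp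
    · intro τ hτ
      have hτ2 : τ < min δ (h - p) := by linarith [hτ.2]
      have := hor τ ⟨hτ.1, hτ2.trans_le (min_le_left _ _)⟩
      rw [clamp_of_mem ⟨by linarith [hτ.1], by linarith [min_le_right δ (h - p)]⟩, add_smul, ← add_assoc] at this
      exact this
  · have hp0 : 0 < p := by
      by_contra hcon
      push Not at hcon
      have := hor (δ/2) ⟨by linarith, by linarith⟩
      rw [clamp_of_le (by linarith)] at this
      rw [clamp_of_le hcon] at hpn
      exact hpn this
    have hph : p ≤ h := by
      by_contra hcon
      push Not at hcon
      have := hor (min (δ/2) (p-h)) ⟨by apply lt_min <;> linarith, lt_of_le_of_lt (min_le_left _ _) (by linarith)⟩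
      rw [clamp_of_ge hh (by linarith [min_le_right (δ/2) (p-h)])] at this
      rw [clamp_of_ge hh hcon.le] at hpn
      exact hpn this
    obtain ⟨l, hl⟩ := exists_nat_one_div_lt (show 0 < min δ p from lt_min hδ (by linarith))
    have hmax : 1 / ((max k l : ℕ) + 1 : ℝ) ≤ 1 / ((l:ℝ) + 1) := by
      gcongr; exact le_max_right _ _
    refine hz2 (max k l) ⟨-p, ?_, ?_⟩
    · rw [clamp_of_mem ⟨hp0.le, hph⟩] at hp
      rw [neg_smul_neg]
      exact lowDens_mono B η (le_max_left _ _) hp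
    · intro τ hτ
      have hτ2 : τ < min δ p := by linarith [hτ.2]
      have := hor τ ⟨hτ.1, hτ2.trans_le (min_le_left _ _)⟩
      rw [clamp_of_mem ⟨by linarith [min_le_right δ p], by linarith [hτ.1]⟩] at this
      convert this using 1
      module

/-- Part I -/
lemma slice_ae {m : ℕ} {A : Set (EuclideanSpace ℝ (Fin (m+1)))} (hA : MeasurableSet A)
    (u : EuclideanSpace ℝ (Fin (m+1))) (hu : ‖u‖ = 1) {h : ℝ} (hh : 0 < h) :
    ∀ᵐ z, (∀ τ ∈ Icc 0 h, z + τ • u ∉ mBoundary A) → (z ∈ A ↔ z + h • u ∈ A) := by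
  obtain ⟨η, hη0, hη1, hη⟩ := exists_eta m
  have hu' : ‖-u‖ = 1 := by rwa [norm_neg]
  have n1 : ∀ᵐ z, ∀ k : ℕ, _ := ae_all_iff.2 fun k => (show ∀ᵐ z, ¬ _ from measure_eq_zero_iff_ae_notMem.1 (slice_null hA u hu k hη))
  have n2 : ∀ᵐ z, ∀ k : ℕ, _ := ae_all_iff.2 fun k => (show ∀ᵐ z, ¬ _ from measure_eq_zero_iff_ae_notMem.1 (slice_null hA (-u) hu' k hη))
  have n3 : ∀ᵐ z, ∀ k : ℕ, _ := ae_all_iff.2 fun k => (show ∀ᵐ z, ¬ _ from measure_eq_zero_iff_ae_notMem.1 (slice_null hA.compl u hu k hη))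
  have n4 : ∀ᵐ z, ∀ k : ℕ, _ := ae_all_iff.2 fun k => (show ∀ᵐ z, ¬ _ from measure_eq_zero_iff_ae_notMem.1 (slice_null hA.compl (-u) hu' k hη))
  have d1 := ae_density hA
  have d2 := (measurePreserving_add_right volume (h • u)).quasiMeasurePreserving.ae (ae_density hA)
  filter_upwards [n1, n2, n3, n4, d1, d2] with z hz1 hz2 hz3 hz4 hd1 hd2 hseg
  have hunion : ∀ τ ∈ Icc 0 h, z + τ • u ∉ mInterior A → z + τ • u ∈ mInterior Aᶜ := by
    intro τ hτ h1
    rw [mInterior_compl hA]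
    have h2 := hseg τ hτ
    rw [mBoundary, notMem_compl_iff] at h2
    exact h2.resolve_left h1
  have hdisj : ∀ x, x ∈ mInterior A → x ∉ mInterior Aᶜ := by
    intro x h1 h2
    rw [mInterior_compl hA] at h2
    have := tendsto_nhds_unique (show Tendsto _ _ _ from h1) h2
    simp at this
  have hiff : z + (0:ℝ) • u ∈ mInterior A ↔ z + h • u ∈ mInterior A := by
    set P : Set ℝ := {τ | z + clamp h τ • u ∈ mInterior A} with hP
    have hcont : Continuous fun τ => z + clamp h τ • u := by
      unfold clamp; fun_prop
    by_contra hcon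
    have hex : P.Nonempty ∧ Pᶜ.Nonempty := by
      have e0 : (0:ℝ) ∈ P ↔ z + (0:ℝ) • u ∈ mInterior A := by
        rw [hP, mem_ofPred_eq, clamp_of_le le_rfl]
      have e1 : h ∈ P ↔ z + h • u ∈ mInterior A := by
        rw [hP, mem_ofPred_eq, clamp_of_ge hh le_rfl]
      rw [← e0, ← e1] at hcon
      by_cases h0 : (0:ℝ) ∈ P
      · exact ⟨⟨0, h0⟩, ⟨h, fun h1 => hcon ⟨fun _ => h1, fun _ => h0⟩⟩⟩
      · refine ⟨⟨h, ?_⟩, ⟨0, h0⟩⟩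
        by_contra h1
        exact hcon ⟨fun h => absurd h h0, fun h => absurd h h1⟩
    rcases baire_line (P := P) (C := fun k => {τ | z + clamp h τ • u ∈ lowDens Aᶜ η k})
      (D := fun k => {τ | z + clamp h τ • u ∈ lowDens A η k})
      (fun k => (isClosed_lowDens _ _ _).preimage hcont) (fun k => (isClosed_lowDens _ _ _).preimage hcont)
      (fun k τ hτ => by
        by_contra hn
        exact lowDens_disjoint _ hη1 k hτ (hunion _ (clamp_mem hh τ) hn))
      (fun k τ hτ => lowDens_disjoint _ hη1 k hτ)
      (fun τ hτ => by
        have h1 : z + clamp h τ • u ∈ mExterior Aᶜ := by rw [mExterior_compl hA]; exact hτ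
        obtain ⟨k, hk⟩ := mem_iUnion.1 (mExterior_subset_lowDens _ hη0 h1)
        exact mem_iUnion.2 ⟨k, hk⟩)
      (fun τ hτ => by
        have h1 : z + clamp h τ • u ∈ mExterior A := by
          rw [← mInterior_compl hA]; exact hunion _ (clamp_mem hh τ) hτ
        obtain ⟨k, hk⟩ := mem_iUnion.1 (mExterior_subset_lowDens _ hη0 h1)
        exact mem_iUnion.2 ⟨k, hk⟩)
      hex.1 hex.2 with ⟨k, p, hp, δ, hδ, hor⟩ | ⟨k, p, hp, δ, hδ, hor⟩
    · refine clamp_contra u hη1 hh hz3 hz4 hp hδ ?_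
      rcases hor with hor | hor
      · exact Or.inl fun σ hσ => hunion _ (clamp_mem hh _) (hor σ hσ)
      · exact Or.inr fun σ hσ => hunion _ (clamp_mem hh _) (hor σ hσ)
    · refine clamp_contra u hη1 hh hz1 hz2 hp hδ ?_
      rcases hor with hor | hor
      · exact Or.inl fun σ hσ => not_not.1 (hor σ hσ)
      · exact Or.inr fun σ hσ => not_not.1 (hor σ hσ)
  have hAI : ∀ x, ((x ∈ A → x ∈ mInterior A) ∧ (x ∉ A → x ∈ mExterior A)) → (x ∈ A ↔ x ∈ mInterior A) := by
    intro x hx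
    refine ⟨hx.1, fun h => ?_⟩
    by_contra hn
    have := hx.2 hn
    rw [← mInterior_compl hA] at this
    exact hdisj x h this
  rw [hAI z hd1, hAI _ hd2, ← hiff, zero_smul, add_zero]

section Polar

variable {V : Type*} [NormedAddCommGroup V] [InnerProductSpace ℝ V]

/-- reflection in the hyperplane orthogonal to `v` -/
def hrefl (v : V) : V ≃ₗᵢ[ℝ] V := Submodule.reflection (ℝ ∙ v)ᗮ

lemma hrefl_apply (v z : V) : hrefl v z = z - (2 * inner ℝ v z / ‖v‖ ^ 2) • v := by
  rw [hrefl, Submodule.reflection_orthogonal_apply, Submodule.reflection_singleton_apply]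
  simp only [RCLike.ofReal_real_eq_id, id]
  module

lemma hrefl_hrefl (v z : V) : hrefl v (hrefl v z) = z := Submodule.reflection_reflection _ _

lemma inner_hrefl {v : V} (hv : v ≠ 0) (z : V) : inner ℝ v (hrefl v z) = - inner ℝ v z := by
  rw [hrefl_apply, inner_sub_right, inner_smul_right, real_inner_self_eq_norm_sq]
  have : ‖v‖ ≠ 0 := norm_ne_zero_iff.2 hv
  field_simp; ring

lemma hrefl_of_inner_eq_zero {v z : V} (h : inner ℝ v z = 0) : hrefl v z = z := by
  rw [hrefl_apply, h]; simp

lemma dist_hrefl_le {v : V} (hv : v ≠ 0) {w z : V} (hw : inner ℝ v w ≤ 0) (hz : 0 ≤ inner ℝ v z) :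
    dist w (hrefl v z) ≤ dist w z := by
  have hv' : 0 < ‖v‖ := norm_pos_iff.2 hv
  rw [dist_eq_norm, dist_eq_norm]
  apply le_of_sq_le_sq _ (norm_nonneg _)
  have h1 : w - hrefl v z = (w - z) + (2 * inner ℝ v z / ‖v‖ ^ 2) • v := by
    rw [hrefl_apply]; abel
  rw [h1, norm_add_sq_real, inner_smul_right, norm_smul, inner_sub_left, real_inner_comm v w, real_inner_comm v z, mul_pow, Real.norm_eq_abs, sq_abs]
  have h2 : 2 * (2 * inner ℝ v z / ‖v‖ ^ 2 * (inner ℝ v w - inner ℝ v z)) + (2 * inner ℝ v z / ‖v‖ ^ 2) ^ 2 * ‖v‖ ^ 2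
      = 4 * inner ℝ v z / ‖v‖ ^ 2 * inner ℝ v w := by
    field_simp; ring
  have h3 : 4 * inner ℝ v z / ‖v‖ ^ 2 * inner ℝ v w ≤ 0 := by
    apply mul_nonpos_of_nonneg_of_nonpos _ hw
    positivity
  linarith

/-- polarization (two-point symmetrization) -/
def polz (v : V) (K : Set V) : Set V :=
  {z | (0 ≤ inner ℝ v z ∧ (z ∈ K ∨ hrefl v z ∈ K)) ∨ (inner ℝ v z ≤ 0 ∧ z ∈ K ∧ hrefl v z ∈ K)}

lemma isClosed_polz (v : V) {K : Set V} (hK : IsClosed K) : IsClosed (polz v K) := by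
  have h1 : IsClosed {z : V | (0:ℝ) ≤ inner ℝ v z} := isClosed_le continuous_const (by fun_prop)
  have h2 : IsClosed {z : V | inner ℝ v z ≤ (0:ℝ)} := isClosed_le (by fun_prop) continuous_const
  have h3 : IsClosed ((hrefl v) ⁻¹' K) := hK.preimage (hrefl v).continuous
  exact (h1.inter (hK.union h3)).union (h2.inter (hK.inter h3))

lemma polz_subset (v : V) {K : Set V} (r : ℝ) (hK : K ⊆ sphere 0 r) : polz v K ⊆ sphere 0 r := by
  intro z hz
  rcases hz with ⟨_, h | h⟩ | ⟨_, h, _⟩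
  · exact hK h
  · have := hK h
    simpa using this
  · exact hK h

lemma thickening_polz {v : V} (hv : v ≠ 0) (K : Set V) (ε : ℝ) :
    thickening ε (polz v K) ⊆ polz v (thickening ε K) := by
  intro w hw
  obtain ⟨z, hz, hd⟩ := mem_thickening_iff.1 hw
  have hd' : dist (hrefl v w) (hrefl v z) < ε := by rwa [(hrefl v).dist_map]
  have hsw : dist (hrefl v w) z = dist w (hrefl v z) := by
    conv_lhs => rw [← hrefl_hrefl v z]
    exact (hrefl v).dist_map _ _
  simp only [polz, mem_ofPred_eq, mem_thickening_iff]
  rcases le_total 0 (inner ℝ v w) with h0 | h0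
  · left
    refine ⟨h0, ?_⟩
    rcases hz with ⟨_, h | h⟩ | ⟨_, h, _⟩
    · exact Or.inl ⟨z, h, hd⟩
    · exact Or.inr ⟨_, h, hd'⟩
    · exact Or.inl ⟨z, h, hd⟩
  · right
    refine ⟨h0, ?_⟩
    rcases hz with ⟨hz0, h | h⟩ | ⟨_, h, h'⟩
    · exact ⟨⟨z, h, hd⟩, ⟨z, h, by rw [hsw]; exact (dist_hrefl_le hv h0 hz0).trans_lt hd⟩⟩
    · exact ⟨⟨_, h, (dist_hrefl_le hv h0 hz0).trans_lt hd⟩, ⟨_, h, hd'⟩⟩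
    · exact ⟨⟨z, h, hd⟩, ⟨_, h', hd'⟩⟩

set_option linter.unusedSectionVars false
variable [MeasurableSpace V] [BorelSpace V]

lemma measure_split {v : V} (hv : v ≠ 0) (σ : Measure V) (hinv : MeasurePreserving (hrefl v) σ σ)
    {T : Set V} (hT : MeasurableSet T) :
    σ T = σ (T ∩ {z | inner ℝ v z = 0}) + (σ (T ∩ {z | 0 < inner ℝ v z}) + σ ((hrefl v) ⁻¹' T ∩ {z | 0 < inner ℝ v z})) := by
  have hc : Continuous fun z : V => (inner ℝ v z : ℝ) := by fun_prop
  have m0 : MeasurableSet {z : V | inner ℝ v z = (0:ℝ)} := (isClosed_eq hc continuous_const).measurableSet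
  have mp : MeasurableSet {z : V | (0:ℝ) < inner ℝ v z} := (isOpen_lt continuous_const hc).measurableSet
  have mn : MeasurableSet {z : V | inner ℝ v z < (0:ℝ)} := (isOpen_lt hc continuous_const).measurableSet
  have h1 : σ ((hrefl v) ⁻¹' T ∩ {z | 0 < inner ℝ v z}) = σ (T ∩ {z | inner ℝ v z < 0}) := by
    rw [← hinv.measure_preimage (hT.inter mn).nullMeasurableSet]
    congr 1
    ext z
    simp [inner_hrefl hv]
  rw [h1, ← measure_inter_add_sdiff T m0, ← measure_inter_add_sdiff (T \ _) mp]
  congr 1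
  congr 1
  · congr 1; ext z
    simp only [mem_inter_iff, Set.mem_sdiff, mem_ofPred_eq]
    constructor
    · rintro ⟨⟨a, b⟩, c⟩; exact ⟨a, c⟩
    · rintro ⟨a, c⟩; exact ⟨⟨a, c.ne'⟩, c⟩
  · congr 1; ext z
    simp only [mem_inter_iff, Set.mem_sdiff, mem_ofPred_eq, not_lt]
    constructor
    · rintro ⟨⟨a, b⟩, c⟩; exact ⟨a, lt_of_le_of_ne c b⟩
    · rintro ⟨a, c⟩; exact ⟨⟨a, c.ne⟩, c.le⟩

lemma measurableSet_polz (v : V) {K : Set V} (hK : MeasurableSet K) : MeasurableSet (polz v K) := by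
  have hc : Continuous fun z : V => (inner ℝ v z : ℝ) := by fun_prop
  have h1 : MeasurableSet {z : V | (0:ℝ) ≤ inner ℝ v z} := (isClosed_le continuous_const hc).measurableSet
  have h2 : MeasurableSet {z : V | inner ℝ v z ≤ (0:ℝ)} := (isClosed_le hc continuous_const).measurableSet
  have h3 : MeasurableSet ((hrefl v) ⁻¹' K) := (hrefl v).continuous.measurable hK
  exact (h1.inter (hK.union h3)).union (h2.inter (hK.inter h3))

lemma polz_zero (v : V) (K : Set V) : polz v K ∩ {z | inner ℝ v z = 0} = K ∩ {z | inner ℝ v z = 0} := by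
  ext z
  simp only [mem_inter_iff, mem_ofPred_eq, polz]
  constructor
  · rintro ⟨h, h0⟩
    rw [hrefl_of_inner_eq_zero h0] at h
    exact ⟨by tauto, h0⟩
  · rintro ⟨h, h0⟩
    rw [hrefl_of_inner_eq_zero h0]
    exact ⟨Or.inl ⟨h0.ge, Or.inl h⟩, h0⟩

lemma polz_pos (v : V) (K : Set V) : polz v K ∩ {z | 0 < inner ℝ v z} = 
    (K ∪ (hrefl v) ⁻¹' K) ∩ {z | 0 < inner ℝ v z} := by
  ext z
  simp only [mem_inter_iff, mem_ofPred_eq, polz, mem_union, mem_preimage]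
  constructor
  · rintro ⟨h | h, h0⟩
    · exact ⟨h.2, h0⟩
    · exact ⟨Or.inl h.2.1, h0⟩
  · rintro ⟨h, h0⟩
    exact ⟨Or.inl ⟨h0.le, h⟩, h0⟩

lemma polz_neg {v : V} (hv : v ≠ 0) (K : Set V) : (hrefl v) ⁻¹' (polz v K) ∩ {z | 0 < inner ℝ v z} = 
    (K ∩ (hrefl v) ⁻¹' K) ∩ {z | 0 < inner ℝ v z} := by
  ext z
  simp only [mem_inter_iff, mem_ofPred_eq, polz, mem_preimage, inner_hrefl hv, hrefl_hrefl]
  constructor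
  · rintro ⟨h | h, h0⟩
    · linarith [h.1]
    · exact ⟨⟨h.2.2, h.2.1⟩, h0⟩
  · rintro ⟨h, h0⟩
    exact ⟨Or.inr ⟨by linarith, h.2, h.1⟩, h0⟩

lemma measure_polz {v : V} (hv : v ≠ 0) (σ : Measure V) (hinv : MeasurePreserving (hrefl v) σ σ)
    {K : Set V} (hK : MeasurableSet K) : σ (polz v K) = σ K := by
  have h3 : MeasurableSet ((hrefl v) ⁻¹' K) := (hrefl v).continuous.measurable hK
  have hc : Continuous fun z : V => (inner ℝ v z : ℝ) := by fun_prop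
  have mp : MeasurableSet {z : V | (0:ℝ) < inner ℝ v z} := (isOpen_lt continuous_const hc).measurableSet
  rw [measure_split hv σ hinv (measurableSet_polz v hK), polz_zero, polz_pos, polz_neg hv, measure_split hv σ hinv hK]
  congr 1
  rw [union_inter_distrib_right, inter_inter_distrib_right]
  exact measure_union_add_inter _ (h3.inter mp)

lemma measure_polz_inter {v : V} (hv : v ≠ 0) (σ : Measure V) (hinv : MeasurePreserving (hrefl v) σ σ)
    {K C : Set V} (hK : MeasurableSet K) (hC : MeasurableSet C)
    (hCv : ∀ z, 0 < inner ℝ v z → hrefl v z ∈ C → z ∈ C) :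
    σ (K ∩ C) + σ ({z | 0 < inner ℝ v z} ∩ (C \ K) ∩ (hrefl v) ⁻¹' (K \ C)) ≤ σ (polz v K ∩ C) := by
  have hr := (hrefl v).continuous.measurable
  have h3 : MeasurableSet ((hrefl v) ⁻¹' K) := hr hK
  have hc : Continuous fun z : V => (inner ℝ v z : ℝ) := by fun_prop
  have mp : MeasurableSet {z : V | (0:ℝ) < inner ℝ v z} := (isOpen_lt continuous_const hc).measurableSet
  rw [measure_split hv σ hinv (hK.inter hC), measure_split hv σ hinv ((measurableSet_polz v hK).inter hC), add_assoc]
  have e0 : K ∩ C ∩ {z | inner ℝ v z = 0} = polz v K ∩ C ∩ {z | inner ℝ v z = 0} := by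
    rw [inter_right_comm, ← polz_zero, inter_right_comm]
  rw [e0]
  refine add_le_add le_rfl ?_
  set T1 := K ∩ C ∩ {z | 0 < inner ℝ v z} with hT1
  set T2 := (hrefl v) ⁻¹' (K ∩ C) ∩ {z | 0 < inner ℝ v z} with hT2
  set G := ({z | 0 < inner ℝ v z} ∩ (C \ K) ∩ (hrefl v) ⁻¹' (K \ C)) with hG
  have mT2 : MeasurableSet T2 := (hr (hK.inter hC)).inter mp
  have mG : MeasurableSet G := (mp.inter (hC.diff hK)).inter (hr (hK.diff hC))
  rw [← measure_union_add_inter T1 mT2, add_right_comm]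
  have hdis : Disjoint (T1 ∪ T2) G := by
    rw [Set.disjoint_left]
    rintro z (h | h) hg
    · exact hg.1.2.2 h.1.1
    · exact hg.2.2 h.1.2
  rw [← measure_union hdis mG]
  apply add_le_add
  · apply measure_mono
    rintro z ((h | h) | h)
    · exact ⟨⟨Or.inl ⟨h.2.le, Or.inl h.1.1⟩, h.1.2⟩, h.2⟩
    · exact ⟨⟨Or.inl ⟨h.2.le, Or.inr h.1.1⟩, hCv z h.2 h.1.2⟩, h.2⟩
    · exact ⟨⟨Or.inl ⟨h.1.1.le, Or.inr h.2.1⟩, h.1.2.1⟩, h.1.1⟩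
  · apply measure_mono
    rintro z ⟨h1, h2⟩
    refine ⟨⟨?_, h2.1.2⟩, h2.2⟩
    have : z ∈ hrefl v ⁻¹' polz v K ∩ {z | 0 < inner ℝ v z} := by
      rw [polz_neg hv]; exact ⟨⟨h1.1.1, h2.1.1⟩, h1.2⟩
    exact this.1

end Polar

section Sphere

variable {V : Type*} [NormedAddCommGroup V] [InnerProductSpace ℝ V] [FiniteDimensional ℝ V]
  [MeasurableSpace V] [BorelSpace V]

lemma exists_refl_swap (σ : Measure V) [IsFiniteMeasure σ] (hinv : ∀ v : V, MeasurePreserving (hrefl v) σ σ)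
    {X Y : Set V} (hX : MeasurableSet X) (hY : MeasurableSet Y) (hXs : X ⊆ sphere 0 1) (hYs : Y ⊆ sphere 0 1)
    (hX0 : σ X ≠ 0) (hY0 : σ Y ≠ 0) (hXY : Disjoint X Y) :
    ∃ x ∈ X, ∃ y ∈ Y, y - x ≠ 0 ∧ σ ({z | 0 < inner ℝ (y - x) z} ∩ Y ∩ (hrefl (y-x)) ⁻¹' X) ≠ 0 := by
  have pick : ∀ {T : Set V}, MeasurableSet T → σ T ≠ 0 →
      ∃ x ∈ T, Tendsto (fun r => σ (T ∩ closedBall x r) / σ (closedBall x r)) (𝓝[>] 0) (𝓝 1) := by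
    intro T hT hT0
    have hne' : σ.restrict T ≠ 0 := by
      intro h; apply hT0
      rw [← Measure.restrict_apply_univ, h]; simp
    have : (ae (σ.restrict T)).NeBot := ae_neBot.2 hne'
    obtain ⟨x, h1, h2⟩ := ((Besicovitch.ae_tendsto_measure_inter_div σ T).and (ae_restrict_mem hT)).exists
    exact ⟨x, h2, h1⟩
  obtain ⟨x, hx, hxt⟩ := pick hX hX0
  obtain ⟨y, hy, hyt⟩ := pick hY hY0
  have hxn : ‖x‖ = 1 := by simpa using hXs hx
  have hyn : ‖y‖ = 1 := by simpa using hYs hy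
  have hne : y ≠ x := fun h => Set.disjoint_left.1 hXY hx (h ▸ hy)
  have hv : y - x ≠ 0 := sub_ne_zero.2 hne
  refine ⟨x, hx, y, hy, hv, ?_⟩
  have hsw : hrefl (y - x) y = x := Submodule.reflection_sub (by rw [hxn, hyn])
  have hin : 0 < inner ℝ (y - x) y := by
    have h1 : 0 < ‖y - x‖ ^ 2 := by have := norm_pos_iff.2 hv; positivity
    rw [norm_sub_sq_real, hxn, hyn] at h1
    rw [inner_sub_left, real_inner_self_eq_norm_sq, hyn, real_inner_comm]
    linarith
  have hopen : IsOpen {z : V | 0 < inner ℝ (y - x) z} := isOpen_lt continuous_const (by fun_prop)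
  obtain ⟨r0, hr0, hball⟩ := Metric.isOpen_iff.1 hopen y hin
  have h1 : ∀ᶠ r : ℝ in 𝓝[>] 0, (1/2 : ℝ≥0∞) < σ (X ∩ closedBall x r) / σ (closedBall x r) :=
    (tendsto_order.1 hxt).1 _ (by simp)
  have h2 : ∀ᶠ r : ℝ in 𝓝[>] 0, (1/2 : ℝ≥0∞) < σ (Y ∩ closedBall y r) / σ (closedBall y r) :=
    (tendsto_order.1 hyt).1 _ (by simp)
  have h3 : ∀ᶠ r : ℝ in 𝓝[>] 0, r ∈ Ioo (0:ℝ) r0 := Ioo_mem_nhdsGT hr0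
  obtain ⟨r, hrx, hry, hr⟩ := (h1.and (h2.and h3)).exists
  have hpre : (hrefl (y-x)) ⁻¹' (closedBall x r) = closedBall y r := by
    ext z
    simp only [mem_preimage, mem_closedBall]
    have hdm := (hrefl (y-x)).dist_map z y
    rw [hsw] at hdm
    rw [hdm]
  have hσb : σ (closedBall x r) = σ (closedBall y r) := by
    rw [← hpre, (hinv _).measure_preimage isClosed_closedBall.measurableSet.nullMeasurableSet]
  have hXm : MeasurableSet ((hrefl (y-x)) ⁻¹' X) := (hrefl (y-x)).continuous.measurable hX
  have hσX : σ ((hrefl (y-x)) ⁻¹' X ∩ closedBall y r) = σ (X ∩ closedBall x r) := by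
    rw [← hpre, ← preimage_inter, (hinv _).measure_preimage (hX.inter isClosed_closedBall.measurableSet).nullMeasurableSet]
  rw [hσb, ← hσX] at hrx
  have hb0 : σ (closedBall y r) ≠ 0 := by
    intro h
    have : σ (Y ∩ closedBall y r) = 0 := measure_mono_null inter_subset_right h
    rw [this] at hry; simp at hry
  have hbt : σ (closedBall y r) ≠ ⊤ := measure_ne_top _ _
  rw [ENNReal.lt_div_iff_mul_lt (Or.inl hb0) (Or.inl hbt)] at hrx hry
  intro hzero
  have hsub : ((hrefl (y-x)) ⁻¹' X ∩ closedBall y r) ∩ (Y ∩ closedBall y r) ⊆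
      {z | 0 < inner ℝ (y - x) z} ∩ Y ∩ (hrefl (y-x)) ⁻¹' X := by
    rintro z ⟨h1, h2⟩
    exact ⟨⟨hball (closedBall_subset_ball hr.2 h1.2), h2.1⟩, h1.1⟩
  have hz := measure_mono_null hsub hzero
  have hadd := measure_union_add_inter (μ := σ) ((hrefl (y-x)) ⁻¹' X ∩ closedBall y r) (hY.inter (isClosed_closedBall (x := y) (ε := r)).measurableSet)
  rw [hz, add_zero] at hadd
  have hle : σ (((hrefl (y-x)) ⁻¹' X ∩ closedBall y r) ∪ (Y ∩ closedBall y r)) ≤ σ (closedBall y r) :=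
    measure_mono (union_subset inter_subset_right inter_subset_right)
  rw [hadd] at hle
  have hlt := ENNReal.add_lt_add hrx hry
  rw [← add_mul] at hlt
  have : (1/2 + 1/2 : ℝ≥0∞) = 1 := by simp [ENNReal.inv_two_add_inv_two]
  rw [this, one_mul] at hlt
  exact absurd hlt (not_lt.2 hle)

open TopologicalSpace in
/-- Existence of an optimizer. -/
lemma exists_opt (σ : Measure V) [IsFiniteMeasure σ] {C : Set V} (hC : IsClosed C) (s M : ℝ≥0∞) (ε : ℝ) 
    (K0 : NonemptyCompacts V) (h0s : (K0 : Set V) ⊆ sphere 0 1) (h0 : s ≤ σ K0) (h0M : σ (thickening ε (K0 : Set V)) ≤ M) :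
    ∃ K : NonemptyCompacts V, (K : Set V) ⊆ sphere 0 1 ∧ s ≤ σ K ∧ σ (thickening ε (K : Set V)) ≤ M ∧
      ∀ K' : NonemptyCompacts V, (K' : Set V) ⊆ sphere 0 1 → s ≤ σ K' → σ (thickening ε (K' : Set V)) ≤ M →
        σ (K' ∩ C) ≤ σ (K ∩ C) := by
  set F : Set (NonemptyCompacts V) := {K | (K : Set V) ⊆ sphere 0 1 ∧ s ≤ σ K ∧ σ (thickening ε (K : Set V)) ≤ M} with hF
  have hFn : ((fun K : NonemptyCompacts V => σ (K ∩ C)) '' F).Nonempty := ⟨_, K0, ⟨h0s, h0, h0M⟩, rfl⟩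
  obtain ⟨a, -, hat, haF⟩ := exists_seq_tendsto_sSup hFn (OrderTop.bddAbove _)
  choose Ks hKs hKa using haF
  have hcomp : IsCompact {K : NonemptyCompacts V | (K : Set V) ⊆ sphere 0 1} :=
    NonemptyCompacts.isCompact_subsets_of_isCompact (isCompact_sphere 0 1)
  obtain ⟨K, hK, φ, hφ, hlim⟩ := hcomp.tendsto_subseq (fun j => (hKs j).1)
  have hdist : ∀ δ > 0, ∀ᶠ j in atTop, hausdorffDist (Ks (φ j) : Set V) (K : Set V) < δ := by
    intro δ hδ
    have := (Metric.tendsto_nhds.1 hlim) δ hδ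
    filter_upwards [this] with j hj
    rwa [NonemptyCompacts.dist_eq] at hj
  have hfin : ∀ K1 K2 : NonemptyCompacts V, hausdorffEDist (K1 : Set V) (K2 : Set V) ≠ ⊤ := fun K1 K2 =>
    hausdorffEDist_ne_top_of_nonempty_of_bounded K1.nonempty K2.nonempty K1.isCompact.isBounded K2.isCompact.isBounded
  have hsub1 : ∀ δ > 0, ∀ᶠ j in atTop, (Ks (φ j) : Set V) ⊆ cthickening δ (K : Set V) := by
    intro δ hδ
    filter_upwards [hdist δ hδ] with j hj x hx
    obtain ⟨y, hy, hxy⟩ := exists_dist_lt_of_hausdorffDist_lt hx hj (hfin _ _)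
    exact mem_cthickening_of_dist_le x y δ _ hy hxy.le
  have hsub2 : ∀ δ > 0, ∀ᶠ j in atTop, (K : Set V) ⊆ thickening δ (Ks (φ j) : Set V) := by
    intro δ hδ
    filter_upwards [hdist δ hδ] with j hj x hx
    obtain ⟨y, hy, hxy⟩ := exists_dist_lt_of_hausdorffDist_lt' hx hj (hfin _ _)
    exact mem_thickening_iff.2 ⟨y, hy, by rwa [dist_comm]⟩
  have husc : ∀ (D : Set V), IsClosed D → ∀ δ : ℕ → ℝ, (∀ i, 0 < δ i) → Tendsto δ atTop (𝓝 0) → 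
      Tendsto (fun i => σ (cthickening (δ i) (K : Set V) ∩ D)) atTop (𝓝 (σ (K ∩ D))) := by
    intro D hD δ hδ hδ0
    have := tendsto_measure_cthickening_of_isClosed (μ := σ.restrict D) (s := (K : Set V)) ⟨1, one_pos, measure_ne_top _ _⟩ K.isCompact.isClosed
    have h2 := this.comp hδ0
    simp only [Function.comp_def] at h2
    rw [Measure.restrict_apply K.isCompact.isClosed.measurableSet] at h2
    refine h2.congr fun i => ?_
    rw [Measure.restrict_apply isClosed_cthickening.measurableSet]
  have hlimle : ∀ (D : Set V), IsClosed D → ∀ (b : ℕ → ℝ≥0∞) (B : ℝ≥0∞), Tendsto b atTop (𝓝 B) → 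
      (∀ j, b j ≤ σ (Ks (φ j) ∩ D)) → B ≤ σ (K ∩ D) := by
    intro D hD b B hb hbj
    have h1 : ∀ δ > 0, B ≤ σ (cthickening δ (K : Set V) ∩ D) := by
      intro δ hδ
      refine le_of_tendsto hb ?_
      filter_upwards [hsub1 δ hδ] with j hj
      exact (hbj j).trans (measure_mono (inter_subset_inter_left _ hj))
    refine ge_of_tendsto (husc D hD (fun i => 1 / ((i:ℝ) + 1)) (fun i => by positivity) tendsto_one_div_add_atTop_nhds_zero_nat) ?_
    exact Eventually.of_forall fun i => h1 _ (by positivity)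
  refine ⟨K, hK, ?_, ?_, ?_⟩
  · have := hlimle univ isClosed_univ (fun _ => s) s tendsto_const_nhds (fun j => by simpa using (hKs (φ j)).2.1)
    simpa using this
  · have hun : thickening ε (K : Set V) = ⋃ i : ℕ, thickening (ε - 1 / ((i:ℝ) + 1)) (K : Set V) := by
      ext z
      simp only [mem_thickening_iff, mem_iUnion]
      constructor
      · rintro ⟨w, hw, hz⟩
        obtain ⟨j, hj⟩ := exists_nat_one_div_lt (sub_pos.2 hz)
        exact ⟨j, w, hw, by linarith⟩
      · rintro ⟨j, w, hw, hj⟩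
        have : (0:ℝ) < 1 / ((j:ℝ) + 1) := by positivity
        exact ⟨w, hw, by linarith⟩
    have hmono : Monotone (fun i : ℕ => thickening (ε - 1 / ((i:ℝ) + 1)) (K : Set V)) := by
      intro i j hij
      apply thickening_mono
      have : 1 / ((j:ℝ) + 1) ≤ 1 / ((i:ℝ) + 1) := by gcongr
      linarith
    rw [hun, hmono.measure_iUnion]
    apply iSup_le
    intro i
    obtain ⟨j, hj⟩ := (hsub2 (1 / ((i:ℝ) + 1)) (by positivity)).exists
    refine le_trans (measure_mono ?_) (hKs (φ j)).2.2
    intro z hz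
    obtain ⟨w, hw, hzw⟩ := mem_thickening_iff.1 hz
    obtain ⟨x, hx, hwx⟩ := mem_thickening_iff.1 (hj hw)
    exact mem_thickening_iff.2 ⟨x, hx, by linarith [dist_triangle z w x]⟩
  · intro K' h1 h2 h3
    have hle : σ (K' ∩ C) ≤ sSup ((fun K : NonemptyCompacts V => σ (K ∩ C)) '' F) := le_sSup ⟨K', ⟨h1, h2, h3⟩, rfl⟩
    refine hle.trans ?_
    exact hlimle C hC (a ∘ φ) _ (hat.comp hφ.tendsto_atTop) (fun j => (hKa (φ j)).ge)

end Sphere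

section Sphere

variable {V : Type*} [NormedAddCommGroup V] [InnerProductSpace ℝ V]

lemma cap_near {e w : V} (he : ‖e‖ = 1) (hw : ‖w‖ = 1) {θ ε : ℝ} (hθ : 0 < θ) (hε : 0 < ε) (hπ : θ + ε ≤ Real.pi)
    (hc : Real.cos (θ + ε) < inner ℝ e w) : ∃ z : V, ‖z‖ = 1 ∧ Real.cos θ < inner ℝ e z ∧ dist z w < ε := by
  by_cases h1 : Real.cos θ < inner ℝ e w
  · exact ⟨w, hw, h1, by simpa using hε⟩
  push Not at h1
  have habs : |inner ℝ e w| ≤ 1 := by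
    have := abs_real_inner_le_norm e w
    rwa [he, hw, one_mul] at this
  set α := Real.arccos (inner ℝ e w) with hα
  have hcα : Real.cos α = inner ℝ e w := Real.cos_arccos (abs_le.1 habs).1 (abs_le.1 habs).2
  have hα0 : 0 ≤ α := Real.arccos_nonneg _
  have hαπ : α ≤ Real.pi := Real.arccos_le_pi _
  have hα1 : α < θ + ε := by
    by_contra hcon; push Not at hcon
    have := Real.cos_le_cos_of_nonneg_of_le_pi (by linarith) hαπ hcon
    linarith
  have hα2 : θ ≤ α := by
    by_contra hcon; push Not at hcon
    have := Real.cos_lt_cos_of_nonneg_of_le_pi hα0 (by linarith) hcon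
    linarith
  obtain ⟨β, hβ1, hβ2⟩ := exists_between (show max 0 (α - ε) < θ from max_lt hθ (by linarith))
  have hβ0 : 0 < β := lt_of_le_of_lt (le_max_left _ _) hβ1
  have hβε : α - ε < β := lt_of_le_of_lt (le_max_right _ _) hβ1
  have hs : 0 < Real.sin α := Real.sin_pos_of_pos_of_lt_pi (by linarith) (by linarith)
  set q := w - inner ℝ e w • e with hq
  have heq : inner ℝ e q = 0 := by
    rw [hq, inner_sub_right, inner_smul_right, real_inner_self_eq_norm_sq, he]; ring
  have hw' : w = Real.cos α • e + q := by rw [hq, hcα]; abel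
  have hqn : ‖q‖ ^ 2 = Real.sin α ^ 2 := by
    have h2 : ‖w‖ ^ 2 = Real.cos α ^ 2 + ‖q‖ ^ 2 := by
      rw [hw', norm_add_sq_real, inner_smul_left, heq, norm_smul, he]; simp
    rw [hw] at h2
    have := Real.sin_sq_add_cos_sq α
    linarith
  refine ⟨Real.cos β • e + (Real.sin β / Real.sin α) • q, ?_, ?_, ?_⟩
  · have h2 : ‖Real.cos β • e + (Real.sin β / Real.sin α) • q‖ ^ 2 = 1 := by
      rw [norm_add_sq_real, inner_smul_left, inner_smul_right, heq, norm_smul, norm_smul, he, mul_pow, mul_pow, hqn]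
      simp only [Real.norm_eq_abs, sq_abs]
      have := Real.sin_sq_add_cos_sq β
      field_simp
      simp; linear_combination (Real.sin α) * this
    nlinarith [norm_nonneg (Real.cos β • e + (Real.sin β / Real.sin α) • q)]
  · rw [inner_add_right, inner_smul_right, inner_smul_right, heq, real_inner_self_eq_norm_sq, he]
    have := Real.cos_lt_cos_of_nonneg_of_le_pi hβ0.le (by linarith) hβ2
    linarith
  · have h3 : Real.cos β • e + (Real.sin β / Real.sin α) • q - w =
        (Real.cos β - Real.cos α) • e + (Real.sin β / Real.sin α - 1) • q := by
      rw [hw']; module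
    rw [dist_eq_norm, h3]
    apply lt_of_pow_lt_pow_left₀ 2 hε.le
    have h4 : ‖(Real.cos β - Real.cos α) • e + (Real.sin β / Real.sin α - 1) • q‖ ^ 2 = 2 - 2 * Real.cos (α - β) := by
      rw [norm_add_sq_real, inner_smul_left, inner_smul_right, heq, norm_smul, norm_smul, he, mul_pow, mul_pow, hqn, Real.cos_sub]
      simp only [Real.norm_eq_abs, sq_abs]
      have h5 := Real.sin_sq_add_cos_sq β
      have h6 := Real.sin_sq_add_cos_sq α
      have h7 : (Real.sin β / Real.sin α - 1) ^ 2 * Real.sin α ^ 2 = (Real.sin β - Real.sin α) ^ 2 := by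
        field_simp
      rw [h7]; simp
      nlinarith
    rw [h4]
    have := Real.one_sub_sq_div_two_le_cos (x := α - β)
    have h8 : (α - β) ^ 2 < ε ^ 2 := by
      apply pow_lt_pow_left₀ <;> first | linarith | norm_num
    linarith

variable [FiniteDimensional ℝ V] [MeasurableSpace V] [BorelSpace V]

open TopologicalSpace in
lemma levy (σ : Measure V) [IsFiniteMeasure σ] (hinv : ∀ v : V, MeasurePreserving (hrefl v) σ σ)
    (hsph : σ (sphere 0 1)ᶜ = 0) (hpos : ∀ U : Set V, IsOpen U → (U ∩ sphere 0 1).Nonempty → σ U ≠ 0)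
    {e : V} (he : ‖e‖ = 1) {θ ε : ℝ} (hθ : 0 < θ) (hε : 0 < ε) (hπ : θ + ε ≤ Real.pi)
    {K0 : Set V} (hK0 : IsCompact K0) (hK0s : K0 ⊆ sphere 0 1)
    (hle : σ {z | Real.cos θ ≤ inner ℝ e z} ≤ σ K0) :
    σ {z | Real.cos (θ + ε) < inner ℝ e z} ≤ σ (thickening ε K0) := by
  have hcont : Continuous fun z : V => (inner ℝ e z : ℝ) := by fun_prop
  set C : Set V := sphere 0 1 ∩ {z | Real.cos θ ≤ inner ℝ e z} with hC
  have hCc : IsClosed C := isClosed_sphere.inter (isClosed_le continuous_const hcont)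
  have hCm := hCc.measurableSet
  have hUo : IsOpen {z : V | Real.cos θ < inner ℝ e z} := isOpen_lt continuous_const hcont
  have hnull : ∀ U : Set V, σ U ≤ σ (sphere 0 1 ∩ U) := by
    intro U
    calc σ U ≤ σ ((sphere 0 1 ∩ U) ∪ (sphere 0 1)ᶜ) := measure_mono fun x hx => by
          by_cases h : x ∈ sphere (0:V) 1
          · exact Or.inl ⟨h, hx⟩
          · exact Or.inr h
      _ ≤ _ := measure_union_le _ _
      _ = _ := by rw [hsph, add_zero]
  have hC0 : σ C ≠ 0 := by
    have h1 : σ {z : V | Real.cos θ < inner ℝ e z} ≠ 0 := by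
      refine hpos _ hUo ⟨e, ?_, by simpa using he⟩
      rw [mem_ofPred_eq, real_inner_self_eq_norm_sq, he]
      have := Real.cos_lt_cos_of_nonneg_of_le_pi le_rfl (by linarith) hθ
      simpa using this
    intro h0
    apply h1
    refine le_antisymm ((hnull _).trans ((measure_mono ?_).trans h0.le)) zero_le
    refine inter_subset_inter_right _ fun z hz => ?_
    exact (show Real.cos θ ≤ inner ℝ e z from le_of_lt hz)
  have hCK0 : σ C ≤ σ K0 := (measure_mono inter_subset_right).trans hle
  have hK0n : K0.Nonempty := by
    rw [nonempty_iff_ne_empty]; rintro rfl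
    simp at hCK0; exact hC0 hCK0
  obtain ⟨K, hKs, hK1, hK2, hKopt⟩ := exists_opt σ hCc (σ C) (σ (thickening ε K0)) ε ⟨⟨K0, hK0⟩, hK0n⟩ hK0s hCK0 le_rfl
  have hKm : MeasurableSet (K : Set V) := K.isCompact.isClosed.measurableSet
  refine le_trans ?_ hK2
  have hCK : σ (C \ K) = 0 := by
    by_contra hne
    have hKC : σ ((K : Set V) \ C) ≠ 0 := by
      intro h0
      have h1 := measure_inter_add_sdiff (μ := σ) (K : Set V) hCm
      have h2 := measure_inter_add_sdiff (μ := σ) C hKm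
      rw [h0, add_zero] at h1
      rw [← h1, ← h2, inter_comm] at hK1
      have h3 : σ ((K : Set V) ∩ C) + σ (C \ K) ≤ σ ((K : Set V) ∩ C) + 0 := by rwa [add_zero]
      have h4 := (ENNReal.add_le_add_iff_left (measure_ne_top σ _)).1 h3
      exact hne (le_antisymm h4 zero_le)
    obtain ⟨x, hx, y, hy, hv, hG⟩ := exists_refl_swap σ hinv (hKm.diff hCm) (hCm.diff hKm)
      (sdiff_subset.trans hKs) (sdiff_subset.trans inter_subset_left) hKC hne
      (Set.disjoint_left.2 fun z hz hz' => hz.2 hz'.1)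
    have hev : 0 < inner ℝ e (y - x) := by
      rw [inner_sub_right]
      have h1 : Real.cos θ ≤ inner ℝ e y := hy.1.2
      have h2 : inner ℝ e x < Real.cos θ := by
        by_contra hcon; push Not at hcon
        exact hx.2 ⟨hKs hx.1, hcon⟩
      linarith
    have hCv : ∀ z, 0 < inner ℝ (y - x) z → hrefl (y - x) z ∈ C → z ∈ C := by
      rintro z hz ⟨h1, h2⟩
      refine ⟨by simpa using h1, ?_⟩
      simp only [mem_ofPred_eq] at h2 ⊢
      rw [hrefl_apply, inner_sub_right, inner_smul_right] at h2
      have : 0 ≤ 2 * inner ℝ (y - x) z / ‖y - x‖ ^ 2 * inner ℝ e (y - x) := by positivity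
      linarith
    have hmain := measure_polz_inter hv σ (hinv _) hKm hCm hCv
    have hpm := measure_polz hv σ (hinv _) hKm
    have hpc : IsCompact (polz (y-x) (K : Set V)) :=
      (isCompact_sphere (0:V) 1).of_isClosed_subset (isClosed_polz _ K.isCompact.isClosed) (polz_subset _ 1 hKs)
    have hpn : (polz (y-x) (K : Set V)).Nonempty := by
      rw [nonempty_iff_ne_empty]; intro h0
      rw [h0, measure_empty] at hpm
      rw [← hpm] at hK1
      exact hC0 (le_antisymm hK1 zero_le)
    have hth : σ (thickening ε (polz (y-x) (K : Set V))) ≤ σ (thickening ε K0) := by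
      refine (measure_mono (thickening_polz hv _ _)).trans ?_
      rw [measure_polz hv σ (hinv _) isOpen_thickening.measurableSet]
      exact hK2
    have hopt := hKopt ⟨⟨_, hpc⟩, hpn⟩ (polz_subset _ 1 hKs) (by change σ C ≤ σ (polz (y-x) (K : Set V)); rw [hpm]; exact hK1) hth
    have h5 := hmain.trans (show σ (polz (y-x) (K : Set V) ∩ C) ≤ σ ((K : Set V) ∩ C) from hopt)
    have h3 : σ ((K : Set V) ∩ C) + σ ({z | 0 < inner ℝ (y - x) z} ∩ (C \ K) ∩ hrefl (y - x) ⁻¹' ((K : Set V) \ C)) ≤ σ ((K : Set V) ∩ C) + 0 := by rwa [add_zero]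
    have h4 := (ENNReal.add_le_add_iff_left (measure_ne_top σ _)).1 h3
    exact hG (le_antisymm h4 zero_le)
  refine (hnull _).trans (measure_mono ?_)
  rintro w ⟨hw, hwc⟩
  have hw1 : ‖w‖ = 1 := by simpa using hw
  obtain ⟨z, hz1, hz2, hz3⟩ := cap_near he hw1 hθ hε hπ hwc
  have hU : IsOpen ({z : V | Real.cos θ < inner ℝ e z} ∩ ball w ε) := hUo.inter isOpen_ball
  have hU0 := hpos _ hU ⟨z, ⟨hz2, hz3⟩, by simpa using hz1⟩
  have hne : ((sphere 0 1 ∩ ({z : V | Real.cos θ < inner ℝ e z} ∩ ball w ε)) ∩ K).Nonempty := by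
    by_contra hcon
    rw [not_nonempty_iff_eq_empty] at hcon
    apply hU0
    refine le_antisymm ((hnull _).trans ((measure_mono ?_).trans hCK.le)) zero_le
    intro x hx
    refine ⟨⟨hx.1, show Real.cos θ ≤ inner ℝ e x from le_of_lt hx.2.1⟩, fun hxK => ?_⟩
    have : x ∈ (∅ : Set V) := by rw [← hcon]; exact ⟨hx, hxK⟩
    exact this
  obtain ⟨x, hx, hxK⟩ := hne
  exact mem_thickening_iff.2 ⟨x, hxK, by rw [dist_comm]; exact hx.2.2⟩

end Sphere

section Arch

lemma map_normSq_complex :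
    NNReal.pi • (volume.restrict (Ioi (0:ℝ))) = Measure.map (fun y : ℂ => ‖y‖ ^ 2) volume := by
  apply Real.measure_ext_Ioo_rat
  intro a b
  generalize (a:ℝ) = a
  generalize (b:ℝ) = b
  have hm : Measurable fun y : ℂ => ‖y‖ ^ 2 := by fun_prop
  rw [Measure.map_apply hm measurableSet_Ioo, Measure.smul_apply, Measure.restrict_apply measurableSet_Ioo]
  rcases le_or_gt b 0 with hb | hb
  · have h1 : Ioo a b ∩ Ioi 0 = ∅ := by
      ext x; simp; intro _ h; linarith
    have h2 : (fun y : ℂ => ‖y‖ ^ 2) ⁻¹' Ioo a b = ∅ := by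
      ext x; simp; intro _; nlinarith [norm_nonneg x]
    rw [h1, h2]; simp
  have hball : ∀ t : ℝ, 0 ≤ t → volume {y : ℂ | ‖y‖ ^ 2 < t} = ENNReal.ofReal t * NNReal.pi := by
    intro t ht
    have : {y : ℂ | ‖y‖ ^ 2 < t} = ball 0 (√t) := by
      ext y; simp [Real.lt_sqrt]
    rw [this, Complex.volume_ball, ← ENNReal.ofReal_pow (by positivity), Real.sq_sqrt ht]
  have hcball : ∀ t : ℝ, 0 ≤ t → volume {y : ℂ | ‖y‖ ^ 2 ≤ t} = ENNReal.ofReal t * NNReal.pi := by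
    intro t ht
    have : {y : ℂ | ‖y‖ ^ 2 ≤ t} = closedBall 0 (√t) := by
      ext y; rw [mem_closedBall_zero_iff, Real.le_sqrt (norm_nonneg y) ht]; rfl
    rw [this, Complex.volume_closedBall, ← ENNReal.ofReal_pow (by positivity), Real.sq_sqrt ht]
  rcases lt_or_ge a 0 with ha | ha
  · have h1 : Ioo a b ∩ Ioi 0 = Ioo 0 b := by
      ext x; simp; constructor
      · rintro ⟨⟨_, h⟩, h'⟩; exact ⟨h', h⟩
      · rintro ⟨h, h'⟩; exact ⟨⟨by linarith, h'⟩, h⟩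
    have h2 : (fun y : ℂ => ‖y‖ ^ 2) ⁻¹' Ioo a b = {y : ℂ | ‖y‖ ^ 2 < b} := by
      ext x; simp; intro _; nlinarith [norm_nonneg x]
    rw [h1, h2, hball b hb.le, Real.volume_Ioo, sub_zero, mul_comm]
    rfl
  · have h1 : Ioo a b ∩ Ioi 0 = Ioo a b := by
      ext x; simp; intro h _; linarith
    rw [h1, Real.volume_Ioo]
    rcases le_or_gt b a with hab | hab
    · have h2 : (fun y : ℂ => ‖y‖ ^ 2) ⁻¹' Ioo a b = ∅ := by
        rw [Ioo_eq_empty (by linarith)]; simp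
      rw [h2, ENNReal.ofReal_of_nonpos (by linarith)]; simp
    have h2 : (fun y : ℂ => ‖y‖ ^ 2) ⁻¹' Ioo a b = {y : ℂ | ‖y‖ ^ 2 < b} \ {y : ℂ | ‖y‖ ^ 2 ≤ a} := by
      ext x; simp [Set.mem_sdiff, and_comm]
    rw [h2, measure_sdiff, hball b hb.le, hcball a ha, ENNReal.ofReal_sub _ ha, ← ENNReal.sub_mul]
    · rw [mul_comm]; rfl
    · intro _ _; simp
    · intro y hy; exact lt_of_le_of_lt (show _ ≤ a from hy) hab
    · exact (isClosed_le (by fun_prop) continuous_const).nullMeasurableSet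
    · rw [hcball a ha]; exact ENNReal.mul_ne_top ENNReal.ofReal_ne_top ENNReal.coe_ne_top

lemma lintegral_normSq_complex {g : ℝ → ℝ≥0∞} (hg : Measurable g) :
    ∫⁻ y : ℂ, g (‖y‖ ^ 2) = NNReal.pi * ∫⁻ s in Ioi (0:ℝ), g s := by
  have hm : Measurable fun y : ℂ => ‖y‖ ^ 2 := by fun_prop
  rw [← lintegral_map (f := g) hg hm, ← map_normSq_complex, lintegral_smul_measure]
  rfl

variable {X : Type*} [NormedAddCommGroup X] [InnerProductSpace ℝ X] [FiniteDimensional ℝ X]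
  [MeasurableSpace X] [BorelSpace X]

/-- uniform cone measure on the unit sphere -/
def coneM (V : Type*) [NormedAddCommGroup V] [InnerProductSpace ℝ V] [FiniteDimensional ℝ V]
  [MeasurableSpace V] [BorelSpace V] : Measure V :=
  Measure.map (fun v : V => ‖v‖⁻¹ • v) (volume.restrict (ball 0 1))

lemma coneM_apply {A : Set X} (hA : MeasurableSet A) :
    coneM X A = volume {v : X | ‖v‖ < 1 ∧ ‖v‖⁻¹ • v ∈ A} := by
  have hm : Measurable (fun v : X => ‖v‖⁻¹ • v) := by fun_prop
  rw [coneM, Measure.map_apply hm hA, Measure.restrict_apply (hm hA)]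
  congr 1
  ext v; simp [and_comm]

instance : IsFiniteMeasure (coneM X) := by
  have : IsFiniteMeasure ((volume : Measure X).restrict (ball 0 1)) :=
    ⟨by rw [Measure.restrict_apply_univ]; exact measure_ball_lt_top⟩
  unfold coneM
  infer_instance

lemma coneM_inv (L : X ≃ₗᵢ[ℝ] X) : MeasurePreserving L (coneM X) (coneM X) := by
  refine ⟨L.continuous.measurable, ?_⟩
  ext A hA
  rw [Measure.map_apply L.continuous.measurable hA, coneM_apply hA, coneM_apply (L.continuous.measurable hA)]
  rw [← (L.measurePreserving).measure_preimage (s := {v : X | ‖v‖ < 1 ∧ ‖v‖⁻¹ • v ∈ A})]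
  · congr 1
    ext v; simp
  · apply MeasurableSet.nullMeasurableSet
    have hm : Measurable (fun v : X => ‖v‖⁻¹ • v) := by fun_prop
    exact (measurableSet_lt measurable_norm measurable_const).inter (hm hA)

lemma coneM_sphere [Nontrivial X] : coneM X (sphere 0 1)ᶜ = 0 := by
  rw [coneM_apply isClosed_sphere.measurableSet.compl]
  refine measure_mono_null (t := {0}) ?_ (measure_singleton _)
  rintro v ⟨_, h⟩
  by_contra hv
  apply h
  have : ‖v‖ ≠ 0 := norm_ne_zero_iff.2 hv
  simp [norm_smul, this]

lemma coneM_pos (U : Set X) (hU : IsOpen U) (hne : (U ∩ sphere 0 1).Nonempty) : coneM X U ≠ 0 := by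
  obtain ⟨p, hp, hp1⟩ := hne
  have hp1 : ‖p‖ = 1 := by simpa using hp1
  rw [coneM_apply hU.measurableSet]
  have hc : ContinuousOn (fun v : X => ‖v‖⁻¹ • v) {0}ᶜ := by
    apply ContinuousOn.smul _ continuousOn_id
    exact continuous_norm.continuousOn.inv₀ (fun v hv => norm_ne_zero_iff.2 hv)
  have ho : IsOpen ({0}ᶜ ∩ (fun v : X => ‖v‖⁻¹ • v) ⁻¹' U) := hc.isOpen_inter_preimage isOpen_compl_singleton hU
  have ho2 := (isOpen_ball (x := (0:X)) (ε := 1)).inter ho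
  refine ne_of_gt (lt_of_lt_of_le (ho2.measure_pos volume ⟨(1/2:ℝ) • p, ?_, ?_, ?_⟩) (measure_mono ?_))
  · simp [norm_smul, hp1]; norm_num
  · simp; intro h; rw [h] at hp1; simp at hp1
  · simp [norm_smul, hp1, hp]
  · rintro v ⟨h1, _, h3⟩
    exact ⟨by simpa using h1, h3⟩

/-- constant in Archimedes' projection theorem -/
def archC (X : Type*) [NormedAddCommGroup X] [InnerProductSpace ℝ X] : ℝ≥0∞ :=
  NNReal.pi * ∫⁻ t in Ioo (0:ℝ) 1, ENNReal.ofReal (√t ^ Module.finrank ℝ X)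

lemma archC_ne_zero : archC X ≠ 0 := by
  apply mul_ne_zero (by simp [NNReal.pi_ne_zero])
  rw [← pos_iff_ne_zero, setLIntegral_pos_iff (by fun_prop)]
  have : Function.support (fun t : ℝ => ENNReal.ofReal (√t ^ Module.finrank ℝ X)) ∩ Ioo 0 1 = Ioo 0 1 := by
    apply inter_eq_right.2
    intro t ht
    have : 0 < √t := Real.sqrt_pos.2 ht.1
    simp only [Function.mem_support, ne_eq, ENNReal.ofReal_eq_zero, not_le]; positivity
  rw [this]; simp

lemma archC_ne_top : archC X ≠ ⊤ := by
  apply ENNReal.mul_ne_top ENNReal.coe_ne_top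
  refine ne_of_lt (lt_of_le_of_lt (setLIntegral_mono' measurableSet_Ioo (g := fun _ => 1) ?_) ?_)
  · intro t ht
    rw [ENNReal.ofReal_le_one]
    apply pow_le_one₀ (by positivity)
    rw [Real.sqrt_le_one]; exact ht.2.le
  · simp

lemma arch [Nontrivial X] {A : Set X} (hA : MeasurableSet A) :
    coneM (WithLp 2 (X × ℂ)) {v | v.fst ∈ A} = archC X * volume (A ∩ ball 0 1) := by
  have hf : Measurable (fun v : WithLp 2 (X × ℂ) => v.fst) := by
    exact (WithLp.prod_continuous_ofLp 2 X ℂ).fst.measurable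
  have hA' : MeasurableSet {v : WithLp 2 (X × ℂ) | v.fst ∈ A} := hf hA
  have hm : Measurable (fun v : WithLp 2 (X × ℂ) => ‖v‖⁻¹ • v) := by fun_prop
  rw [coneM_apply hA']
  have hS : MeasurableSet {v : WithLp 2 (X × ℂ) | ‖v‖ < 1 ∧ ‖v‖⁻¹ • v ∈ {v : WithLp 2 (X × ℂ) | v.fst ∈ A}} :=
    (measurableSet_lt measurable_norm measurable_const).inter (hm hA')
  rw [← (WithLp.volume_preserving_toLp X ℂ).measure_preimage hS.nullMeasurableSet]
  set R : Set (X × ℝ) := {p | p.2 < 1 ∧ 0 < p.2 ∧ (√p.2)⁻¹ • p.1 ∈ A} with hR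
  have hmR : Measurable (fun p : X × ℝ => (√p.2)⁻¹ • p.1) := by fun_prop
  have hRm : MeasurableSet R :=
    (measurableSet_lt measurable_snd measurable_const).inter
     ((measurableSet_lt measurable_const measurable_snd).inter (hmR hA))
  have hpre : MeasurableSet (WithLp.toLp 2 ⁻¹' {v : WithLp 2 (X × ℂ) | ‖v‖ < 1 ∧ ‖v‖⁻¹ • v ∈ {v : WithLp 2 (X × ℂ) | v.fst ∈ A}}) :=
    (WithLp.volume_preserving_toLp X ℂ).measurable hS
  rw [Measure.volume_eq_prod, Measure.prod_apply hpre]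
  have h1 : ∀ x : X, x ≠ 0 → (volume : Measure ℂ) (Prod.mk x ⁻¹' (WithLp.toLp 2 ⁻¹' {v : WithLp 2 (X × ℂ) | ‖v‖ < 1 ∧ ‖v‖⁻¹ • v ∈ {v : WithLp 2 (X × ℂ) | v.fst ∈ A}}))
      = NNReal.pi * ∫⁻ t, (R ∩ {p | ‖p.1‖ ^ 2 < p.2}).indicator 1 (x, t) := by
    intro x hx
    have hx' : 0 < ‖x‖ := norm_pos_iff.2 hx
    have e1 : Prod.mk x ⁻¹' (WithLp.toLp 2 ⁻¹' {v : WithLp 2 (X × ℂ) | ‖v‖ < 1 ∧ ‖v‖⁻¹ • v ∈ {v : WithLp 2 (X × ℂ) | v.fst ∈ A}})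
       = (fun y : ℂ => ‖y‖ ^ 2) ⁻¹' {s : ℝ | (x, ‖x‖ ^ 2 + s) ∈ R} := by
      ext y
      have hn : ‖WithLp.toLp 2 (x, y)‖ = √(‖x‖ ^ 2 + ‖y‖ ^ 2) := by
        rw [WithLp.prod_norm_eq_of_L2]; rfl
      have : 0 < ‖x‖ ^ 2 + ‖y‖ ^ 2 := by positivity
      simp only [mem_preimage, mem_ofPred_eq, hn, hR, WithLp.smul_fst, this, true_and]
      rw [Real.sqrt_lt' one_pos, one_pow]; rfl
    have hQ : MeasurableSet {s : ℝ | (x, ‖x‖ ^ 2 + s) ∈ R} := by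
      have : Measurable fun s : ℝ => (x, ‖x‖ ^ 2 + s) := by fun_prop
      exact this hRm
    have hm2 : Measurable fun y : ℂ => ‖y‖ ^ 2 := by fun_prop
    rw [e1, ← lintegral_indicator_one (hm2 hQ)]
    have e2 : ∀ y : ℂ, ((fun y : ℂ => ‖y‖ ^ 2) ⁻¹' {s : ℝ | (x, ‖x‖ ^ 2 + s) ∈ R}).indicator (1 : ℂ → ℝ≥0∞) y
       = ({s : ℝ | (x, ‖x‖ ^ 2 + s) ∈ R}.indicator (1 : ℝ → ℝ≥0∞)) (‖y‖ ^ 2) := fun y => rfl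
    simp_rw [e2]
    rw [lintegral_normSq_complex (measurable_one.indicator hQ), ← lintegral_indicator measurableSet_Ioi]
    rw [← lintegral_add_left_eq_self (μ := (volume : Measure ℝ)) (fun t => (R ∩ {p | ‖p.1‖ ^ 2 < p.2}).indicator (1 : X × ℝ → ℝ≥0∞) (x, t)) (‖x‖ ^ 2)]
    congr 2
    ext s
    by_cases hs : 0 < s <;> by_cases hsR : (x, ‖x‖ ^ 2 + s) ∈ R <;> simp [indicator, hs, hsR]
  have hR2 : MeasurableSet (R ∩ {p : X × ℝ | ‖p.1‖ ^ 2 < p.2}) :=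
    hRm.inter (measurableSet_lt (by fun_prop) (by fun_prop))
  have h2 : ∀ᵐ x : X, x ≠ 0 := by
    filter_upwards [show ∀ᵐ x : X, x ∉ ({0} : Set X) from measure_eq_zero_iff_ae_notMem.1 (measure_singleton 0)] with x hx
    exact hx
  rw [lintegral_congr_ae (h2.mono h1), lintegral_const_mul _ (measurable_one.indicator hR2).lintegral_prod_right',
    lintegral_lintegral_swap (f := fun x t => (R ∩ {p | ‖p.1‖ ^ 2 < p.2}).indicator (1 : X × ℝ → ℝ≥0∞) (x, t))
      (measurable_one.indicator hR2).aemeasurable]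
  have h3 : ∀ t : ℝ, ∫⁻ x : X, (R ∩ {p | ‖p.1‖ ^ 2 < p.2}).indicator (1 : X × ℝ → ℝ≥0∞) (x, t) =
      (Ioo (0:ℝ) 1).indicator (fun t => ENNReal.ofReal (√t ^ Module.finrank ℝ X) * volume (A ∩ ball 0 1)) t := by
    intro t
    by_cases ht : t ∈ Ioo (0:ℝ) 1
    · have hst : 0 < √t := Real.sqrt_pos.2 ht.1
      rw [indicator_of_mem ht]
      have e1 : ∀ x : X, (R ∩ {p | ‖p.1‖ ^ 2 < p.2}).indicator (1 : X × ℝ → ℝ≥0∞) (x, t) =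
          (((√t)⁻¹ • ·) ⁻¹' (A ∩ ball 0 1)).indicator (1 : X → ℝ≥0∞) x := by
        intro x
        have : (x, t) ∈ R ∩ {p | ‖p.1‖ ^ 2 < p.2} ↔ x ∈ (((√t)⁻¹ • ·) ⁻¹' (A ∩ ball (0:X) 1)) := by
          simp only [hR, mem_inter_iff, mem_ofPred_eq, mem_preimage, ht.1, ht.2, true_and, mem_ball_zero_iff, norm_smul]
          rw [Real.norm_of_nonneg (by positivity), inv_mul_lt_iff₀ hst, mul_one, Real.lt_sqrt (norm_nonneg x)]
        by_cases h : x ∈ (((√t)⁻¹ • ·) ⁻¹' (A ∩ ball (0:X) 1))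
        · rw [indicator_of_mem h, indicator_of_mem (this.2 h)]; rfl
        · rw [indicator_of_notMem h, indicator_of_notMem (fun h' => h (this.1 h'))]
      have hmm : MeasurableSet (((√t)⁻¹ • ·) ⁻¹' (A ∩ ball (0:X) 1)) :=
        (measurable_const_smul _) (hA.inter measurableSet_ball)
      simp_rw [e1]
      rw [lintegral_indicator_one hmm, Measure.addHaar_preimage_smul _ (by positivity)]
      congr 2
      rw [inv_pow, inv_inv, abs_of_nonneg (by positivity)]
    · rw [indicator_of_notMem ht]
      have e1 : ∀ x : X, (R ∩ {p | ‖p.1‖ ^ 2 < p.2}).indicator (1 : X × ℝ → ℝ≥0∞) (x, t) = 0 := by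
        intro x
        apply indicator_of_notMem
        rintro ⟨⟨h1, h2, _⟩, _⟩
        exact ht ⟨h2, h1⟩
      simp [e1]
  simp_rw [h3]
  rw [lintegral_indicator measurableSet_Ioo, lintegral_mul_const _ (by fun_prop), archC, mul_assoc]

end Arch

section BallIso

variable {X : Type*} [NormedAddCommGroup X] [InnerProductSpace ℝ X] [FiniteDimensional ℝ X]
  [MeasurableSpace X] [BorelSpace X]

lemma ball_iso [Nontrivial X] {e : X} (he : ‖e‖ = 1) {θ ε : ℝ} (hθ : 0 < θ) (hε : 0 < ε) (hπ : θ + ε ≤ Real.pi)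
    {K : Set X} (hK : IsCompact K)
    (hle : volume ({x | Real.cos θ ≤ inner ℝ e x} ∩ ball 0 1) ≤ volume (K ∩ ball 0 1)) :
    volume ({x | Real.cos (θ + ε) < inner ℝ e x} ∩ ball 0 1) ≤ volume (thickening ε K ∩ ball 0 1) := by
  have hcont : Continuous fun z : X => (inner ℝ e z : ℝ) := by fun_prop
  have hfc : Continuous (fun v : WithLp 2 (X × ℂ) => v.fst) := (WithLp.prod_continuous_ofLp 2 X ℂ).fst
  set K0 : Set (WithLp 2 (X × ℂ)) := sphere 0 1 ∩ {v | v.fst ∈ K} with hK0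
  have hK0c : IsCompact K0 := (isCompact_sphere _ _).inter_right (hK.isClosed.preimage hfc)
  have hnt : Nontrivial (WithLp 2 (X × ℂ)) := (WithLp.equiv 2 (X × ℂ)).nontrivial
  have hinner : ∀ v : WithLp 2 (X × ℂ), inner ℝ (WithLp.toLp 2 (e, (0:ℂ))) v = inner ℝ e v.fst := by
    intro v
    rw [WithLp.prod_inner_apply]; simp
  have hnull : ∀ U : Set (WithLp 2 (X × ℂ)), coneM _ U ≤ coneM _ (sphere 0 1 ∩ U) := by
    intro U
    calc coneM _ U ≤ coneM _ ((sphere 0 1 ∩ U) ∪ (sphere 0 1)ᶜ) := measure_mono fun x hx => by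
          by_cases h : x ∈ sphere (0:WithLp 2 (X × ℂ)) 1
          · exact Or.inl ⟨h, hx⟩
          · exact Or.inr h
      _ ≤ _ := measure_union_le _ _
      _ = _ := by rw [coneM_sphere, add_zero]
  have key := levy (coneM (WithLp 2 (X × ℂ))) (fun v => coneM_inv _) coneM_sphere coneM_pos
    (e := WithLp.toLp 2 (e, (0:ℂ))) (by rw [WithLp.prod_norm_eq_of_L2]; simp [he]) hθ hε hπ hK0c inter_subset_left
  simp only [hinner] at key
  have h1 := arch (A := {x : X | Real.cos θ ≤ inner ℝ e x}) (isClosed_le continuous_const hcont).measurableSet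
  have h2 := arch (A := {x : X | Real.cos (θ + ε) < inner ℝ e x}) (isOpen_lt continuous_const hcont).measurableSet
  have h3 := arch (A := K) hK.isClosed.measurableSet
  have h4 := arch (A := thickening ε K) isOpen_thickening.measurableSet
  have key2 := key (by
    refine le_trans ?_ (hnull _)
    rw [h3]
    change coneM (WithLp 2 (X × ℂ)) {v | v.fst ∈ {x : X | Real.cos θ ≤ inner ℝ e x}} ≤ _
    rw [h1]
    gcongr)
  have key3 : coneM (WithLp 2 (X × ℂ)) (thickening ε K0) ≤ coneM (WithLp 2 (X × ℂ)) {v | v.fst ∈ thickening ε K} := by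
    apply measure_mono
    intro v hv
    obtain ⟨z, hz, hd⟩ := mem_thickening_iff.1 hv
    refine mem_thickening_iff.2 ⟨z.fst, hz.2, lt_of_le_of_lt ?_ hd⟩
    rw [dist_eq_norm, dist_eq_norm, ← WithLp.sub_fst]
    apply le_of_sq_le_sq _ (norm_nonneg _)
    rw [WithLp.prod_norm_sq_eq_of_L2]
    nlinarith [sq_nonneg ‖(v - z).snd‖]
  change coneM (WithLp 2 (X × ℂ)) {v | v.fst ∈ {x : X | Real.cos (θ + ε) < inner ℝ e x}} ≤ _ at key2
  have key4 := key2.trans key3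
  rw [h2, h4] at key4
  exact (ENNReal.mul_le_mul_iff_right archC_ne_zero archC_ne_top).1 key4

end BallIso

section Calc

/-- the integral of `sin ^ n` -/
def sinI (n : ℕ) (θ : ℝ) : ℝ := ∫ x in (0:ℝ)..θ, Real.sin x ^ n

lemma sinI_hasDeriv (n : ℕ) (θ : ℝ) : HasDerivAt (sinI n) (Real.sin θ ^ n) θ :=
  ((by fun_prop : Continuous fun x => Real.sin x ^ n).integral_hasStrictDerivAt 0 θ).hasDerivAt

lemma sinI_zero (n : ℕ) : sinI n 0 = 0 := by simp [sinI]

lemma sinI_cont (n : ℕ) : Continuous (sinI n) :=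
  continuous_iff_continuousAt.2 fun θ => (sinI_hasDeriv n θ).continuousAt

lemma sinI_rec (n : ℕ) (θ : ℝ) : ((n:ℝ) + 2) * sinI (n+2) θ = - Real.sin θ ^ (n+1) * Real.cos θ + (n+1) * sinI n θ := by
  have h := integral_sin_pow (a := 0) (b := θ) (n := n)
  unfold sinI
  rw [h]
  simp
  field_simp

lemma sinI_one (θ : ℝ) : sinI 1 θ = 1 - Real.cos θ := by simp [sinI]

lemma sinI_zero' (θ : ℝ) : sinI 0 θ = θ := by simp [sinI]

/-- the key function -/
def hF (n : ℕ) (θ : ℝ) : ℝ := Real.sin θ ^ n - n * sinI n θ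

lemma hF_hasDeriv (n : ℕ) (θ : ℝ) :
    HasDerivAt (hF (n+1)) ((n+1) * Real.sin θ ^ n * (Real.cos θ - Real.sin θ)) θ := by
  have h1 := ((Real.hasDerivAt_sin θ).pow (n+1)).sub ((sinI_hasDeriv (n+1) θ).const_mul ((n+1 : ℕ):ℝ))
  refine HasDerivAt.congr_deriv (f := hF (n+1)) h1 ?_
  push_cast [Nat.add_sub_cancel]; ring

lemma hF_zero (n : ℕ) : hF (n+1) 0 = 0 := by simp [hF, sinI_zero]

lemma sin_cos_lt {θ : ℝ} (h0 : 0 ≤ θ) (h : θ < Real.pi / 4) : Real.sin θ < Real.cos θ := by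
  rw [← Real.sin_pi_div_two_sub]
  apply Real.sin_lt_sin_of_lt_of_le_pi_div_two <;> linarith [Real.pi_pos]

lemma cos_sin_lt {θ : ℝ} (h0 : Real.pi / 4 < θ) (h : θ ≤ Real.pi / 2) : Real.cos θ < Real.sin θ := by
  rw [← Real.sin_pi_div_two_sub]
  apply Real.sin_lt_sin_of_lt_of_le_pi_div_two <;> linarith [Real.pi_pos]

lemma hF_strictMono (n : ℕ) : StrictMonoOn (hF (n+1)) (Icc 0 (Real.pi / 4)) := by
  apply strictMonoOn_of_deriv_pos (convex_Icc _ _)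
    (fun θ _ => (hF_hasDeriv n θ).continuousAt.continuousWithinAt)
  intro θ hθ
  rw [interior_Icc] at hθ
  rw [(hF_hasDeriv n θ).deriv]
  have h1 : 0 < Real.sin θ := Real.sin_pos_of_pos_of_lt_pi hθ.1 (by linarith [hθ.2, Real.pi_pos])
  have h2 := sin_cos_lt hθ.1.le hθ.2
  have : 0 < Real.cos θ - Real.sin θ := by linarith
  positivity

lemma hF_antitone (n : ℕ) : AntitoneOn (hF (n+1)) (Icc (Real.pi / 4) (Real.pi / 2)) := by
  apply antitoneOn_of_deriv_nonpos (convex_Icc _ _)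
    (fun θ _ => (hF_hasDeriv n θ).continuousAt.continuousWithinAt)
    (fun θ _ => (hF_hasDeriv n θ).differentiableAt.differentiableWithinAt)
  intro θ hθ
  rw [interior_Icc] at hθ
  rw [(hF_hasDeriv n θ).deriv]
  have h1 : 0 < Real.sin θ := Real.sin_pos_of_pos_of_lt_pi (by linarith [hθ.1, Real.pi_pos]) (by linarith [hθ.2, Real.pi_pos])
  have h2 := cos_sin_lt hθ.1 hθ.2.le
  have : Real.cos θ - Real.sin θ ≤ 0 := by linarith
  exact mul_nonpos_of_nonneg_of_nonpos (by positivity) this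

/-- the calculus statement -/
def CalcGood (n : ℕ) : Prop := ∃ θ, 0 < θ ∧ θ < Real.pi / 2 ∧ 2 * sinI n (Real.pi / 4) < sinI n θ ∧
  ∀ t ∈ Icc 0 θ, n * sinI n t ≤ Real.sin t ^ n

lemma calcGood_of (n : ℕ) {θ : ℝ} (h1 : Real.pi / 4 ≤ θ) (h2 : θ < Real.pi / 2)
    (h3 : 2 * sinI (n+1) (Real.pi / 4) < sinI (n+1) θ) (h4 : ((n+1 : ℕ):ℝ) * sinI (n+1) θ ≤ Real.sin θ ^ (n+1)) :
    CalcGood (n+1) := by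
  have hp := Real.pi_pos
  refine ⟨θ, by linarith, h2, h3, fun t ht => ?_⟩
  have : 0 ≤ hF (n+1) t := by
    rcases le_total t (Real.pi / 4) with h | h
    · rw [← hF_zero n]
      exact (hF_strictMono n).monotoneOn ⟨le_rfl, by linarith⟩ ⟨ht.1, h⟩ ht.1
    · have h5 := hF_antitone n ⟨h, by linarith [ht.2]⟩ ⟨h1, h2.le⟩ ht.2
      have : 0 ≤ hF (n+1) θ := by unfold hF; linarith
      linarith
  unfold hF at this; linarith

lemma calc_one : CalcGood 1 := by
  have hc : Real.cos (Real.arccos (2/5)) = 2/5 := Real.cos_arccos (by norm_num) (by norm_num)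
  have hs : Real.sin (Real.arccos (2/5)) = √(1 - (2/5)^2) := Real.sin_arccos _
  have h2 : (1.41 : ℝ) < √2 := by apply Real.lt_sqrt_of_sq_lt; norm_num
  have h2' : √2 < (1.42 : ℝ) := by rw [Real.sqrt_lt' (by norm_num)]; norm_num
  apply calcGood_of 0 (θ := Real.arccos (2/5))
  · by_contra h; push Not at h
    have := Real.cos_lt_cos_of_nonneg_of_le_pi (Real.arccos_nonneg _) (by linarith [Real.pi_pos]) h
    rw [hc, Real.cos_pi_div_four] at this
    linarith
  · rw [Real.arccos_lt_pi_div_two]; norm_num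
  · rw [sinI_one, sinI_one, hc, Real.cos_pi_div_four]; linarith
  · rw [sinI_one, hc, hs]
    have : (3/5 : ℝ) ≤ √(1 - (2/5)^2) := by apply Real.le_sqrt_of_sq_le; norm_num
    norm_num at this ⊢; linarith

lemma sinI_two (θ : ℝ) : 2 * sinI 2 θ = θ - Real.sin θ * Real.cos θ := by
  have := sinI_rec 0 θ
  rw [sinI_zero'] at this; norm_num at this; linarith

lemma sinI_three (θ : ℝ) : 3 * sinI 3 θ = 2 - 2 * Real.cos θ - Real.sin θ ^ 2 * Real.cos θ := by
  have := sinI_rec 1 θ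
  rw [sinI_one] at this; norm_num at this; linarith

lemma sinI_four (θ : ℝ) : 8 * sinI 4 θ = 3 * (θ - Real.sin θ * Real.cos θ) - 2 * Real.sin θ ^ 3 * Real.cos θ := by
  have := sinI_rec 2 θ
  have h := sinI_two θ
  norm_num at this; linarith

lemma sinI_five (θ : ℝ) : 15 * sinI 5 θ = 4 * (2 - 2 * Real.cos θ - Real.sin θ ^ 2 * Real.cos θ) - 3 * Real.sin θ ^ 4 * Real.cos θ := by
  have := sinI_rec 3 θ
  have h := sinI_three θ
  norm_num at this; linarith

lemma sinI_six (θ : ℝ) : 48 * sinI 6 θ = 5 * (3 * (θ - Real.sin θ * Real.cos θ) - 2 * Real.sin θ ^ 3 * Real.cos θ) - 8 * Real.sin θ ^ 5 * Real.cos θ := by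
  have := sinI_rec 4 θ
  have h := sinI_four θ
  norm_num at this; linarith

lemma calc_two : CalcGood 2 := by
  have hp := Real.pi_gt_d2
  have hp' := Real.pi_lt_d2
  have h3 : √3 < (1.74 : ℝ) := by rw [Real.sqrt_lt' (by norm_num)]; norm_num
  have h3' : (1.73 : ℝ) < √3 := by apply Real.lt_sqrt_of_sq_lt; norm_num
  have h22 : √2 * √2 = 2 := Real.mul_self_sqrt (by norm_num)
  have h33 : √3 * √3 = 3 := Real.mul_self_sqrt (by norm_num)
  have e1 := sinI_two (Real.pi / 4)
  have e2 := sinI_two (Real.pi / 3)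
  rw [Real.sin_pi_div_four, Real.cos_pi_div_four] at e1
  rw [Real.sin_pi_div_three, Real.cos_pi_div_three] at e2
  have h5 : √2 / 2 * (√2 / 2) = 1 / 2 := by linarith
  have h6 : (√3 / 2) ^ 2 = 3 / 4 := by rw [div_pow, Real.sq_sqrt (by norm_num)]; norm_num
  apply calcGood_of 1 (θ := Real.pi / 3)
  · linarith
  · linarith
  · norm_num at hp hp' h3 h3' ⊢; linarith
  · rw [Real.sin_pi_div_three, h6]
    norm_num at hp hp' h3 h3' ⊢; linarith

lemma calc_three : CalcGood 3 := by
  have hp := Real.pi_gt_d2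
  have hp' := Real.pi_lt_d2
  have h3 : √3 < (1.74 : ℝ) := by rw [Real.sqrt_lt' (by norm_num)]; norm_num
  have h3' : (1.73 : ℝ) < √3 := by apply Real.lt_sqrt_of_sq_lt; norm_num
  have h2 : (1.41 : ℝ) < √2 := by apply Real.lt_sqrt_of_sq_lt; norm_num
  have e1 := sinI_three (Real.pi / 4)
  have e2 := sinI_three (Real.pi / 3)
  rw [Real.sin_pi_div_four, Real.cos_pi_div_four, div_pow, Real.sq_sqrt (by norm_num)] at e1
  rw [Real.sin_pi_div_three, Real.cos_pi_div_three, div_pow, Real.sq_sqrt (by norm_num)] at e2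
  apply calcGood_of 2 (θ := Real.pi / 3)
  · linarith
  · linarith
  · norm_num at *; linarith
  · have : √3 ^ 3 = 3 * √3 := by rw [pow_succ, Real.sq_sqrt (by norm_num)]
    rw [Real.sin_pi_div_three, div_pow, this]
    norm_num at *; linarith

lemma angle345 : ∃ θ : ℝ, Real.sin θ = 4/5 ∧ Real.cos θ = 3/5 ∧ Real.pi / 4 + 0.1414 < θ ∧ θ < Real.pi / 4 + 1/7 := by
  have hp := Real.pi_gt_d2
  have hp' := Real.pi_lt_d2
  set φ := Real.arctan (1/7) with hφ
  have h50 : √(1 + (1/7)^2) = 5 * √2 / 7 := by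
    rw [Real.sqrt_eq_iff_mul_self_eq (by positivity) (by positivity)]
    have h22 : √2 * √2 = 2 := Real.mul_self_sqrt (by norm_num)
    nlinarith
  have h22 : √2 * √2 = 2 := Real.mul_self_sqrt (by norm_num)
  have h2 : 0 < √2 := by positivity
  have hs : Real.sin φ = √2 / 10 := by
    rw [hφ, Real.sin_arctan, h50]; field_simp; nlinarith
  have hc : Real.cos φ = 7 * √2 / 10 := by
    rw [hφ, Real.cos_arctan, h50]; field_simp; nlinarith
  have hφ0 : 0 < φ := by rw [hφ, Real.arctan_pos]; norm_num
  refine ⟨Real.pi / 4 + φ, ?_, ?_, ?_, ?_⟩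
  · rw [Real.sin_add, hs, hc, Real.sin_pi_div_four, Real.cos_pi_div_four]; nlinarith
  · rw [Real.cos_add, hs, hc, Real.sin_pi_div_four, Real.cos_pi_div_four]; nlinarith
  · have := Real.sin_lt hφ0
    have h3 : (1.414 : ℝ) < √2 := by apply Real.lt_sqrt_of_sq_lt; norm_num
    rw [hs] at this
    linarith
  · have := Real.lt_tan hφ0 (Real.arctan_lt_pi_div_two _)
    rw [hφ, Real.tan_arctan] at this
    linarith

lemma calc_four : CalcGood 4 := by
  have hp := Real.pi_gt_d4
  have hp' := Real.pi_lt_d4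
  have h22 : √2 * √2 = 2 := Real.mul_self_sqrt (by norm_num)
  obtain ⟨θ, hs, hc, h1, h2⟩ := angle345
  have e1 := sinI_four (Real.pi / 4)
  have e2 := sinI_four θ
  rw [hs, hc] at e2
  rw [Real.sin_pi_div_four, Real.cos_pi_div_four] at e1
  have h4 : (√2/2)^3 * (√2/2) = 1/4 := by ring_nf; rw [show √2^4 = (√2*√2)^2 by ring, h22]; norm_num
  have h5 : (√2/2) * (√2/2) = 1/2 := by ring_nf; rw [show √2^2 = √2*√2 by ring, h22]; norm_num
  apply calcGood_of 3 (θ := θ)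
  · linarith
  · linarith
  · norm_num at *; linarith
  · rw [hs]; norm_num at *; linarith

lemma calc_five : CalcGood 5 := by
  have hp := Real.pi_gt_d4
  have hp' := Real.pi_lt_d4
  have h22 : √2 * √2 = 2 := Real.mul_self_sqrt (by norm_num)
  have h3 : (1.414 : ℝ) < √2 := by apply Real.lt_sqrt_of_sq_lt; norm_num
  obtain ⟨θ, hs, hc, h1, h2⟩ := angle345
  have e1 := sinI_five (Real.pi / 4)
  have e2 := sinI_five θ
  rw [hs, hc] at e2
  rw [Real.sin_pi_div_four, Real.cos_pi_div_four] at e1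
  have h4 : (√2/2)^4 = 1/4 := by ring_nf; rw [show √2^4 = (√2*√2)^2 by ring, h22]; norm_num
  have h5 : (√2/2)^2 = 1/2 := by ring_nf; rw [show √2^2 = √2*√2 by ring, h22]; norm_num
  rw [h4, h5] at e1
  apply calcGood_of 4 (θ := θ)
  · linarith
  · linarith
  · norm_num at *; linarith
  · rw [hs]; norm_num at *; linarith

lemma calc_six : CalcGood 6 := by
  have hp := Real.pi_gt_d4
  have hp' := Real.pi_lt_d4
  have h22 : √2 * √2 = 2 := Real.mul_self_sqrt (by norm_num)
  obtain ⟨θ, hs, hc, h1, h2⟩ := angle345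
  have e1 := sinI_six (Real.pi / 4)
  have e2 := sinI_six θ
  rw [hs, hc] at e2
  rw [Real.sin_pi_div_four, Real.cos_pi_div_four] at e1
  have h4 : (√2/2)^3 * (√2/2) = 1/4 := by ring_nf; rw [show √2^4 = (√2*√2)^2 by ring, h22]; norm_num
  have h6 : (√2/2)^5 * (√2/2) = 1/8 := by ring_nf; rw [show √2^6 = (√2*√2)^3 by ring, h22]; norm_num
  have h5 : (√2/2) * (√2/2) = 1/2 := by ring_nf; rw [show √2^2 = √2*√2 by ring, h22]; norm_num
  apply calcGood_of 5 (θ := θ)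
  · linarith
  · linarith
  · norm_num at *; linarith
  · rw [hs]; norm_num at *; linarith

end Calc

section Calc

lemma calc_big (k : ℕ) (hk : 6 ≤ k) : CalcGood (k+1) := by
  have hp := Real.pi_pos
  have h22 : √2 * √2 = 2 := Real.mul_self_sqrt (by norm_num)
  set b : ℝ := (√2 / 2) ^ (k+1) with hb
  have hb0 : 0 < b := by positivity
  have hb2 : b ^ 2 = (1/2) ^ (k+1) := by
    rw [hb, ← pow_mul, mul_comm, pow_mul]; congr 1; nlinarith
  have h43 : (4:ℝ) ≤ (4/3) ^ (k+1) := by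
    calc (4:ℝ) ≤ (4/3)^7 := by norm_num
      _ ≤ _ := pow_le_pow_right₀ (by norm_num) (by omega)
  have h23 : (2 * b) ^ 2 ≤ (2/3 : ℝ) ^ (k+1) := by
    rw [mul_pow, hb2, show (2/3:ℝ) = (4/3) * (1/2) by norm_num, mul_pow (4/3:ℝ)]
    have : (0:ℝ) < (1/2) ^ (k+1) := by positivity
    nlinarith
  have h2b : 2 * b < 1 := by
    have : (2/3 : ℝ) ^ (k+1) < 1 := pow_lt_one₀ (by norm_num) (by norm_num) (by omega)
    nlinarith
  obtain ⟨θ, hθ, hy⟩ : ∃ θ ∈ Icc (Real.pi / 4) (Real.pi / 2), Real.sin θ ^ (k+1) = 2 * b := by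
    have := intermediate_value_Icc (f := fun θ => Real.sin θ ^ (k+1)) (show Real.pi / 4 ≤ Real.pi / 2 by linarith) (by fun_prop)
    have h := this (show 2 * b ∈ _ by
      simp only [Real.sin_pi_div_four, Real.sin_pi_div_two, one_pow]
      exact ⟨by rw [← hb]; linarith, h2b.le⟩)
    exact h
  have hs0 : ∀ t ∈ Icc 0 θ, 0 ≤ Real.sin t := fun t ht => Real.sin_nonneg_of_nonneg_of_le_pi ht.1 (by linarith [ht.2, hθ.2])
  have hsθ : Real.sin θ ^ 2 ≤ 2/3 := by
    by_contra hcon; push Not at hcon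
    have := pow_lt_pow_left₀ hcon (by norm_num) (n := k+1) (by omega)
    rw [← pow_mul, mul_comm, pow_mul, hy] at this
    linarith
  have hs : ∀ t ∈ Icc 0 θ, Real.sin t ^ 2 ≤ 2/3 := by
    intro t ht
    refine le_trans (pow_le_pow_left₀ (hs0 t ht) ?_ 2) hsθ
    exact Real.sin_le_sin_of_le_of_le_pi_div_two (by linarith [ht.1]) hθ.2 ht.2
  have hθ2 : θ < Real.pi / 2 := by
    rcases hθ.2.lt_or_eq with h | h
    · exact h
    · rw [h] at hy; simp at hy; linarith
  have hc0 : ∀ t ∈ Icc 0 θ, 0 < Real.cos t := fun t ht => Real.cos_pos_of_mem_Ioo ⟨by linarith [ht.1], by linarith [ht.2]⟩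
  have hπ4 : Real.pi / 4 ∈ Icc 0 θ := ⟨by linarith, hθ.1⟩
  have hk6 : (6:ℝ) ≤ k := by exact_mod_cast hk
  -- Q
  set Q : ℝ → ℝ := fun t => 2 / b * (Real.sin t ^ k * Real.cos t ^ 3) with hQ
  obtain ⟨j, rfl⟩ : ∃ j, k = j + 1 := ⟨k - 1, by omega⟩
  have hQd : ∀ t, HasDerivAt Q (2 / b * (Real.sin t ^ j * Real.cos t ^ 2 * ((j + 1) * Real.cos t ^ 2 - 3 * Real.sin t ^ 2))) t := by
    intro t
    have := (((Real.hasDerivAt_sin t).pow (j+1)).mul ((Real.hasDerivAt_cos t).pow 3)).const_mul (2 / b)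
    refine HasDerivAt.congr_deriv (f := Q) this ?_
    simp only [Pi.pow_apply, Nat.add_sub_cancel]; push_cast; ring
  have hQm : MonotoneOn Q (Icc 0 θ) := by
    apply monotoneOn_of_deriv_nonneg (convex_Icc _ _)
      (fun t _ => (hQd t).continuousAt.continuousWithinAt)
      (fun t _ => (hQd t).differentiableAt.differentiableWithinAt)
    intro t ht
    rw [interior_Icc] at ht
    have ht' : t ∈ Icc 0 θ := ⟨ht.1.le, ht.2.le⟩
    rw [(hQd t).deriv]
    have h1 := hs0 t ht'
    have h2 := hs t ht'
    have h3 := Real.sin_sq_add_cos_sq t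
    have h4 : 0 ≤ ((j:ℝ) + 1) * Real.cos t ^ 2 - 3 * Real.sin t ^ 2 := by
      push_cast at hk6
      nlinarith
    positivity
  have hQ1 : Q (Real.pi / 4) = 1 := by
    simp only [hQ, Real.sin_pi_div_four, Real.cos_pi_div_four]
    have h4 : (√2 / 2) ^ 3 = (1/2) * (√2/2) := by
      rw [pow_succ]; congr 1; nlinarith
    have h5 : (√2 / 2) ^ (j+1) * (√2/2)^3 = b / 2 := by rw [h4, hb, pow_succ _ (j+1)]; ring
    rw [h5]; field_simp
  set P : ℝ → ℝ := fun t => 1 + (2 / ((j:ℝ)+2)) * (Real.sin t ^ (j+2) / b - 1) - Real.tan t with hP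
  have hPd : ∀ t ∈ Icc 0 θ, HasDerivAt P ((Q t - 1) / Real.cos t ^ 2) t := by
    intro t ht
    have hc := hc0 t ht
    have := ((((((Real.hasDerivAt_sin t).pow (j+2)).div_const b).sub_const 1).const_mul (2 / ((j:ℝ)+2))).const_add 1).sub
      (Real.hasDerivAt_tan hc.ne')
    refine HasDerivAt.congr_deriv (f := P) this ?_
    simp only [hQ]
    push_cast
    simp
    field_simp
  have hP1 : P (Real.pi / 4) = 0 := by
    simp only [hP, Real.tan_pi_div_four, Real.sin_pi_div_four]
    rw [show (√2/2)^(j+2) = b from rfl, div_self hb0.ne']; ring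
  have hP0 : ∀ t ∈ Icc 0 θ, 0 ≤ P t := by
    intro t ht
    rw [← hP1]
    rcases le_total t (Real.pi / 4) with h | h
    · have : AntitoneOn P (Icc 0 (Real.pi / 4)) := by
        have hsub : Icc 0 (Real.pi / 4) ⊆ Icc 0 θ := Icc_subset_Icc_right hθ.1
        apply antitoneOn_of_deriv_nonpos (convex_Icc _ _)
          (fun t ht => (hPd t (hsub ht)).continuousAt.continuousWithinAt)
          (fun t ht => (hPd t (hsub (interior_subset ht))).differentiableAt.differentiableWithinAt)
        intro x hx
        have hx := interior_subset hx
        rw [(hPd x (hsub hx)).deriv]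
        have := hQm (hsub hx) hπ4 hx.2
        rw [hQ1] at this
        exact div_nonpos_of_nonpos_of_nonneg (by linarith) (by positivity)
      exact this ⟨ht.1, h⟩ ⟨by linarith, le_rfl⟩ h
    · have : MonotoneOn P (Icc (Real.pi / 4) θ) := by
        have hsub : Icc (Real.pi / 4) θ ⊆ Icc 0 θ := Icc_subset_Icc_left (by linarith)
        apply monotoneOn_of_deriv_nonneg (convex_Icc _ _)
          (fun t ht => (hPd t (hsub ht)).continuousAt.continuousWithinAt)
          (fun t ht => (hPd t (hsub (interior_subset ht))).differentiableAt.differentiableWithinAt)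
        intro x hx
        have hx := interior_subset hx
        rw [(hPd x (hsub hx)).deriv]
        have := hQm hπ4 (hsub hx) hx.1
        rw [hQ1] at this
        exact div_nonneg (by linarith) (by positivity)
      exact this ⟨le_rfl, hθ.1⟩ ⟨h, ht.2⟩ h
  set M : ℝ → ℝ := fun t => Real.sin t ^ (j+2) + (1 / ((j:ℝ)+2)) * ((Real.sin t ^ (j+2))^2 / b - 2 * Real.sin t ^ (j+2))
      - ((j:ℝ)+2) * sinI (j+2) t with hM
  have hMd : ∀ t ∈ Icc 0 θ, HasDerivAt M (((j:ℝ)+2) * Real.sin t ^ (j+1) * Real.cos t * P t) t := by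
    intro t ht
    have hc := hc0 t ht
    have hy' := (Real.hasDerivAt_sin t).pow (j+2)
    have := (hy'.add (((((hy'.pow 2)).div_const b).sub (hy'.const_mul 2)).const_mul (1 / ((j:ℝ)+2)))).sub
      ((sinI_hasDeriv (j+2) t).const_mul ((j:ℝ)+2))
    refine HasDerivAt.congr_deriv (f := M) this ?_
    simp only [hP, Real.tan_eq_sin_div_cos]
    push_cast
    simp
    field_simp
    ring
  have hMm : MonotoneOn M (Icc 0 θ) := by
    apply monotoneOn_of_deriv_nonneg (convex_Icc _ _)
      (fun t ht => (hMd t ht).continuousAt.continuousWithinAt)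
      (fun t ht => (hMd t (interior_subset ht)).differentiableAt.differentiableWithinAt)
    intro t ht
    have ht := interior_subset ht
    rw [(hMd t ht).deriv]
    have := hP0 t ht
    have := hs0 t ht
    have := hc0 t ht
    positivity
  have hMθ := hMm ⟨le_rfl, by linarith [hθ.1]⟩ ⟨by linarith [hθ.1], le_rfl⟩ (show 0 ≤ θ by linarith [hθ.1])
  have hM0 : M 0 = 0 := by simp [hM, sinI_zero]
  rw [hM0] at hMθ
  simp only [hM] at hMθ
  rw [hy] at hMθ
  have hz : (2 * b) ^ 2 / b - 2 * (2 * b) = 0 := by field_simp; ring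
  rw [hz, mul_zero, add_zero] at hMθ
  have hh1 := hF_antitone (j+1) (left_mem_Icc.2 (by linarith)) hθ hθ.1
  have hh2 := hF_strictMono (j+1) (left_mem_Icc.2 (by linarith)) (right_mem_Icc.2 (by linarith)) (show 0 < Real.pi / 4 by linarith)
  rw [hF_zero] at hh2
  simp only [hF] at hh1 hh2
  rw [hy] at hh1
  rw [Real.sin_pi_div_four] at hh1 hh2
  rw [show (√2/2)^(j+1+1) = b from rfl] at hh1 hh2
  have hj : (0:ℝ) < ((j+1+1:ℕ):ℝ) := by positivity
  apply calcGood_of (j+1) hθ.1 hθ2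
  · have : ((j+1+1:ℕ):ℝ) * (2 * sinI (j+1+1) (Real.pi / 4)) < ((j+1+1:ℕ):ℝ) * sinI (j+1+1) θ := by linarith
    exact lt_of_mul_lt_mul_left this hj.le
  · rw [hy]
    push_cast
    have e : sinI (j+1+1) θ = sinI (j+2) θ := rfl
    rw [e]; linarith

lemma calcGood (n : ℕ) (hn : 0 < n) : CalcGood n := by
  rcases Nat.lt_or_ge n 7 with h | h
  · interval_cases n
    · exact calc_one
    · exact calc_two
    · exact calc_three
    · exact calc_four
    · exact calc_five
    · exact calc_six
  · obtain ⟨k, rfl⟩ : ∃ k, n = k + 1 := ⟨n - 1, by omega⟩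
    exact calc_big k (by omega)

end Calc

section CapVol

lemma slab_vol {m : ℕ} {u : EuclideanSpace ℝ (Fin (m+1))} (hu : ‖u‖ = 1) {T : Set ℝ} (hT : MeasurableSet T) :
    volume ({x | inner ℝ u x ∈ T} ∩ ball 0 1) =
      (∫⁻ t in T ∩ Ioo (-1) 1, ENNReal.ofReal (√(1 - t^2) ^ m)) * volume (ball (0:EuclideanSpace ℝ (Fin m)) 1) := by
  obtain ⟨Φ, ι, hmp, hΦ, hι⟩ := exists_frame u hu
  have hS : MeasurableSet ({x : EuclideanSpace ℝ (Fin (m+1)) | inner ℝ u x ∈ T} ∩ ball 0 1) := by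
    have : Measurable fun x : EuclideanSpace ℝ (Fin (m+1)) => (inner ℝ u x : ℝ) := by fun_prop
    exact (this hT).inter measurableSet_ball
  rw [← hmp.measure_preimage hS.nullMeasurableSet, Measure.volume_eq_prod, Measure.prod_apply (hmp.measurable hS)]
  have hin : ∀ t y, inner ℝ u (Φ (t, y)) = t := by
    intro t y
    rw [hΦ, inner_add_right, inner_smul_right, hι, real_inner_self_eq_norm_sq, hu]; ring
  have hno : ∀ t y, ‖Φ (t, y)‖ ^ 2 = t ^ 2 + ‖y‖ ^ 2 := by
    intro t y
    rw [hΦ, norm_add_sq_real, inner_smul_left, hι, norm_smul, hu, ι.norm_map]; simp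
  have h1 : ∀ t : ℝ, volume (Prod.mk t ⁻¹' (Φ ⁻¹' ({x : EuclideanSpace ℝ (Fin (m+1)) | inner ℝ u x ∈ T} ∩ ball 0 1)))
     = (T ∩ Ioo (-1) 1).indicator (fun t => ENNReal.ofReal (√(1 - t^2) ^ m) * volume (ball (0:EuclideanSpace ℝ (Fin m)) 1)) t := by
    intro t
    by_cases ht : t ∈ T ∩ Ioo (-1) 1
    · rw [indicator_of_mem ht]
      have h0 : 0 < 1 - t ^ 2 := by nlinarith [ht.2.1, ht.2.2]
      have h2 : Prod.mk t ⁻¹' (Φ ⁻¹' ({x : EuclideanSpace ℝ (Fin (m+1)) | inner ℝ u x ∈ T} ∩ ball 0 1)) = ball 0 (√(1-t^2)) := by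
        ext y
        simp only [mem_preimage, mem_inter_iff, mem_ofPred_eq, hin, ht.1, true_and, mem_ball_zero_iff]
        rw [Real.lt_sqrt (norm_nonneg y), ← sq_lt_one_iff₀ (norm_nonneg _), hno]; constructor <;> intro h <;> linarith
      rw [h2, Measure.addHaar_ball_of_pos _ _ (Real.sqrt_pos.2 h0)]
      simp
    · rw [indicator_of_notMem ht]
      have h2 : Prod.mk t ⁻¹' (Φ ⁻¹' ({x : EuclideanSpace ℝ (Fin (m+1)) | inner ℝ u x ∈ T} ∩ ball 0 1)) = ∅ := by
        ext y
        simp only [mem_preimage, mem_inter_iff, mem_ofPred_eq, hin, mem_ball_zero_iff, mem_empty_iff_false, iff_false]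
        rintro ⟨h3, h4⟩
        refine ht ⟨h3, ?_⟩
        have := hno t y
        have h5 : t ^ 2 < 1 := by nlinarith [norm_nonneg (Φ (t,y)), sq_nonneg ‖y‖]
        constructor <;> nlinarith
      rw [h2]; simp
  simp_rw [h1]
  rw [lintegral_indicator (hT.inter measurableSet_Ioo), lintegral_mul_const _ (by fun_prop)]

lemma lintegral_cap (m : ℕ) {θ : ℝ} (h0 : 0 ≤ θ) (hπ : θ ≤ Real.pi) :
    ∫⁻ t in Ioc (Real.cos θ) 1, ENNReal.ofReal (√(1 - t^2) ^ m) = ENNReal.ofReal (sinI (m+1) θ) := by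
  have hc : Continuous fun t : ℝ => √(1 - t^2) ^ m := by fun_prop
  rw [← ofReal_integral_eq_lintegral_ofReal (hc.integrableOn_Ioc) (Eventually.of_forall fun t => by positivity)]
  rw [← intervalIntegral.integral_of_le (Real.cos_le_one θ)]
  congr 1
  have h1 := intervalIntegral.integral_comp_mul_deriv (a := 0) (b := θ) (f := Real.cos) (f' := fun x => - Real.sin x)
    (g := fun t : ℝ => √(1 - t^2) ^ m) (fun x _ => Real.hasDerivAt_cos x) (by fun_prop) hc
  rw [Real.cos_zero] at h1
  rw [intervalIntegral.integral_symm, ← h1, sinI, ← intervalIntegral.integral_neg]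
  apply intervalIntegral.integral_congr
  intro x hx
  rw [uIcc_of_le h0] at hx
  have hs := Real.sin_nonneg_of_nonneg_of_le_pi hx.1 (hx.2.trans hπ)
  simp only [Function.comp]
  rw [← Real.abs_sin_eq_sqrt_one_sub_cos_sq, abs_of_nonneg hs]; ring

lemma cap_vol {m : ℕ} {u : EuclideanSpace ℝ (Fin (m+1))} (hu : ‖u‖ = 1) {θ : ℝ} (h0 : 0 ≤ θ) (hπ : θ ≤ Real.pi) :
    volume ({x | Real.cos θ < inner ℝ u x} ∩ ball 0 1) =
      ENNReal.ofReal (sinI (m+1) θ) * volume (ball (0:EuclideanSpace ℝ (Fin m)) 1) := by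
  rw [← lintegral_cap m h0 hπ, setLIntegral_congr (Ioo_ae_eq_Ioc (μ := volume) (a := Real.cos θ) (b := 1)).symm]
  have := slab_vol hu (T := Ioi (Real.cos θ)) measurableSet_Ioi
  have h2 : Ioi (Real.cos θ) ∩ Ioo (-1) 1 = Ioo (Real.cos θ) 1 := by
    ext t; simp; intro a _; linarith [Real.neg_one_le_cos θ]
  rw [h2] at this
  exact this

lemma cap_vol' {m : ℕ} {u : EuclideanSpace ℝ (Fin (m+1))} (hu : ‖u‖ = 1) {θ : ℝ} (h0 : 0 ≤ θ) (hπ : θ ≤ Real.pi) :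
    volume ({x | Real.cos θ ≤ inner ℝ u x} ∩ ball 0 1) =
      ENNReal.ofReal (sinI (m+1) θ) * volume (ball (0:EuclideanSpace ℝ (Fin m)) 1) := by
  apply le_antisymm
  · rw [← lintegral_cap m h0 hπ, setLIntegral_congr (Ico_ae_eq_Ioc (μ := volume) (a := Real.cos θ) (b := 1)).symm]
    have := slab_vol hu (T := Ici (Real.cos θ)) measurableSet_Ici
    refine le_trans this.le ?_
    gcongr
    rintro t ⟨h1, h2, h3⟩
    exact ⟨h1, h3⟩
  · rw [← cap_vol hu h0 hπ]
    apply measure_mono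
    rintro x ⟨h1, h2⟩
    exact ⟨show Real.cos θ ≤ inner ℝ u x from le_of_lt h1, h2⟩

lemma cap_region_le {m : ℕ} {u : EuclideanSpace ℝ (Fin (m+1))} (hu : ‖u‖ = 1) :
    volume (ball 0 1 ∩ ball (√2 • u) 1) ≤
      ENNReal.ofReal (2 * sinI (m+1) (Real.pi / 4)) * volume (ball (0:EuclideanSpace ℝ (Fin m)) 1) := by
  have hp := Real.pi_pos
  have h22 : √2 * √2 = 2 := Real.mul_self_sqrt (by norm_num)
  set C := {x : EuclideanSpace ℝ (Fin (m+1)) | Real.cos (Real.pi / 4) ≤ inner ℝ u x} ∩ ball 0 1 with hC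
  set G : EuclideanSpace ℝ (Fin (m+1)) → EuclideanSpace ℝ (Fin (m+1)) := fun x => √2 • u + hrefl u x with hG
  have hGmp : MeasurePreserving G volume volume :=
    (measurePreserving_add_left volume (√2 • u)).comp (hrefl u).measurePreserving
  have hCm : MeasurableSet C := by
    refine MeasurableSet.inter (isClosed_le continuous_const (by fun_prop)).measurableSet measurableSet_ball
  have hCv : volume C = _ := cap_vol' hu (θ := Real.pi / 4) (by linarith) (by linarith)
  have hu0 : u ≠ 0 := by rintro rfl; simp at hu
  have hsub : ball 0 1 ∩ ball (√2 • u) 1 ⊆ C ∪ G ⁻¹' C := by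
    rintro x ⟨h1, h2⟩
    by_cases h : Real.cos (Real.pi / 4) ≤ inner ℝ u x
    · exact Or.inl ⟨h, h1⟩
    · right
      push Not at h
      rw [Real.cos_pi_div_four] at h
      constructor
      · show Real.cos (Real.pi / 4) ≤ inner ℝ u (√2 • u + hrefl u x)
        rw [inner_add_right, inner_smul_right, inner_hrefl hu0, real_inner_self_eq_norm_sq, hu, Real.cos_pi_div_four]
        linarith
      · have : G x = hrefl u (x - √2 • u) := by
          simp only [hG, map_sub]
          have : hrefl u (√2 • u) = - (√2 • u) := by
            rw [hrefl_apply, inner_smul_right, real_inner_self_eq_norm_sq, hu]; module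
          rw [this]; abel
        rw [this, mem_ball_zero_iff, LinearIsometryEquiv.norm_map]
        rwa [mem_ball, dist_eq_norm] at h2
  calc _ ≤ volume (C ∪ G ⁻¹' C) := measure_mono hsub
    _ ≤ volume C + volume (G ⁻¹' C) := measure_union_le _ _
    _ = volume C + volume C := by rw [hGmp.measure_preimage hCm.nullMeasurableSet]
    _ = _ := by
      rw [hCv, ← two_mul, ENNReal.ofReal_mul (by norm_num), mul_assoc]; simp

end CapVol

section IsoBall

lemma sinI_mono_step (n : ℕ) {θ ε : ℝ} (h0 : 0 ≤ θ) (hε : 0 ≤ ε) (h : θ + ε ≤ Real.pi / 2) :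
    sinI n θ + ε * Real.sin θ ^ n ≤ sinI n (θ + ε) := by
  have hm : MonotoneOn (fun x => sinI n x - (x - θ) * Real.sin θ ^ n) (Icc θ (θ + ε)) := by
    have hd : ∀ x, HasDerivAt (fun x => sinI n x - (x - θ) * Real.sin θ ^ n) (Real.sin x ^ n - 1 * Real.sin θ ^ n) x :=
      fun x => (sinI_hasDeriv n x).sub (((hasDerivAt_id x).sub_const θ).mul_const _)
    apply monotoneOn_of_deriv_nonneg (convex_Icc _ _)
      (fun t _ => (hd t).continuousAt.continuousWithinAt)
      (fun t _ => (hd t).differentiableAt.differentiableWithinAt)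
    intro x hx
    have hx := interior_subset hx
    rw [(hd x).deriv]
    have h1 : 0 ≤ Real.sin θ := Real.sin_nonneg_of_nonneg_of_le_pi h0 (by linarith [Real.pi_pos])
    have h2 : Real.sin θ ≤ Real.sin x := Real.sin_le_sin_of_le_of_le_pi_div_two (by linarith [Real.pi_pos]) (by linarith [hx.2]) hx.1
    have := pow_le_pow_left₀ h1 h2 n
    linarith
  have := hm (left_mem_Icc.2 (by linarith)) (right_mem_Icc.2 (by linarith)) (by linarith)
  simp at this; linarith

lemma iso_ball {m : ℕ} {u : EuclideanSpace ℝ (Fin (m+1))} (hu : ‖u‖ = 1) :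
    ∃ v : ℝ≥0∞, volume (ball 0 1 ∩ ball (√2 • u) 1) < v ∧ v ≠ ⊤ ∧ ∃ ε0 : ℝ, 0 < ε0 ∧
      ∀ K : Set (EuclideanSpace ℝ (Fin (m+1))), IsCompact K → volume (K ∩ ball 0 1) ≤ v → ∀ ε, 0 < ε → ε < ε0 →
        ENNReal.ofReal (1 + (m+1) * ε) * volume (K ∩ ball 0 1) ≤ volume (thickening ε K ∩ ball 0 1) := by
  obtain ⟨θ, h0, hπ, h1, h2⟩ := calcGood (m+1) (by omega)
  set κ := volume (ball (0:EuclideanSpace ℝ (Fin m)) 1) with hκ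
  have hκ0 : κ ≠ 0 := (measure_ball_pos _ _ one_pos).ne'
  have hκt : κ ≠ ⊤ := measure_ball_lt_top.ne
  have hp0 : 0 ≤ sinI (m+1) (Real.pi / 4) := by
    rw [← sinI_zero (m+1)]
    have := sinI_mono_step (m+1) (θ := 0) (ε := Real.pi / 4) le_rfl (by positivity) (by linarith [Real.pi_pos])
    simpa using this
  refine ⟨ENNReal.ofReal (sinI (m+1) θ) * κ, ?_, ENNReal.mul_ne_top ENNReal.ofReal_ne_top hκt, Real.pi / 2 - θ, by linarith, ?_⟩
  · refine lt_of_le_of_lt (cap_region_le hu) ?_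
    rw [← hκ, ENNReal.mul_lt_mul_iff_left hκ0 hκt]
    exact (ENNReal.ofReal_lt_ofReal_iff (by linarith)).2 h1
  intro K hK hKv ε hε hε0
  rcases eq_or_ne (volume (K ∩ ball 0 1)) 0 with hz | hz
  · rw [hz, mul_zero]; exact zero_le
  have hKt : volume (K ∩ ball 0 1) ≠ ⊤ := ne_top_of_le_ne_top measure_ball_lt_top.ne (measure_mono inter_subset_right)
  set x : ℝ := (volume (K ∩ ball 0 1) / κ).toReal with hx
  have hxK : volume (K ∩ ball 0 1) = ENNReal.ofReal x * κ := by
    rw [hx, ENNReal.ofReal_toReal (ENNReal.div_ne_top hKt hκ0), ENNReal.div_mul_cancel hκ0 hκt]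
  have hx1 : x ≤ sinI (m+1) θ := by
    rw [hxK, ENNReal.mul_le_mul_iff_left hκ0 hκt, ENNReal.ofReal_le_ofReal_iff (by linarith)] at hKv
    exact hKv
  obtain ⟨t, ht, htx⟩ : ∃ t ∈ Icc 0 θ, sinI (m+1) t = x := by
    have := intermediate_value_Icc (f := sinI (m+1)) h0.le (sinI_cont _).continuousOn
    rw [sinI_zero] at this
    exact this ⟨ENNReal.toReal_nonneg, hx1⟩
  have ht0 : 0 < t := by
    rcases ht.1.lt_or_eq with h | h
    · exact h
    · rw [← h, sinI_zero] at htx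
      rw [← htx] at hxK; simp at hxK; exact absurd hxK hz
  have hnt : Nontrivial (EuclideanSpace ℝ (Fin (m+1))) := by
    have : u ≠ 0 := by rintro rfl; simp at hu
    exact ⟨⟨u, 0, this⟩⟩
  have hpi := Real.pi_pos
  have key := ball_iso hu ht0 hε (by linarith [ht.2]) hK (by
    rw [cap_vol' hu ht.1 (by linarith [ht.2]), hxK, htx])
  rw [cap_vol hu (by linarith [ht.1]) (by linarith [ht.2])] at key
  refine le_trans ?_ key
  rw [hxK, ← mul_assoc]
  refine mul_le_mul_left ?_ κ
  have hxn : 0 ≤ x := ENNReal.toReal_nonneg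
  rw [← ENNReal.ofReal_mul (by positivity)]
  apply ENNReal.ofReal_le_ofReal
  have h3 := sinI_mono_step (m+1) ht.1 hε.le (by linarith [ht.2])
  have h4 := h2 t ht
  push_cast at h4
  rw [htx] at h3 h4
  nlinarith

lemma scaled_vol {m : ℕ} {s : ℝ} (hs : 0 < s) (A : Set (EuclideanSpace ℝ (Fin (m+1)))) :
    volume (A ∩ ball 0 s) = ENNReal.ofReal (s^(m+1)) *
      volume (((fun x : EuclideanSpace ℝ (Fin (m+1)) => s • x) ⁻¹' A) ∩ ball 0 1) := by
  have e1 : ((fun x : EuclideanSpace ℝ (Fin (m+1)) => s • x) ⁻¹' A) ∩ ball (0:EuclideanSpace ℝ (Fin (m+1))) 1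
      = (s • ·) ⁻¹' (A ∩ ball 0 s) := by
    ext x
    simp only [mem_inter_iff, mem_preimage, mem_ball_zero_iff, norm_smul, Real.norm_of_nonneg hs.le]
    rw [mul_lt_iff_lt_one_right hs]
  rw [e1, Measure.addHaar_preimage_smul _ hs.ne', finrank_euclideanSpace_fin, abs_of_nonneg (by positivity), ← mul_assoc,
    ← ENNReal.ofReal_mul (by positivity), mul_inv_cancel₀ (by positivity)]
  simp

lemma scaled_compact {m : ℕ} {s : ℝ} (hs : 0 < s) {K : Set (EuclideanSpace ℝ (Fin (m+1)))} (hK : IsCompact K) :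
    IsCompact ((fun x : EuclideanSpace ℝ (Fin (m+1)) => s • x) ⁻¹' K) := by
  have e : ((fun x : EuclideanSpace ℝ (Fin (m+1)) => s • x) ⁻¹' K) = (fun x => s⁻¹ • x) '' K := by
    ext x
    simp only [mem_preimage, mem_image]
    constructor
    · intro h
      exact ⟨_, h, by rw [smul_smul, inv_mul_cancel₀ hs.ne', one_smul]⟩
    · rintro ⟨y, hy, rfl⟩
      rwa [smul_smul, mul_inv_cancel₀ hs.ne', one_smul]
  rw [e]
  exact hK.image (continuous_const_smul s⁻¹)

lemma scaled_thick {m : ℕ} {s ε : ℝ} (hs : 0 < s) (K : Set (EuclideanSpace ℝ (Fin (m+1)))) :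
    thickening (ε / s) ((fun x : EuclideanSpace ℝ (Fin (m+1)) => s • x) ⁻¹' K)
      ⊆ (fun x : EuclideanSpace ℝ (Fin (m+1)) => s • x) ⁻¹' (thickening ε K) := by
  intro x hx
  obtain ⟨z, hz, hd⟩ := mem_thickening_iff.1 hx
  rw [mem_preimage, mem_thickening_iff]
  have hz : s • z ∈ K := hz
  refine ⟨s • z, hz, ?_⟩
  rw [dist_eq_norm, ← smul_sub, norm_smul, Real.norm_of_nonneg hs.le, ← dist_eq_norm]
  rw [lt_div_iff₀ hs] at hd; linarith

lemma iso_ball_scaled {m : ℕ} {u : EuclideanSpace ℝ (Fin (m+1))} (hu : ‖u‖ = 1) :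
    ∃ v : ℝ≥0∞, volume (ball 0 1 ∩ ball (√2 • u) 1) < v ∧ v ≠ ⊤ ∧ ∃ ε0 : ℝ, 0 < ε0 ∧
      ∀ s, 0 < s → ∀ K : Set (EuclideanSpace ℝ (Fin (m+1))), IsCompact K →
        volume (K ∩ ball 0 s) ≤ ENNReal.ofReal (s^(m+1)) * v → ∀ ε, 0 < ε → ε < s * ε0 →
        ENNReal.ofReal (1 + (m+1) / s * ε) * volume (K ∩ ball 0 s) ≤ volume (thickening ε K ∩ ball 0 s) := by
  obtain ⟨v, h1, h2, ε0, h3, h4⟩ := iso_ball hu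
  refine ⟨v, h1, h2, ε0, h3, ?_⟩
  intro s hs K hK hKv ε hε hε0
  have hpre := scaled_vol (m := m) hs
  have hs0 : ENNReal.ofReal (s^(m+1)) ≠ 0 := by
    rw [ne_eq, ENNReal.ofReal_eq_zero, not_le]; positivity
  have hc := scaled_compact hs hK
  rw [hpre, hpre]
  rw [hpre, ENNReal.mul_le_mul_iff_right hs0 ENNReal.ofReal_ne_top] at hKv
  have key := h4 _ hc hKv (ε / s) (by positivity) (by rw [div_lt_iff₀ hs]; linarith)
  have hth := scaled_thick (ε := ε) hs K
  rw [mul_left_comm]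
  refine mul_le_mul_right (le_trans ?_ (key.trans (measure_mono (inter_subset_inter_left _ hth)))) _
  rw [show ((m:ℝ)+1) / s * ε = (m+1) * (ε / s) by ring]

end IsoBall

section Moll

/-- mollified indicator -/
def mol {m : ℕ} (A : Set (EuclideanSpace ℝ (Fin (m+1)))) (η : EuclideanSpace ℝ (Fin (m+1)) → ℝ)
    (x : EuclideanSpace ℝ (Fin (m+1))) : ℝ≥0∞ := ∫⁻ z in A, ENNReal.ofReal (η (x - z))

/-- gradient bound for the mollified indicator -/
def grd {m : ℕ} (S : Set (EuclideanSpace ℝ (Fin (m+1)))) (η : EuclideanSpace ℝ (Fin (m+1)) → ℝ) (L : NNReal) (ε : ℝ)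
    (x : EuclideanSpace ℝ (Fin (m+1))) : ℝ≥0∞ :=
  (hcst m)⁻¹ * ∫⁻ z in S, ENNReal.ofReal (η (x - z) + L * ε) ∂μH[(m:ℝ)]

lemma mol_step {m : ℕ} {A : Set (EuclideanSpace ℝ (Fin (m+1)))} (hA : MeasurableSet A)
    {η : EuclideanSpace ℝ (Fin (m+1)) → ℝ} {L : NNReal} (hL : LipschitzWith L η) (h0 : ∀ z, 0 ≤ η z)
    {w x : EuclideanSpace ℝ (Fin (m+1))} {ε : ℝ} (hε : dist w x ≤ ε) :
    mol A η w ≤ mol A η x + ENNReal.ofReal ε * grd (mBoundary A) η L ε x := by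
  rcases eq_or_ne w x with rfl | hne
  · exact le_self_add
  set h := ‖w - x‖ with hh
  have hpos : 0 < h := norm_pos_iff.2 (sub_ne_zero.2 hne)
  have hle : h ≤ ε := by rw [hh, ← dist_eq_norm]; exact hε
  set u := h⁻¹ • (w - x) with hu
  have hun : ‖u‖ = 1 := by
    rw [hu, norm_smul, Real.norm_of_nonneg (by positivity), ← hh, inv_mul_cancel₀ hpos.ne']
  have hw : w = x + h • u := by
    rw [hu, smul_smul, mul_inv_cancel₀ hpos.ne', one_smul]; abel
  have hηm : Measurable η := hL.continuous.measurable
  set S := mBoundary A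
  set W := {z | ∃ τ ∈ Icc 0 h, z + τ • u ∈ S} with hW
  have hL' : LipschitzWith L (fun z => η (x - z)) := by
    have : LipschitzWith 1 (fun z : EuclideanSpace ℝ (Fin (m+1)) => x - z) := by
      refine LipschitzWith.of_dist_le_mul fun a b => ?_
      simp [dist_eq_norm, norm_sub_rev]
    have h2 := hL.comp this
    rw [mul_one] at h2
    exact h2
  have hsweep := lintegral_sweep_le u hun h hpos S _ L hL' (fun z => h0 _)
  rw [← hW] at hsweep
  have hAu : MeasurableSet {z | z + h • u ∈ A} := (measurable_id.add_const (h • u)) hA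
  have e1 : mol A η w = ∫⁻ z in {z | z + h • u ∈ A}, ENNReal.ofReal (η (x - z)) := by
    rw [mol, ← lintegral_indicator hA, ← lintegral_indicator hAu, ← lintegral_add_right_eq_self _ (h • u)]
    congr 1; ext z
    by_cases hz : z + h • u ∈ A
    · rw [indicator_of_mem hz, indicator_of_mem (by exact hz), hw, add_sub_add_right_eq_sub]
    · rw [indicator_of_notMem hz, indicator_of_notMem (by exact hz)]
  have hsub : {z | z + h • u ∈ A} ≤ᵐ[volume] (A ∪ W : Set _) := by
    filter_upwards [slice_ae hA u hun hpos] with z hz hzA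
    by_cases hzW : z ∈ W
    · exact Or.inr hzW
    · left
      refine (hz ?_).2 hzA
      intro τ hτ hS
      exact hzW ⟨τ, hτ, hS⟩
  rw [e1]
  calc ∫⁻ z in {z | z + h • u ∈ A}, ENNReal.ofReal (η (x - z))
      ≤ ∫⁻ z in A ∪ W, ENNReal.ofReal (η (x - z)) := lintegral_mono' (Measure.restrict_mono_ae hsub) le_rfl
    _ ≤ (∫⁻ z in A, ENNReal.ofReal (η (x - z))) + ∫⁻ z in W, ENNReal.ofReal (η (x - z)) := lintegral_union_le _ _ _
    _ ≤ _ := by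
      refine add_le_add le_rfl (hsweep.trans ?_)
      rw [grd]
      refine mul_le_mul' (ENNReal.ofReal_le_ofReal hle) (mul_le_mul' le_rfl (lintegral_mono fun z => ENNReal.ofReal_le_ofReal ?_))
      have : (L:ℝ) * h ≤ L * ε := by gcongr
      linarith

lemma grd_measurable {m : ℕ} {S : Set (EuclideanSpace ℝ (Fin (m+1)))} (hS : μH[(m:ℝ)] S ≠ ⊤)
    {η : EuclideanSpace ℝ (Fin (m+1)) → ℝ} {L : NNReal} (hL : LipschitzWith L η) (ε : ℝ) :
    Measurable (grd S η L ε) := by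
  have : IsFiniteMeasure ((μH[(m:ℝ)] : Measure (EuclideanSpace ℝ (Fin (m+1)))).restrict S) :=
    ⟨by rw [Measure.restrict_apply_univ]; exact hS.lt_top⟩
  have hηm : Measurable η := hL.continuous.measurable
  unfold grd
  refine Measurable.const_mul ?_ _
  refine Measurable.lintegral_prod_right' (f := fun p : EuclideanSpace ℝ (Fin (m+1)) × EuclideanSpace ℝ (Fin (m+1)) =>
    ENNReal.ofReal (η (p.1 - p.2) + L * ε)) ?_
  fun_prop

lemma mol_measurable {m : ℕ} (A : Set (EuclideanSpace ℝ (Fin (m+1))))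
    {η : EuclideanSpace ℝ (Fin (m+1)) → ℝ} (hη : Measurable η) : Measurable (mol A η) := by
  unfold mol
  refine Measurable.lintegral_prod_right' (f := fun p : EuclideanSpace ℝ (Fin (m+1)) × EuclideanSpace ℝ (Fin (m+1)) =>
    ENNReal.ofReal (η (p.1 - p.2))) ?_
  fun_prop

lemma mol_le_one {m : ℕ} (A : Set (EuclideanSpace ℝ (Fin (m+1))))
    {η : EuclideanSpace ℝ (Fin (m+1)) → ℝ} (h1 : ∫⁻ z, ENNReal.ofReal (η z) = 1) (x : EuclideanSpace ℝ (Fin (m+1))) :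
    mol A η x ≤ 1 := by
  rw [← h1, mol]
  refine (setLIntegral_le_lintegral _ _).trans ?_
  rw [lintegral_sub_left_eq_self (fun z => ENNReal.ofReal (η z)) x]

lemma grd_le {m : ℕ} (S : Set (EuclideanSpace ℝ (Fin (m+1))))
    {η : EuclideanSpace ℝ (Fin (m+1)) → ℝ} {M : ℝ} (hM : ∀ z, η z ≤ M) (L : NNReal) (ε : ℝ) (x : EuclideanSpace ℝ (Fin (m+1))) :
    grd S η L ε x ≤ (hcst m)⁻¹ * (ENNReal.ofReal (M + L * ε) * μH[(m:ℝ)] S) := by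
  unfold grd
  refine mul_le_mul' le_rfl ?_
  rw [← setLIntegral_const]
  exact lintegral_mono fun z => ENNReal.ofReal_le_ofReal (by linarith [hM (x - z)])

lemma mol_closed {m : ℕ} {A : Set (EuclideanSpace ℝ (Fin (m+1)))} (hA : MeasurableSet A)
    (hS : μH[(m:ℝ)] (mBoundary A) ≠ ⊤)
    {η : EuclideanSpace ℝ (Fin (m+1)) → ℝ} {L : NNReal} (hL : LipschitzWith L η) (h0 : ∀ z, 0 ≤ η z)
    {M : ℝ} (hM : ∀ z, η z ≤ M) (t : ℝ≥0∞) : IsClosed {x | t ≤ mol A η x} := by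
  rw [← isSeqClosed_iff_isClosed]
  intro y x hy hlim
  show t ≤ mol A η x
  set C := (hcst m)⁻¹ * (ENNReal.ofReal (M + L * 1) * μH[(m:ℝ)] (mBoundary A)) with hC
  have hCt : C ≠ ⊤ := ENNReal.mul_ne_top (ENNReal.inv_ne_top.2 (hcst_ne_zero m)) (ENNReal.mul_ne_top ENNReal.ofReal_ne_top hS)
  have hd : Tendsto (fun k => dist (y k) x) atTop (𝓝 0) := tendsto_iff_dist_tendsto_zero.1 hlim
  have hlim2 : Tendsto (fun k => mol A η x + ENNReal.ofReal (dist (y k) x) * C) atTop (𝓝 (mol A η x + 0)) := by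
    refine Tendsto.const_add _ ?_
    have := ENNReal.Tendsto.mul_const (ENNReal.tendsto_ofReal hd) (Or.inr hCt : _ ∨ C ≠ ⊤)
    simpa using this
  rw [add_zero] at hlim2
  refine ge_of_tendsto hlim2 ?_
  filter_upwards [hd.eventually (gt_mem_nhds one_pos)] with k hk
  refine (hy k).trans ((mol_step (x := x) hA hL h0 le_rfl).trans ?_)
  refine add_le_add le_rfl (mul_le_mul' le_rfl ((grd_le _ hM L _ x).trans ?_))
  rw [hC]
  refine mul_le_mul' le_rfl (mul_le_mul' (ENNReal.ofReal_le_ofReal ?_) le_rfl)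
  have : (L:ℝ) * dist (y k) x ≤ L * 1 := by gcongr
  linarith

lemma layer_cake {X : Type*} [MeasurableSpace X] (μ : Measure X) [SFinite μ] {g : X → ℝ≥0∞} (hg : Measurable g) :
    ∫⁻ x, g x ∂μ = ∫⁻ t in Ioi (0:ℝ), μ {x | ENNReal.ofReal t ≤ g x} := by
  have hms : MeasurableSet {p : X × ℝ | ENNReal.ofReal p.2 ≤ g p.1} :=
    measurableSet_le (by fun_prop) (by fun_prop)
  have h1 : ∀ x, g x = ∫⁻ t in Ioi (0:ℝ), ({p : X × ℝ | ENNReal.ofReal p.2 ≤ g p.1}).indicator 1 (x, t) := by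
    intro x
    have hm : MeasurableSet {t : ℝ | ENNReal.ofReal t ≤ g x} := measurableSet_le (by fun_prop) (by fun_prop)
    have : ∀ t, ({p : X × ℝ | ENNReal.ofReal p.2 ≤ g p.1}).indicator (1 : X × ℝ → ℝ≥0∞) (x, t)
      = ({t : ℝ | ENNReal.ofReal t ≤ g x}).indicator 1 t := fun t => rfl
    simp_rw [this]
    rw [lintegral_indicator_one hm, Measure.restrict_apply hm]
    rcases eq_or_ne (g x) ⊤ with h | h
    · simp [h]
    · have : {t : ℝ | ENNReal.ofReal t ≤ g x} ∩ Ioi 0 = Ioc 0 (g x).toReal := by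
        ext t
        simp only [mem_inter_iff, mem_ofPred_eq, mem_Ioi, mem_Ioc]
        rw [ENNReal.ofReal_le_iff_le_toReal h]; tauto
      rw [this, Real.volume_Ioc, sub_zero, ENNReal.ofReal_toReal h]
  calc ∫⁻ x, g x ∂μ = ∫⁻ x, (∫⁻ t in Ioi (0:ℝ), ({p : X × ℝ | ENNReal.ofReal p.2 ≤ g p.1}).indicator 1 (x, t)) ∂μ :=
        lintegral_congr h1
    _ = ∫⁻ t in Ioi (0:ℝ), ∫⁻ x, ({p : X × ℝ | ENNReal.ofReal p.2 ≤ g p.1}).indicator 1 (x, t) ∂μ := by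
        rw [lintegral_lintegral_swap]
        exact (measurable_one.indicator hms).aemeasurable
    _ = _ := by
        refine lintegral_congr fun t => ?_
        have hm : MeasurableSet {x | ENNReal.ofReal t ≤ g x} := measurableSet_le (by fun_prop) hg
        rw [← lintegral_indicator_one hm]
        rfl

lemma layer_ineq {X : Type*} [MeasurableSpace X] (μ : Measure X) [IsFiniteMeasure μ] {f g : X → ℝ≥0∞} (hf : Measurable f)
    (hg : Measurable g) {τ k : ℝ} (hk : 0 ≤ k) (hfg : ∀ x, f x ≤ g x)
    (h : ∀ t, τ ≤ t → ENNReal.ofReal (1 + k) * μ {x | ENNReal.ofReal t ≤ f x} ≤ μ {x | ENNReal.ofReal t ≤ g x}) :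
    ENNReal.ofReal (1 + k) * ∫⁻ x, f x ∂μ ≤ ∫⁻ x, g x ∂μ + ENNReal.ofReal k * (ENNReal.ofReal τ * μ univ) := by
  have e : ENNReal.ofReal k * (ENNReal.ofReal τ * μ univ) =
      ∫⁻ t in Ioi (0:ℝ), (Ioc 0 τ).indicator (fun _ => ENNReal.ofReal k * μ univ) t := by
    rw [lintegral_indicator measurableSet_Ioc, setLIntegral_const, Measure.restrict_apply measurableSet_Ioc,
      inter_eq_left.2 (fun x hx => hx.1), Real.volume_Ioc, sub_zero]
    ring
  rw [layer_cake μ hf, layer_cake μ hg, e, ← lintegral_const_mul' _ _ ENNReal.ofReal_ne_top,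
    ← lintegral_add_right _ (measurable_const.indicator measurableSet_Ioc)]
  refine setLIntegral_mono' measurableSet_Ioi fun t ht => ?_
  by_cases htτ : t ≤ τ
  · rw [indicator_of_mem (show t ∈ Ioc 0 τ from ⟨ht, htτ⟩), ENNReal.ofReal_add zero_le_one hk, ENNReal.ofReal_one, add_mul, one_mul]
    refine add_le_add (measure_mono fun x hx => ?_) (mul_le_mul' le_rfl (measure_mono (subset_univ _)))
    exact le_trans hx (hfg x)
  · exact (h t (by linarith)).trans le_self_add

end Moll

section Moll2

lemma grd_lintegral_le {m : ℕ} {S : Set (EuclideanSpace ℝ (Fin (m+1)))} (hS : μH[(m:ℝ)] S ≠ ⊤)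
    {η : EuclideanSpace ℝ (Fin (m+1)) → ℝ} {L : NNReal} (hL : LipschitzWith L η) (h0 : ∀ z, 0 ≤ η z)
    (h1 : ∫⁻ z, ENNReal.ofReal (η z) = 1) {a s r : ℝ} (hsupp : ∀ z, η z ≠ 0 → ‖z‖ < a) (has : s + a ≤ r)
    {ε : ℝ} (hε : 0 ≤ ε) :
    ∫⁻ x in ball 0 s, grd S η L ε x ≤ (hcst m)⁻¹ * (μH[(m:ℝ)] (S ∩ ball 0 r) +
      ENNReal.ofReal ε * (ENNReal.ofReal L * volume (ball (0:EuclideanSpace ℝ (Fin (m+1))) s) * μH[(m:ℝ)] S)) := by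
  set ν := (μH[(m:ℝ)] : Measure (EuclideanSpace ℝ (Fin (m+1)))).restrict S with hν
  have hfin : IsFiniteMeasure ν := ⟨by rw [hν, Measure.restrict_apply_univ]; exact hS.lt_top⟩
  have hηm : Measurable η := hL.continuous.measurable
  unfold grd
  rw [lintegral_const_mul' _ _ (ENNReal.inv_ne_top.2 (hcst_ne_zero m))]
  refine mul_le_mul' le_rfl ?_
  rw [lintegral_lintegral_swap (by
    have : Measurable (fun p : EuclideanSpace ℝ (Fin (m+1)) × EuclideanSpace ℝ (Fin (m+1)) =>
      ENNReal.ofReal (η (p.1 - p.2) + L * ε)) := by fun_prop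
    exact this.aemeasurable)]
  have hb : ∀ z, ∫⁻ x in ball 0 s, ENNReal.ofReal (η (x - z) + L * ε) ≤
      (ball 0 r).indicator 1 z + ENNReal.ofReal ε * (ENNReal.ofReal L * volume (ball (0:EuclideanSpace ℝ (Fin (m+1))) s)) := by
    intro z
    have : ∀ x, ENNReal.ofReal (η (x - z) + L * ε) = ENNReal.ofReal (η (x - z)) + ENNReal.ofReal ε * ENNReal.ofReal L := by
      intro x
      rw [ENNReal.ofReal_add (h0 _) (by positivity), mul_comm (L:ℝ), ENNReal.ofReal_mul hε]
    simp_rw [this]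
    rw [lintegral_add_right _ measurable_const, setLIntegral_const]
    refine add_le_add ?_ (by rw [mul_assoc])
    by_cases hz : z ∈ ball 0 r
    · rw [indicator_of_mem hz, Pi.one_apply, ← h1]
      refine (setLIntegral_le_lintegral _ _).trans ?_
      rw [lintegral_sub_right_eq_self (fun x => ENNReal.ofReal (η x)) z]
    · rw [indicator_of_notMem hz]
      refine le_of_eq ?_
      rw [setLIntegral_eq_zero_iff measurableSet_ball (by fun_prop)]
      refine Eventually.of_forall fun x hx => ?_
      by_cases hη : η (x - z) = 0
      · simp [hη]
      exfalso
      have h2 := hsupp _ hη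
      rw [mem_ball_zero_iff] at hx hz
      have h3 : ‖z‖ ≤ ‖x‖ + ‖x - z‖ := by
        have := norm_sub_le x (x - z); simpa using this
      linarith
  refine (lintegral_mono hb).trans ?_
  rw [lintegral_add_right _ measurable_const, lintegral_indicator_one measurableSet_ball, lintegral_const,
    Measure.restrict_apply measurableSet_ball, Measure.restrict_apply_univ, inter_comm, mul_assoc]

lemma moll_main {m : ℕ} {A : Set (EuclideanSpace ℝ (Fin (m+1)))} (hA : MeasurableSet A)
    (hS : μH[(m:ℝ)] (mBoundary A) ≠ ⊤)
    {η : EuclideanSpace ℝ (Fin (m+1)) → ℝ} {L : NNReal} (hL : LipschitzWith L η) (h0 : ∀ z, 0 ≤ η z)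
    {M : ℝ} (hM : ∀ z, η z ≤ M)
    (h1 : ∫⁻ z, ENNReal.ofReal (η z) = 1) {a s r : ℝ} (hsupp : ∀ z, η z ≠ 0 → ‖z‖ < a) (has : s + a ≤ r)
    (hs : 0 < s) {ε0 : ℝ} (hε0 : 0 < ε0) {v : ℝ≥0∞}
    (hiso : ∀ K : Set (EuclideanSpace ℝ (Fin (m+1))), IsCompact K →
        volume (K ∩ ball 0 s) ≤ v → ∀ ε, 0 < ε → ε < ε0 →
        ENNReal.ofReal (1 + (m+1) / s * ε) * volume (K ∩ ball 0 s) ≤ volume (thickening ε K ∩ ball 0 s))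
    {τ : ℝ} (hv : volume ({x | ENNReal.ofReal τ ≤ mol A η x} ∩ ball 0 s) ≤ v) :
    ENNReal.ofReal ((m+1)/s) * ∫⁻ x in ball 0 s, mol A η x ≤ (hcst m)⁻¹ * μH[(m:ℝ)] (mBoundary A ∩ ball 0 r) +
      ENNReal.ofReal ((m+1)/s) * (ENNReal.ofReal τ * volume (ball (0:EuclideanSpace ℝ (Fin (m+1))) s)) := by
  have hηm : Measurable η := hL.continuous.measurable
  set S := mBoundary A with hSdef
  set k : ℝ := (m+1)/s with hk
  have hk0 : 0 ≤ k := by positivity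
  set μ := (volume : Measure (EuclideanSpace ℝ (Fin (m+1)))).restrict (ball 0 s) with hμ
  have hBt : volume (ball (0:EuclideanSpace ℝ (Fin (m+1))) s) ≠ ⊤ := measure_ball_lt_top.ne
  have hμfin : IsFiniteMeasure μ := ⟨by rw [hμ, Measure.restrict_apply_univ]; exact hBt.lt_top⟩
  have hfm := mol_measurable A hηm
  have hft : ∫⁻ x, mol A η x ∂μ ≠ ⊤ := by
    refine ne_top_of_le_ne_top hBt ?_
    calc ∫⁻ x, mol A η x ∂μ ≤ ∫⁻ x, 1 ∂μ := lintegral_mono (mol_le_one A h1)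
      _ = _ := by simp [hμ]
  set Q : ℝ≥0∞ := ENNReal.ofReal L * volume (ball (0:EuclideanSpace ℝ (Fin (m+1))) s) * μH[(m:ℝ)] S with hQ
  have hQt : Q ≠ ⊤ := ENNReal.mul_ne_top (ENNReal.mul_ne_top ENNReal.ofReal_ne_top hBt) hS
  -- the inequality at scale ε
  have hstep : ∀ ε, 0 < ε → ε < ε0 → ENNReal.ofReal k * ∫⁻ x, mol A η x ∂μ ≤
      (hcst m)⁻¹ * (μH[(m:ℝ)] (S ∩ ball 0 r) + ENNReal.ofReal ε * Q) +
        ENNReal.ofReal k * (ENNReal.ofReal τ * volume (ball (0:EuclideanSpace ℝ (Fin (m+1))) s)) := by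
    intro ε hε hεlt
    have hgm := grd_measurable hS hL ε
    have hl := layer_ineq μ (f := mol A η) (g := fun x => mol A η x + ENNReal.ofReal ε * grd S η L ε x) hfm
      (hfm.add (hgm.const_mul _)) (τ := τ) (k := k * ε) (by positivity) (fun x => le_self_add) (by
        intro t ht
        have hm1 : MeasurableSet {x | ENNReal.ofReal t ≤ mol A η x} := measurableSet_le measurable_const hfm
        have hm2 : MeasurableSet {x | ENNReal.ofReal t ≤ mol A η x + ENNReal.ofReal ε * grd S η L ε x} :=
          measurableSet_le measurable_const (hfm.add (hgm.const_mul _))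
        rw [hμ, Measure.restrict_apply hm1, Measure.restrict_apply hm2]
        set K := {x | ENNReal.ofReal t ≤ mol A η x} ∩ closedBall 0 s with hK
        have hKc : IsCompact K := (isCompact_closedBall 0 s).inter_left (mol_closed hA hS hL h0 hM _)
        have hKB : K ∩ ball 0 s = {x | ENNReal.ofReal t ≤ mol A η x} ∩ ball 0 s := by
          rw [hK, inter_assoc, inter_eq_right.2 (ball_subset_closedBall : ball (0:EuclideanSpace ℝ (Fin (m+1))) s ⊆ _)]
        have := hiso K hKc (by
          rw [hKB]
          refine (measure_mono (inter_subset_inter_left _ fun x hx => ?_)).trans hv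
          exact le_trans (ENNReal.ofReal_le_ofReal ht) hx) ε hε hεlt
        rw [hKB] at this
        refine this.trans (measure_mono (inter_subset_inter_left _ ?_))
        intro w hw
        obtain ⟨x, hx, hd⟩ := mem_thickening_iff.1 hw
        have hx1 : ENNReal.ofReal t ≤ mol A η x := hx.1
        exact hx1.trans (mol_step hA hL h0 (by rw [dist_comm]; exact hd.le)))
    rw [lintegral_add_right _ (hgm.const_mul _), lintegral_const_mul' _ _ ENNReal.ofReal_ne_top,
      ENNReal.ofReal_add zero_le_one (by positivity), ENNReal.ofReal_one, add_mul, one_mul, add_assoc,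
      ENNReal.add_le_add_iff_left hft, mul_comm k ε, ENNReal.ofReal_mul hε.le, mul_assoc, mul_assoc, ← mul_add] at hl
    have he0 : ENNReal.ofReal ε ≠ 0 := by rw [ne_eq, ENNReal.ofReal_eq_zero, not_le]; exact hε
    rw [ENNReal.mul_le_mul_iff_right he0 ENNReal.ofReal_ne_top] at hl
    refine hl.trans (add_le_add ?_ ?_)
    · exact grd_lintegral_le hS hL h0 h1 hsupp has hε.le
    · rw [hμ, Measure.restrict_apply_univ]
  have hlim : Tendsto (fun ε : ℝ => (hcst m)⁻¹ * (μH[(m:ℝ)] (S ∩ ball 0 r) + ENNReal.ofReal ε * Q) +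
        ENNReal.ofReal k * (ENNReal.ofReal τ * volume (ball (0:EuclideanSpace ℝ (Fin (m+1))) s))) (𝓝[>] 0)
      (𝓝 ((hcst m)⁻¹ * (μH[(m:ℝ)] (S ∩ ball 0 r) + 0) +
        ENNReal.ofReal k * (ENNReal.ofReal τ * volume (ball (0:EuclideanSpace ℝ (Fin (m+1))) s)))) := by
    refine Tendsto.add_const _ (ENNReal.Tendsto.const_mul (Tendsto.const_add _ ?_) (Or.inr (ENNReal.inv_ne_top.2 (hcst_ne_zero m))))
    have h2 : Tendsto (fun ε : ℝ => ENNReal.ofReal ε) (𝓝[>] 0) (𝓝 (ENNReal.ofReal 0)) :=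
      (ENNReal.tendsto_ofReal tendsto_id).mono_left nhdsWithin_le_nhds
    have := ENNReal.Tendsto.mul_const h2 (Or.inr hQt : _ ∨ Q ≠ ⊤)
    simpa using this
  rw [add_zero] at hlim
  refine ge_of_tendsto hlim ?_
  filter_upwards [Ioo_mem_nhdsGT hε0] with ε hε
  exact hstep ε hε.1 hε.2

end Moll2

section Moll3

lemma exists_moll (m : ℕ) : ∃ (η : ℕ → EuclideanSpace ℝ (Fin (m+1)) → ℝ) (a : ℕ → ℝ), Tendsto a atTop (𝓝 0) ∧
    (∀ j, (∃ L, LipschitzWith L (η j)) ∧ (∀ z, 0 ≤ η j z) ∧ (∃ M, ∀ z, η j z ≤ M) ∧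
      (∫⁻ z, ENNReal.ofReal (η j z) = 1) ∧ ∀ z, η j z ≠ 0 → ‖z‖ < a j) ∧
    ∀ A : Set (EuclideanSpace ℝ (Fin (m+1))), MeasurableSet A →
      ∀ᵐ x, Tendsto (fun j => mol A (η j) x) atTop (𝓝 (A.indicator 1 x)) := by
  have hp : ∀ j : ℕ, (0:ℝ) < 1 / ((j:ℝ) + 1) := fun j => by positivity
  let φ : ℕ → ContDiffBump (0 : EuclideanSpace ℝ (Fin (m+1))) := fun j =>
    ⟨1 / ((j:ℝ) + 1), 2 * (1 / ((j:ℝ) + 1)), hp j, by linarith [hp j]⟩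
  have hr : Tendsto (fun j => (φ j).rOut) atTop (𝓝 0) := by
    have := (tendsto_one_div_add_atTop_nhds_zero_nat (𝕜 := ℝ)).const_mul 2
    rwa [mul_zero] at this
  refine ⟨fun j => (φ j).normed volume, fun j => (φ j).rOut, hr, ?_, ?_⟩
  · intro j
    refine ⟨ContDiff.lipschitzWith_of_hasCompactSupport (𝕂 := ℝ) (n := 1) (φ j).hasCompactSupport_normed
        ((φ j).contDiff_normed (n := 1)) (by simp), fun z => (φ j).nonneg_normed z,
        ⟨_, fun z => (φ j).normed_le_div_measure_closedBall_rIn volume z⟩, ?_, ?_⟩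
    · rw [← ofReal_integral_eq_lintegral_ofReal (φ j).integrable_normed (Eventually.of_forall fun z => (φ j).nonneg_normed z),
        (φ j).integral_normed, ENNReal.ofReal_one]
    · intro z hz
      have : z ∈ Function.support ((φ j).normed volume) := hz
      rw [(φ j).support_normed_eq] at this
      simpa using this
  · intro A hA
    have hli : LocallyIntegrable (A.indicator (fun _ => (1:ℝ))) (volume : Measure (EuclideanSpace ℝ (Fin (m+1)))) :=
      (locallyIntegrable_const (1:ℝ)).indicator hA
    filter_upwards [ContDiffBump.ae_convolution_tendsto_right_of_locallyIntegrable (φ := φ) (K := 2) hr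
      (Eventually.of_forall fun j => le_rfl) hli] with x hx
    have e : ∀ j, mol A ((φ j).normed volume) x = ENNReal.ofReal
        ((convolution ((φ j).normed volume) (A.indicator (fun _ => (1:ℝ))) (ContinuousLinearMap.lsmul ℝ ℝ) volume) x) := by
      intro j
      rw [convolution_lsmul_swap]
      have h_integr : Integrable (fun z => (φ j).normed volume (x - z)) volume := (φ j).integrable_normed.comp_sub_left x
      have e2 : (fun t => (φ j).normed volume (x - t) • A.indicator (fun _ => (1:ℝ)) t) =
          A.indicator (fun z => (φ j).normed volume (x - z)) := by
        ext t; by_cases ht : t ∈ A <;> simp [ht]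
      rw [e2, integral_indicator hA, mol,
        ofReal_integral_eq_lintegral_ofReal h_integr.integrableOn (Eventually.of_forall fun z => (φ j).nonneg_normed _)]
    simp_rw [e]
    have := ENNReal.tendsto_ofReal hx
    convert this using 2
    by_cases ht : x ∈ A <;> simp [ht]

lemma moll_limit {m : ℕ} {A : Set (EuclideanSpace ℝ (Fin (m+1)))} (hA : MeasurableSet A)
    (hS : μH[(m:ℝ)] (mBoundary A) ≠ ⊤) {s r : ℝ} (hs : 0 < s) (hsr : s < r)
    {ε0 : ℝ} (hε0 : 0 < ε0) {v : ℝ≥0∞}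
    (hiso : ∀ K : Set (EuclideanSpace ℝ (Fin (m+1))), IsCompact K →
        volume (K ∩ ball 0 s) ≤ v → ∀ ε, 0 < ε → ε < ε0 →
        ENNReal.ofReal (1 + (m+1) / s * ε) * volume (K ∩ ball 0 s) ≤ volume (thickening ε K ∩ ball 0 s))
    (hv : volume (A ∩ ball 0 s) < v) {τ : ℝ} (hτ : 0 < τ) :
    ENNReal.ofReal ((m+1)/s) * volume (A ∩ ball 0 s) ≤ (hcst m)⁻¹ * μH[(m:ℝ)] (mBoundary A ∩ ball 0 r) +
      ENNReal.ofReal ((m+1)/s) * (ENNReal.ofReal τ * volume (ball (0:EuclideanSpace ℝ (Fin (m+1))) s)) := by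
  obtain ⟨η, a, ha, hη, hconv⟩ := exists_moll m
  have hBt : volume (ball (0:EuclideanSpace ℝ (Fin (m+1))) s) ≠ ⊤ := measure_ball_lt_top.ne
  have hmeas : ∀ j, Measurable (mol A (η j)) := fun j => by
    obtain ⟨⟨L, hL⟩, -⟩ := hη j
    exact mol_measurable A hL.continuous.measurable
  have hone : ∀ j x, mol A (η j) x ≤ 1 := fun j x => mol_le_one A (hη j).2.2.2.1 x
  have hdc : ∀ T : Set (EuclideanSpace ℝ (Fin (m+1))), MeasurableSet T →
      Tendsto (fun j => ∫⁻ x in T ∩ ball 0 s, mol A (η j) x) atTop (𝓝 (volume (A ∩ (T ∩ ball 0 s)))) := by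
    intro T hT
    have := tendsto_lintegral_of_dominated_convergence (μ := volume.restrict (T ∩ ball 0 s)) (F := fun j => mol A (η j))
      (f := A.indicator 1) (fun _ => 1) hmeas (fun j => Eventually.of_forall (hone j)) (by
        rw [lintegral_one, Measure.restrict_apply_univ]
        exact ne_top_of_le_ne_top hBt (measure_mono inter_subset_right)) (ae_restrict_of_ae (hconv A hA))
    rwa [lintegral_indicator_one hA, Measure.restrict_apply hA] at this
  have h1 := hdc univ MeasurableSet.univ
  have h2 := hdc Aᶜ hA.compl
  rw [univ_inter] at h1
  have e0 : A ∩ (Aᶜ ∩ ball 0 s) = ∅ := by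
    rw [← inter_assoc, inter_compl_self, empty_inter]
  rw [e0, measure_empty] at h2
  have hτ0 : ENNReal.ofReal τ ≠ 0 := by rw [ne_eq, ENNReal.ofReal_eq_zero, not_le]; exact hτ
  have h3 : Tendsto (fun j => volume (A ∩ ball 0 s) + (ENNReal.ofReal τ)⁻¹ * ∫⁻ x in Aᶜ ∩ ball 0 s, mol A (η j) x) atTop
      (𝓝 (volume (A ∩ ball 0 s) + (ENNReal.ofReal τ)⁻¹ * 0)) :=
    Tendsto.const_add _ (ENNReal.Tendsto.const_mul h2 (Or.inr (ENNReal.inv_ne_top.2 hτ0)))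
  rw [mul_zero, add_zero] at h3
  refine le_of_tendsto (ENNReal.Tendsto.const_mul h1 (Or.inr ENNReal.ofReal_ne_top)) ?_
  filter_upwards [h3.eventually (gt_mem_nhds hv), ha.eventually (gt_mem_nhds (sub_pos.2 hsr))] with j hj1 hj2
  obtain ⟨⟨L, hL⟩, h0, ⟨M, hM⟩, hi1, hsupp⟩ := hη j
  refine moll_main hA hS hL h0 hM hi1 hsupp (by linarith) hs hε0 hiso (le_trans ?_ hj1.le)
  set Q := {x | ENNReal.ofReal τ ≤ mol A (η j) x} with hQ
  have hQm : MeasurableSet Q := measurableSet_le measurable_const (hmeas j)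
  have hsub : Q ∩ ball 0 s ⊆ (A ∩ ball 0 s) ∪ (Q ∩ (Aᶜ ∩ ball 0 s)) := by
    intro x hx
    by_cases hxA : x ∈ A
    · exact Or.inl ⟨hxA, hx.2⟩
    · exact Or.inr ⟨hx.1, hxA, hx.2⟩
  refine (measure_mono hsub).trans ((measure_union_le _ _).trans (add_le_add le_rfl ?_))
  rw [← Measure.restrict_apply hQm]
  have := mul_meas_ge_le_lintegral (μ := volume.restrict (Aᶜ ∩ ball 0 s)) (hmeas j) (ENNReal.ofReal τ)
  rw [mul_comm, ← div_eq_mul_inv, ENNReal.le_div_iff_mul_le (Or.inl hτ0) (Or.inl ENNReal.ofReal_ne_top), mul_comm]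
  exact this

lemma perim_lower {m : ℕ} {A : Set (EuclideanSpace ℝ (Fin (m+1)))} (hA : MeasurableSet A)
    (hS : μH[(m:ℝ)] (mBoundary A) ≠ ⊤) {r : ℝ} (hr : 0 < r) {u : EuclideanSpace ℝ (Fin (m+1))} (hu : ‖u‖ = 1)
    (hsm : volume (A ∩ ball 0 r) ≤ ENNReal.ofReal (r^(m+1)) * volume (ball 0 1 ∩ ball (√2 • u) 1)) :
    ENNReal.ofReal ((m+1)/r) * volume (A ∩ ball 0 r) ≤ (hcst m)⁻¹ * μH[(m:ℝ)] (mBoundary A ∩ ball 0 r) := by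
  obtain ⟨v, hv1, hv2, ε0, hε0, hiso⟩ := iso_ball_scaled hu
  have hrn : ENNReal.ofReal (r^(m+1)) ≠ 0 := by rw [ne_eq, ENNReal.ofReal_eq_zero, not_le]; positivity
  have hlt : volume (A ∩ ball 0 r) < ENNReal.ofReal (r^(m+1)) * v :=
    hsm.trans_lt ((ENNReal.mul_lt_mul_iff_right hrn ENNReal.ofReal_ne_top).2 hv1)
  have hc : Tendsto (fun s : ℝ => ENNReal.ofReal (s^(m+1)) * v) (𝓝[<] r) (𝓝 (ENNReal.ofReal (r^(m+1)) * v)) := by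
    refine ENNReal.Tendsto.mul_const (ENNReal.tendsto_ofReal ?_) (Or.inr hv2)
    exact ((continuous_pow (m+1)).tendsto r).mono_left nhdsWithin_le_nhds
  have hfix : ∀ᶠ s in 𝓝[<] r, ENNReal.ofReal ((m+1)/r) * volume (A ∩ ball 0 s) ≤
      (hcst m)⁻¹ * μH[(m:ℝ)] (mBoundary A ∩ ball 0 r) := by
    filter_upwards [hc.eventually (lt_mem_nhds hlt), Ioo_mem_nhdsLT hr] with s hs1 hs2
    have hBt : volume (ball (0:EuclideanSpace ℝ (Fin (m+1))) s) ≠ ⊤ := measure_ball_lt_top.ne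
    have hle : volume (A ∩ ball 0 s) ≤ volume (A ∩ ball 0 r) :=
      measure_mono (inter_subset_inter_right _ (ball_subset_ball hs2.2.le))
    have h := fun τ hτ => moll_limit hA hS hs2.1 hs2.2 (mul_pos hs2.1 hε0) (hiso s hs2.1) (hle.trans_lt hs1) (τ := τ) hτ
    have hlim : Tendsto (fun τ : ℝ => (hcst m)⁻¹ * μH[(m:ℝ)] (mBoundary A ∩ ball 0 r) +
      ENNReal.ofReal ((m+1)/s) * (ENNReal.ofReal τ * volume (ball (0:EuclideanSpace ℝ (Fin (m+1))) s))) (𝓝[>] 0)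
      (𝓝 ((hcst m)⁻¹ * μH[(m:ℝ)] (mBoundary A ∩ ball 0 r) + ENNReal.ofReal ((m+1)/s) * (ENNReal.ofReal 0 * volume (ball (0:EuclideanSpace ℝ (Fin (m+1))) s)))) := by
      refine Tendsto.const_add _ (ENNReal.Tendsto.const_mul (ENNReal.Tendsto.mul_const ?_ (Or.inr hBt)) (Or.inr ENNReal.ofReal_ne_top))
      exact (ENNReal.tendsto_ofReal tendsto_id).mono_left nhdsWithin_le_nhds
    rw [ENNReal.ofReal_zero, zero_mul, mul_zero, add_zero] at hlim
    have h4 := ge_of_tendsto hlim (by filter_upwards [self_mem_nhdsWithin] with τ hτ using h τ hτ)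
    refine le_trans (mul_le_mul' (ENNReal.ofReal_le_ofReal ?_) le_rfl) h4
    exact div_le_div_of_nonneg_left (by positivity) hs2.1 hs2.2.le
  -- exhaust
  obtain ⟨σ, hσm, hσ, hσl⟩ := exists_seq_strictMono_tendsto' (show r - 1 < r by linarith)
  have hσ' : Tendsto σ atTop (𝓝[<] r) := tendsto_nhdsWithin_iff.2 ⟨hσl, Eventually.of_forall fun k => (hσ k).2⟩
  have hU : (⋃ k, A ∩ ball (0:EuclideanSpace ℝ (Fin (m+1))) (σ k)) = A ∩ ball 0 r := by
    rw [← inter_iUnion]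
    congr 1
    ext x
    simp only [mem_iUnion, mem_ball_zero_iff]
    constructor
    · rintro ⟨k, hk⟩; exact hk.trans (hσ k).2
    · intro hx; exact (hσl.eventually (lt_mem_nhds hx)).exists
  have hmono : Monotone fun k => A ∩ ball (0:EuclideanSpace ℝ (Fin (m+1))) (σ k) := fun i j hij =>
    inter_subset_inter_right _ (ball_subset_ball (hσm.monotone hij))
  have hT := tendsto_measure_iUnion_atTop (μ := volume) hmono
  rw [hU] at hT
  exact le_of_tendsto (ENNReal.Tendsto.const_mul hT (Or.inr ENNReal.ofReal_ne_top)) (hσ'.eventually hfix)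

end Moll3

section Sphere

lemma radial_lip {X : Type*} [NormedAddCommGroup X] [InnerProductSpace ℝ X] {a b : X} (ha : 1 ≤ ‖a‖) (hb : 1 ≤ ‖b‖) :
    ‖‖a‖⁻¹ • a - ‖b‖⁻¹ • b‖ ≤ ‖a - b‖ := by
  have ha0 : 0 < ‖a‖ := by linarith
  have hb0 : 0 < ‖b‖ := by linarith
  refine le_of_sq_le_sq ?_ (norm_nonneg _)
  rw [norm_sub_sq_real, norm_sub_sq_real, norm_smul, norm_smul, real_inner_smul_left, real_inner_smul_right,
    norm_inv, norm_inv, norm_norm, norm_norm, inv_mul_cancel₀ ha0.ne', inv_mul_cancel₀ hb0.ne']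
  set α := ‖a‖
  set β := ‖b‖
  set c := α⁻¹ * (β⁻¹ * inner ℝ a b) with hc
  have hi : inner ℝ a b = α * β * c := by rw [hc]; field_simp
  have hc1 : c ≤ 1 := by
    have := real_inner_le_norm a b
    rw [hi] at this
    have h2 : 0 < α * β := by positivity
    by_contra h
    push Not at h
    nlinarith
  rw [hi]
  have h1 : 1 ≤ α * β := by nlinarith
  nlinarith [sq_nonneg (α - β), mul_nonneg (sub_nonneg.2 h1) (sub_nonneg.2 hc1)]

/-- sector of the unit ball over a subset of the sphere of radius `r` -/
def sec {m : ℕ} (r : ℝ) (U : Set (EuclideanSpace ℝ (Fin (m+1)))) : Set (EuclideanSpace ℝ (Fin (m+1))) :=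
  {x | x ∈ ball 0 1 ∧ (r / ‖x‖) • x ∈ U}

lemma sec_meas {m : ℕ} (r : ℝ) {U : Set (EuclideanSpace ℝ (Fin (m+1)))} (hU : MeasurableSet U) :
    MeasurableSet (sec r U) := by
  refine measurableSet_ball.inter ?_
  have : Measurable fun x : EuclideanSpace ℝ (Fin (m+1)) => (r / ‖x‖) • x :=
    (measurable_const.div measurable_norm).smul measurable_id
  exact this hU

lemma lintegral_pow_Ioo (m : ℕ) {q : ℝ} (hq : 0 ≤ q) :
    ∫⁻ t in Ioo 0 q, ENNReal.ofReal (t^m) = ENNReal.ofReal (q^(m+1) / (m+1)) := by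
  rw [← ofReal_integral_eq_lintegral_ofReal, ← integral_Ioc_eq_integral_Ioo, ← intervalIntegral.integral_of_le hq, integral_pow]
  · simp
  · exact ((continuous_pow m).continuousOn.integrableOn_Icc (a := 0) (b := q)).mono_set Ioo_subset_Icc_self
  · rw [EventuallyLE, ae_restrict_iff' measurableSet_Ioo]
    exact Eventually.of_forall fun t ht => pow_nonneg ht.1.le m

lemma sphere_piece {m : ℕ} {p : EuclideanSpace ℝ (Fin (m+1))} (hp : ‖p‖ = 1) {q r : ℝ} (hq : 0 < q) (hr : 0 < r)
    {U : Set (EuclideanSpace ℝ (Fin (m+1)))} (hU : MeasurableSet U) (hUs : U ⊆ sphere 0 r)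
    (hUq : ∀ x ∈ U, q * r < inner ℝ p x) :
    ENNReal.ofReal (q^(m+1)/(m+1)) * μH[(m:ℝ)] U ≤ ENNReal.ofReal (r^m) * hcst m * volume (sec r U) := by
  obtain ⟨Φ, ι, hΦ, hΦf, hι⟩ := exists_frame p hp
  set a : EuclideanSpace ℝ (Fin m) → EuclideanSpace ℝ (Fin (m+1)) := fun y => p + ι y with hadef
  have hpa : ∀ y, inner ℝ p (a y) = 1 := by
    intro y; rw [hadef]; simp only [inner_add_right, hι, add_zero, real_inner_self_eq_norm_sq, hp]; norm_num
  have ha1 : ∀ y, 1 ≤ ‖a y‖ := by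
    intro y
    have := real_inner_le_norm p (a y)
    rw [hpa, hp, one_mul] at this; exact this
  set F : EuclideanSpace ℝ (Fin m) → EuclideanSpace ℝ (Fin (m+1)) := fun y => r • (‖a y‖⁻¹ • a y) with hF
  have hFl : LipschitzWith (Real.toNNReal r) F := by
    refine LipschitzWith.of_dist_le_mul fun y z => ?_
    rw [Real.coe_toNNReal r hr.le, dist_eq_norm, hF]
    simp only
    rw [← smul_sub, norm_smul, Real.norm_of_nonneg hr.le]
    refine mul_le_mul_of_nonneg_left ((radial_lip (ha1 y) (ha1 z)).trans (le_of_eq ?_)) hr.le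
    rw [hadef]; simp only
    rw [add_sub_add_left_eq_sub, ← map_sub, LinearIsometry.norm_map, dist_eq_norm]
  set T := F ⁻¹' U with hT
  -- surjectivity
  have hsurj : U ⊆ F '' T := by
    intro x hx
    have hix : 0 < inner ℝ p x := lt_trans (by positivity) (hUq x hx)
    have hxn : ‖x‖ = r := by simpa using hUs hx
    obtain ⟨⟨t, y⟩, hty⟩ := Φ.surjective x
    rw [hΦf] at hty
    have ht : inner ℝ p x = t := by
      rw [← hty, inner_add_right, hι, add_zero, real_inner_smul_right, real_inner_self_eq_norm_sq, hp]; norm_num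
    rw [ht] at hix
    have e1 : x = t • a (t⁻¹ • y) := by
      rw [hadef]; simp only
      rw [smul_add, map_smul, smul_smul, mul_inv_cancel₀ hix.ne', one_smul, hty]
    have hFx : F (t⁻¹ • y) = x := by
      have hn : ‖x‖ = t * ‖a (t⁻¹ • y)‖ := by
        conv_lhs => rw [e1]
        rw [norm_smul, Real.norm_of_nonneg hix.le]
      have hapos : 0 < ‖a (t⁻¹ • y)‖ := by linarith [ha1 (t⁻¹ • y)]
      rw [hF]; simp only
      conv_rhs => rw [e1]
      rw [smul_smul, ← hxn, hn, mul_assoc, mul_inv_cancel₀ hapos.ne', mul_one]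
    exact ⟨_, by rw [hT, mem_preimage, hFx]; exact hx, hFx⟩
  have h1 : μH[(m:ℝ)] U ≤ ENNReal.ofReal (r^m) * hcst m * volume T := by
    refine (measure_mono hsurj).trans ?_
    refine ((hFl.hausdorffMeasure_image_le (Nat.cast_nonneg m) T)).trans (le_of_eq ?_)
    rw [hausdorff_eq, Measure.smul_apply, smul_eq_mul, ← mul_assoc, ENNReal.rpow_natCast, ENNReal.ofReal_pow hr.le]
    rfl
  have h2 : ENNReal.ofReal (q^(m+1)/(m+1)) * volume T ≤ volume (sec r U) := by
    have hsm := sec_meas r hU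
    rw [← hΦ.measure_preimage hsm.nullMeasurableSet]
    have hvp : (volume : Measure (ℝ × EuclideanSpace ℝ (Fin m))) = (volume : Measure ℝ).prod volume := rfl
    rw [hvp, Measure.prod_apply (Φ.measurable hsm), ← lintegral_pow_Ioo m hq.le, ← lintegral_mul_const _ (by fun_prop)]
    refine le_trans (setLIntegral_mono' measurableSet_Ioo ?_) (setLIntegral_le_lintegral (Ioo 0 q) _)
    intro t ht
    have ht0 : 0 < t := ht.1
    have e3 : volume ((fun y : EuclideanSpace ℝ (Fin m) => t⁻¹ • y) ⁻¹' T) = ENNReal.ofReal (t^m) * volume T := by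
      rw [Measure.addHaar_preimage_smul _ (inv_ne_zero ht0.ne'), finrank_euclideanSpace_fin, inv_pow, inv_inv,
        abs_of_nonneg (by positivity)]
    rw [← e3]
    refine measure_mono ?_
    intro y hy
    have hy : F (t⁻¹ • y) ∈ U := hy
    show Φ (t, y) ∈ sec r U
    have e1 : Φ (t, y) = t • a (t⁻¹ • y) := by
      rw [hΦf, hadef]; simp only
      rw [smul_add, map_smul, smul_smul, mul_inv_cancel₀ ht0.ne', one_smul]
    set b := a (t⁻¹ • y) with hb
    have hbpos : 0 < ‖b‖ := by linarith [ha1 (t⁻¹ • y)]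
    have hFb : F (t⁻¹ • y) = r • (‖b‖⁻¹ • b) := rfl
    have hqb : q * ‖b‖ < 1 := by
      have := hUq _ hy
      rw [hFb, real_inner_smul_right, real_inner_smul_right, hpa, mul_one, mul_comm, mul_lt_mul_iff_right₀ hr] at this
      rwa [lt_inv_comm₀ hq hbpos, ← one_div, lt_div_iff₀ hq, mul_comm] at this
    have hn : ‖t • b‖ = t * ‖b‖ := by rw [norm_smul, Real.norm_of_nonneg ht0.le]
    rw [e1]
    refine ⟨?_, ?_⟩
    · rw [mem_ball_zero_iff, hn]
      have : t * ‖b‖ ≤ q * ‖b‖ := by have := ht.2.le; gcongr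
      linarith
    · have : (r / ‖t • b‖) • (t • b) = F (t⁻¹ • y) := by
        rw [hFb, hn, smul_smul, smul_smul]
        congr 1
        field_simp
      rw [this]; exact hy
  calc ENNReal.ofReal (q^(m+1)/(m+1)) * μH[(m:ℝ)] U
      ≤ ENNReal.ofReal (q^(m+1)/(m+1)) * (ENNReal.ofReal (r^m) * hcst m * volume T) := mul_le_mul' le_rfl h1
    _ = ENNReal.ofReal (r^m) * hcst m * (ENNReal.ofReal (q^(m+1)/(m+1)) * volume T) := by ring
    _ ≤ _ := mul_le_mul' le_rfl h2

lemma sphere_q {m : ℕ} {q r : ℝ} (hq : 0 < q) (hq1 : q < 1) (hr : 0 < r) :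
    ENNReal.ofReal (q^(m+1)/(m+1)) * μH[(m:ℝ)] (sphere (0:EuclideanSpace ℝ (Fin (m+1))) r) ≤
      ENNReal.ofReal (r^m) * hcst m * volume (ball (0:EuclideanSpace ℝ (Fin (m+1))) 1) := by
  have hne : Nonempty (sphere (0:EuclideanSpace ℝ (Fin (m+1))) 1) :=
    ⟨⟨EuclideanSpace.single 0 1, by simp⟩⟩
  let d := TopologicalSpace.denseSeq (sphere (0:EuclideanSpace ℝ (Fin (m+1))) 1)
  have hd : ∀ i, ‖(d i : EuclideanSpace ℝ (Fin (m+1)))‖ = 1 := fun i => by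
    have := (d i).2; simpa using this
  let V : ℕ → Set (EuclideanSpace ℝ (Fin (m+1))) := fun i => sphere 0 r ∩ {x | q * r < inner ℝ (d i : EuclideanSpace ℝ (Fin (m+1))) x}
  have hVm : ∀ i, MeasurableSet (V i) := fun i => isClosed_sphere.measurableSet.inter
    (isOpen_lt continuous_const (continuous_const.inner continuous_id)).measurableSet
  have hcov : sphere (0:EuclideanSpace ℝ (Fin (m+1))) r ⊆ ⋃ i, disjointed V i := by
    rw [iUnion_disjointed]
    intro x hx
    have hxn : ‖x‖ = r := by simpa using hx
    have hO : IsOpen {p : sphere (0:EuclideanSpace ℝ (Fin (m+1))) 1 | q * r < inner ℝ (p : EuclideanSpace ℝ (Fin (m+1))) x} :=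
      isOpen_lt continuous_const (continuous_subtype_val.inner continuous_const)
    have hON : {p : sphere (0:EuclideanSpace ℝ (Fin (m+1))) 1 | q * r < inner ℝ (p : EuclideanSpace ℝ (Fin (m+1))) x}.Nonempty := by
      refine ⟨⟨r⁻¹ • x, by simp [norm_smul, hxn, abs_of_pos hr, hr.ne']⟩, ?_⟩
      show q * r < inner ℝ (r⁻¹ • x) x
      rw [real_inner_smul_left, real_inner_self_eq_norm_sq, hxn, sq, ← mul_assoc, inv_mul_cancel₀ hr.ne', one_mul]
      nlinarith
    obtain ⟨p, hp, ⟨i, rfl⟩⟩ := (TopologicalSpace.denseRange_denseSeq (sphere (0:EuclideanSpace ℝ (Fin (m+1))) 1)).inter_open_nonempty _ hO hON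
    exact mem_iUnion.2 ⟨i, hx, hp⟩
  have hUm : ∀ i, MeasurableSet (disjointed V i) := fun i => MeasurableSet.disjointed hVm i
  have hsub : ∀ i, disjointed V i ⊆ V i := disjointed_subset V
  calc ENNReal.ofReal (q^(m+1)/(m+1)) * μH[(m:ℝ)] (sphere (0:EuclideanSpace ℝ (Fin (m+1))) r)
      ≤ ENNReal.ofReal (q^(m+1)/(m+1)) * ∑' i, μH[(m:ℝ)] (disjointed V i) :=
        mul_le_mul' le_rfl ((measure_mono hcov).trans (measure_iUnion_le _))
    _ = ∑' i, ENNReal.ofReal (q^(m+1)/(m+1)) * μH[(m:ℝ)] (disjointed V i) := ENNReal.tsum_mul_left.symm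
    _ ≤ ∑' i, ENNReal.ofReal (r^m) * hcst m * volume (sec r (disjointed V i)) := by
        refine ENNReal.tsum_le_tsum fun i => ?_
        exact sphere_piece (hd i) hq hr (hUm i) (fun x hx => (hsub i hx).1) (fun x hx => (hsub i hx).2)
    _ = ENNReal.ofReal (r^m) * hcst m * ∑' i, volume (sec r (disjointed V i)) := ENNReal.tsum_mul_left
    _ = ENNReal.ofReal (r^m) * hcst m * volume (⋃ i, sec r (disjointed V i)) := by
        rw [measure_iUnion _ (fun i => sec_meas r (hUm i))]
        intro i j hij
        have := disjoint_disjointed V hij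
        refine Set.disjoint_left.2 fun x hx hx' => Set.disjoint_left.1 this hx.2 hx'.2
    _ ≤ _ := mul_le_mul' le_rfl (measure_mono (iUnion_subset fun i x hx => hx.1))

lemma sphere_le {m : ℕ} {r : ℝ} (hr : 0 < r) :
    μH[(m:ℝ)] (sphere (0:EuclideanSpace ℝ (Fin (m+1))) r) ≤
      ENNReal.ofReal ((m+1) * r^m) * hcst m * volume (ball (0:EuclideanSpace ℝ (Fin (m+1))) 1) := by
  set C := ENNReal.ofReal (r^m) * hcst m * volume (ball (0:EuclideanSpace ℝ (Fin (m+1))) 1) with hC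
  have hCt : C ≠ ⊤ := ENNReal.mul_ne_top (ENNReal.mul_ne_top ENNReal.ofReal_ne_top (hcst_ne_top m)) measure_ball_lt_top.ne
  have hlim : Tendsto (fun q : ℝ => ENNReal.ofReal ((m+1) / q^(m+1)) * C) (𝓝[<] 1) (𝓝 (ENNReal.ofReal ((m+1) / 1^(m+1)) * C)) := by
    refine ENNReal.Tendsto.mul_const (ENNReal.tendsto_ofReal (Tendsto.mono_left ?_ nhdsWithin_le_nhds)) (Or.inr hCt)
    refine Tendsto.div tendsto_const_nhds ((continuous_pow (m+1)).tendsto 1) (by simp)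
  rw [one_pow, div_one] at hlim
  have e : ENNReal.ofReal ((m+1) * r^m) * hcst m * volume (ball (0:EuclideanSpace ℝ (Fin (m+1))) 1) = ENNReal.ofReal (m+1) * C := by
    rw [hC, ENNReal.ofReal_mul (by positivity)]; ring
  rw [e]
  refine ge_of_tendsto hlim ?_
  filter_upwards [Ioo_mem_nhdsLT (zero_lt_one (α := ℝ))] with q hq
  have h := sphere_q (m := m) hq.1 hq.2 hr
  have hq0 := hq.1
  calc μH[(m:ℝ)] (sphere (0:EuclideanSpace ℝ (Fin (m+1))) r)
      = ENNReal.ofReal ((m+1) / q^(m+1)) * (ENNReal.ofReal (q^(m+1)/(m+1)) * μH[(m:ℝ)] (sphere (0:EuclideanSpace ℝ (Fin (m+1))) r)) := by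
        rw [← mul_assoc, ← ENNReal.ofReal_mul (by positivity)]
        rw [show ((m:ℝ)+1) / q^(m+1) * (q^(m+1)/(m+1)) = 1 by field_simp]
        simp
    _ ≤ _ := mul_le_mul' le_rfl h

end Sphere

theorem perim_ratio_lower_bound (n : ℕ) (hn : 0 < n) (A : Set (EuclideanSpace ℝ (Fin n)))
    (hA : MeasurableSet A) (hper : HasFinitePerimeter A Set.univ) (r : ℝ) (hr : 0 < r)
    (hsmall : volume (A ∩ ball 0 r) / volume (ball (0 : EuclideanSpace ℝ (Fin n)) r)
      ≤ deltaConst n hn) :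
    volume (A ∩ ball 0 r) / volume (ball (0 : EuclideanSpace ℝ (Fin n)) r)
      ≤ perim A (ball 0 r) / μH[(n : ℝ) - 1] (sphere (0 : EuclideanSpace ℝ (Fin n)) r) := by
  obtain ⟨m, rfl⟩ : ∃ m, n = m + 1 := ⟨n - 1, by omega⟩
  have hexp : (((m + 1 : ℕ) : ℝ) - 1) = (m : ℝ) := by push_cast; ring
  obtain ⟨-, hfin⟩ := hper
  unfold perim at hfin ⊢
  rw [hexp] at hfin ⊢
  rw [inter_univ] at hfin
  set u : EuclideanSpace ℝ (Fin (m+1)) := EuclideanSpace.single ⟨0, hn⟩ 1 with hu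
  have hun : ‖u‖ = 1 := by simp [hu]
  have hcap : capRegion (m+1) hn = ball 0 1 ∩ ball (√2 • u) 1 := by
    have : (EuclideanSpace.single (⟨0, hn⟩ : Fin (m+1)) (√2) : EuclideanSpace ℝ (Fin (m+1))) = √2 • u := by
      ext i; by_cases hi : i = ⟨0, hn⟩ <;> simp [hu, hi]
    rw [capRegion, this]
  set κ := volume (ball (0:EuclideanSpace ℝ (Fin (m+1))) 1) with hκ
  have hκ0 : κ ≠ 0 := (measure_ball_pos _ _ one_pos).ne'
  have hκt : κ ≠ ⊤ := measure_ball_lt_top.ne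
  have hB : volume (ball (0:EuclideanSpace ℝ (Fin (m+1))) r) = ENNReal.ofReal (r^(m+1)) * κ := by
    rw [Measure.addHaar_ball_of_pos _ _ hr, finrank_euclideanSpace_fin]
  have hB0 : volume (ball (0:EuclideanSpace ℝ (Fin (m+1))) r) ≠ 0 := (measure_ball_pos _ _ hr).ne'
  have hBt : volume (ball (0:EuclideanSpace ℝ (Fin (m+1))) r) ≠ ⊤ := measure_ball_lt_top.ne
  have hsm : volume (A ∩ ball 0 r) ≤ ENNReal.ofReal (r^(m+1)) * volume (ball 0 1 ∩ ball (√2 • u) 1) := by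
    rw [ENNReal.div_le_iff hB0 hBt, deltaConst, hcap, ← hκ, hB, mul_comm (ENNReal.ofReal _) κ, ← mul_assoc,
      ENNReal.div_mul_cancel hκ0 hκt, mul_comm] at hsmall
    exact hsmall
  have key := perim_lower hA hfin.ne hr hun hsm
  have hsph := sphere_le (m := m) hr
  have hc0 := hcst_ne_zero m
  have hct := hcst_ne_top m
  set k := ENNReal.ofReal ((m+1)/r) with hk
  have hk0 : k ≠ 0 := by rw [hk, ne_eq, ENNReal.ofReal_eq_zero, not_le]; positivity
  have hkt : k ≠ ⊤ := ENNReal.ofReal_ne_top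
  have hX : ENNReal.ofReal ((m+1) * r^m) * hcst m * κ = (hcst m * k) * volume (ball (0:EuclideanSpace ℝ (Fin (m+1))) r) := by
    rw [hB, hk]
    have : ENNReal.ofReal ((m+1) * r^m) = ENNReal.ofReal ((m+1)/r) * ENNReal.ofReal (r^(m+1)) := by
      rw [← ENNReal.ofReal_mul (by positivity)]
      congr 1
      field_simp
      ring
    rw [this]; ring
  rw [← hκ, hX] at hsph
  refine le_trans ?_ (ENNReal.div_le_div_left hsph _)
  have hP : hcst m * k * volume (A ∩ ball 0 r) ≤ μH[(m:ℝ)] (mBoundary A ∩ ball 0 r) := by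
    calc hcst m * k * volume (A ∩ ball 0 r) = hcst m * (k * volume (A ∩ ball 0 r)) := mul_assoc _ _ _
      _ ≤ hcst m * ((hcst m)⁻¹ * μH[(m:ℝ)] (mBoundary A ∩ ball 0 r)) := mul_le_mul' le_rfl key
      _ = _ := by rw [← mul_assoc, ENNReal.mul_inv_cancel hc0 hct, one_mul]
  refine le_trans (le_of_eq ?_) (ENNReal.div_le_div_right hP _)
  rw [ENNReal.mul_div_mul_left _ _ (mul_ne_zero hc0 hk0) (ENNReal.mul_ne_top hct hkt)]
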